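/- (Ford's multiplication table theorem) Let M(N) = #{k ≤ N : k = n·m for some positive integers n, m ≤ √N} and let δ = 1 − (1 + log log 2)/log 2 = 0.008607… . Then M(N) ≍ N / ((log N)^{δ} (log log N)^{3/2}) as N → ∞; that is, there exist constants c₁, c₂ > 0 and N₀ such that for all N ≥ N₀, c₁ · N/((log N)^{δ}(log log N)^{3/2}) ≤ M(N) ≤ c₂ · N/((log N)^{δ}(log log N)^{3/2}). -/

import Mathlib

open scoped Classical

/-- `multTableCount N` = `M(N)`, the number of integers `k ≤ N` expressible as
`k = n·m` with positive integers `n, m ≤ √N`. -/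
noncomputable def multTableCount (N : ℕ) : ℕ :=
  ((Finset.Icc 1 N).filter
    (fun k => ∃ n m : ℕ, (n : ℝ) ≤ Real.sqrt N ∧ (m : ℝ) ≤ Real.sqrt N ∧ k = n * m)).card

namespace FordMult
open Finset Real

/-- Weighted count of sequences of `n` nonnegative integers of total `k` whose partial sums `N(t)` satisfy
`N(t) ≤ t`, each integer `j` having weight `1 / j!`. -/
noncomputable def ballotLE : ℕ → ℕ → ℝ
  | 0, k => if k = 0 then 1 else 0
  | n + 1, k => if k ≤ n + 1 then ∑ x ∈ antidiagonal k, ballotLE n x.1 / (x.2.factorial : ℝ) else 0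

/-- Weighted count of sequences of `n` nonnegative integers of total `k` whose partial sums `N(t)` satisfy
`t ≤ N(t) + r`, each integer `j` having weight `1 / j!`. -/
noncomputable def ballotGE (r : ℕ) : ℕ → ℕ → ℝ
  | 0, k => if k = 0 then 1 else 0
  | n + 1, k => if n + 1 ≤ k + r then ∑ x ∈ antidiagonal k, ballotGE r n x.1 / (x.2.factorial : ℝ) else 0

theorem ballotLE_nonneg (n k : ℕ) : 0 ≤ ballotLE n k := by
  induction n generalizing k with
  | zero => unfold ballotLE; split_ifs <;> norm_num
  | succ n ih =>
    unfold ballotLE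
    split_ifs
    · exact sum_nonneg fun x _ => div_nonneg (ih _) (by positivity)
    · exact le_rfl

theorem ballotGE_nonneg (r n k : ℕ) : 0 ≤ ballotGE r n k := by
  induction n generalizing k with
  | zero => unfold ballotGE; split_ifs <;> norm_num
  | succ n ih =>
    unfold ballotGE
    split_ifs
    · exact sum_nonneg fun x _ => div_nonneg (ih _) (by positivity)
    · exact le_rfl

theorem ballotLE_eq_zero {n k : ℕ} (h : n < k) : ballotLE n k = 0 := by
  cases n with
  | zero => unfold ballotLE; rw [if_neg (by omega)]
  | succ n => unfold ballotLE; rw [if_neg (by omega)]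

theorem ballotGE_eq_zero {r n k : ℕ} (h : k + r < n) : ballotGE r n k = 0 := by
  cases n with
  | zero => omega
  | succ n => unfold ballotGE; rw [if_neg (by omega)]

theorem sum_antidiagonal_pow_div_factorial (x y : ℝ) (k : ℕ) :
    ∑ p ∈ antidiagonal k, x ^ p.1 / (p.1.factorial : ℝ) * (y ^ p.2 / (p.2.factorial : ℝ)) =
      (x + y) ^ k / (k.factorial : ℝ) := by
  rw [(Commute.all x y).add_pow', sum_div]
  refine sum_congr rfl fun p hp => ?_
  rw [HasAntidiagonal.mem_antidiagonal] at hp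
  subst hp
  have := Nat.add_choose_mul_factorial_mul_factorial p.1 p.2
  rw [← Nat.choose_symm_add] at this
  have h2 : ((p.1 + p.2).choose p.1 : ℝ) * p.1.factorial * p.2.factorial = (p.1 + p.2).factorial := by
    exact_mod_cast this
  rw [nsmul_eq_mul, ← h2]
  have h3 : ((p.1 + p.2).choose p.1 : ℝ) ≠ 0 := by
    exact_mod_cast (Nat.choose_pos (by omega)).ne'
  field_simp

theorem ballotLE_closed (n k : ℕ) (hk : k ≤ n + 1) :
    ballotLE n k = ((n : ℝ) + 1 - k) / (n + 1) * ((n + 1) ^ k / (k.factorial : ℝ)) := by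
  induction n generalizing k with
  | zero =>
    unfold ballotLE
    interval_cases k <;> norm_num
  | succ n ih =>
    by_cases hk2 : k = n + 1 + 1
    · subst hk2
      rw [ballotLE_eq_zero (by omega)]
      push_cast; ring
    have hk3 : k ≤ n + 1 := by omega
    unfold ballotLE
    rw [if_pos hk3]
    have hn : (0 : ℝ) < n + 1 := by positivity
    have h1 : ∀ x ∈ antidiagonal k, ballotLE n x.1 / (x.2.factorial : ℝ) =
        ((n : ℝ) + 1) ^ x.1 / (x.1.factorial : ℝ) * (1 ^ x.2 / (x.2.factorial : ℝ))
        - (x.1 : ℝ) / (n + 1) * (((n : ℝ) + 1) ^ x.1 / (x.1.factorial : ℝ) * (1 ^ x.2 / (x.2.factorial : ℝ))) := by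
      intro x hx
      rw [HasAntidiagonal.mem_antidiagonal] at hx
      rw [ih x.1 (by omega), one_pow]
      field_simp
    rw [sum_congr rfl h1, sum_sub_distrib, sum_antidiagonal_pow_div_factorial]
    have h2 : ∑ x ∈ antidiagonal k, (x.1 : ℝ) / (n + 1) * (((n : ℝ) + 1) ^ x.1 / (x.1.factorial : ℝ) * (1 ^ x.2 / (x.2.factorial : ℝ)))
        = (k : ℝ) * ((n : ℝ) + 2) ^ k / (n + 2) / (k.factorial : ℝ) := by
      cases k with
      | zero => simp
      | succ k =>
        rw [Nat.sum_antidiagonal_succ]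
        have h3 : ∀ x ∈ antidiagonal k, (((x.1 + 1 : ℕ) : ℝ)) / (n + 1) * (((n : ℝ) + 1) ^ (x.1 + 1) / ((x.1 + 1).factorial : ℝ) * (1 ^ x.2 / (x.2.factorial : ℝ)))
            = ((n : ℝ) + 1) ^ x.1 / (x.1.factorial : ℝ) * (1 ^ x.2 / (x.2.factorial : ℝ)) := by
          intro x _
          rw [Nat.factorial_succ]
          push_cast
          field_simp
          ring
        simp only
        rw [sum_congr rfl h3, sum_antidiagonal_pow_div_factorial, Nat.factorial_succ]
        push_cast
        have : (n : ℝ) + 2 ≠ 0 := by positivity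
        field_simp
        ring
    rw [h2]
    push_cast
    have h5 : (n : ℝ) + 1 + 1 = n + 2 := by ring
    rw [h5]
    have : (n : ℝ) + 2 ≠ 0 := by positivity
    field_simp

theorem sum_ballotLE_mul_ballotGE (s T : ℕ) :
    ∑ m ∈ range (s + 1), ballotLE s (s - m) * ballotGE 0 T (T + m) ≤ ballotLE (s + T) (s + T) := by
  induction T generalizing s with
  | zero =>
    rw [sum_range_succ']
    have : ∀ m ∈ range s, ballotLE s (s - (m + 1)) * ballotGE 0 0 (0 + (m + 1)) = 0 := by
      intro m _
      simp [ballotGE]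
    rw [sum_eq_zero this]
    simp [ballotGE]
  | succ T ih =>
    have h := ih (s + 1)
    have e : s + 1 + T = s + (T + 1) := by ring
    rw [e] at h
    refine le_trans ?_ h
    have h1 : ∀ m ∈ range (s + 1), ballotLE s (s - m) * ballotGE 0 (T + 1) (T + 1 + m) =
        ∑ m' ∈ range (s + 2), if m' ≤ m + 1 then ballotLE s (s - m) * (ballotGE 0 T (T + m') / ((m + 1 - m').factorial : ℝ)) else 0 := by
      intro m hm
      rw [mem_range] at hm
      rw [ballotGE, if_pos (by omega), mul_sum, Nat.sum_antidiagonal_eq_sum_range_succ (fun i j => ballotLE s (s - m) * (ballotGE 0 T i / (j.factorial : ℝ))),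
        ← sum_filter]
      have : ∀ i ∈ range (T + 1 + m).succ, i ∉ (range (s+2)|>.filter (fun m' => m' ≤ m + 1)).image (fun m' => T + m') →
        ballotLE s (s - m) * (ballotGE 0 T i / ((T + 1 + m - i).factorial : ℝ)) = 0 := by
        intro i hi hn
        have : i < T := by
          by_contra hc
          apply hn
          rw [mem_image]
          refine ⟨i - T, ?_, by omega⟩
          simp only [mem_filter, mem_range] at *
          omega
        rw [ballotGE_eq_zero (by omega)]
        simp
      rw [← sum_subset _ this]
      · rw [sum_image (by intro a _ b _ h; simpa using h)]
        refine sum_congr rfl fun x hx => ?_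
        have : T + 1 + m - (T + x) = m + 1 - x := by omega
        rw [this]
      · intro i hi
        simp only [mem_image, mem_filter, mem_range] at *
        omega
    rw [sum_congr rfl h1, sum_comm]
    refine sum_le_sum fun m' hm' => ?_
    rw [mem_range] at hm'
    rw [ballotLE, if_pos (by omega), sum_mul, Nat.sum_antidiagonal_eq_sum_range_succ (fun i j => ballotLE s i / (j.factorial : ℝ) * ballotGE 0 T (T + m')),
      ← sum_filter]
    have : ∑ a ∈ range (s+1) with m' ≤ a + 1, ballotLE s (s - a) * (ballotGE 0 T (T + m') / ((a + 1 - m').factorial : ℝ))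
       = ∑ i ∈ (range (s+1)|>.filter (fun a => m' ≤ a + 1)).image (fun a => s - a), ballotLE s i / ((s + 1 - m' - i).factorial : ℝ) * ballotGE 0 T (T + m') := by
      rw [sum_image]
      · refine sum_congr rfl fun x hx => ?_
        simp only [mem_filter, mem_range] at hx
        have : s + 1 - m' - (s - x) = x + 1 - m' := by omega
        rw [this]; ring
      · intro a ha b hb h
        simp only [coe_filter, Set.mem_ofPred_eq, mem_range] at ha hb
        simp only at h
        omega
    rw [this]
    refine sum_le_sum_of_subset_of_nonneg ?_ ?_
    · intro i hi
      simp only [mem_image, mem_filter, mem_range] at *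
      omega
    · intro i _ _
      exact mul_nonneg (div_nonneg (ballotLE_nonneg _ _) (by positivity)) (ballotGE_nonneg _ _ _)

theorem ballotGE_one_le (n k : ℕ) : ballotGE 1 n k ≤ 2 * ballotGE 0 (n + 1) (k + 2) := by
  induction n generalizing k with
  | zero =>
    by_cases hk : k = 0
    · subst hk
      simp [ballotGE, Nat.sum_antidiagonal_succ]
    · rw [ballotGE, if_neg hk]
      exact mul_nonneg (by norm_num) (ballotGE_nonneg _ _ _)
  | succ n ih =>
    by_cases hk : n + 1 ≤ k + 1
    · have h0 : ballotGE 0 (n + 1 + 1) (k + 1 + 1) =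
          ∑ x ∈ antidiagonal (k + 1 + 1), ballotGE 0 (n + 1) x.1 / (x.2.factorial : ℝ) := by
        conv_lhs => unfold ballotGE
        rw [if_pos (by omega)]
      rw [ballotGE, if_pos hk, h0]
      rw [Nat.sum_antidiagonal_succ, Nat.sum_antidiagonal_succ]
      have h1 : ∑ x ∈ antidiagonal k, ballotGE 1 n x.1 / (x.2.factorial : ℝ) ≤
         2 * ∑ x ∈ antidiagonal k, ballotGE 0 (n + 1) (x.1 + 1 + 1) / (x.2.factorial : ℝ) := by
        rw [mul_sum]
        refine sum_le_sum fun x _ => ?_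
        rw [← mul_div_assoc]
        gcongr
        exact ih _
      have h2 := div_nonneg (ballotGE_nonneg 0 (n+1) 0) (Nat.cast_nonneg (α := ℝ) (k+1+1).factorial)
      have h3 := div_nonneg (ballotGE_nonneg 0 (n+1) (0+1)) (Nat.cast_nonneg (α := ℝ) (k+1).factorial)
      simp only at *
      linarith
    · rw [ballotGE_eq_zero (by omega)]
      exact mul_nonneg (by norm_num) (ballotGE_nonneg _ _ _)

/-- The sequence `(n + 1) ^ (-3 / 2)`. -/
noncomputable def decay (n : ℕ) : ℝ := 1 / (((n : ℝ) + 1) * √((n : ℝ) + 1))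

theorem decay_pos (n : ℕ) : 0 < decay n := by unfold decay; positivity

theorem decay_anti {m n : ℕ} (h : m ≤ n) : decay n ≤ decay m := by
  unfold decay
  gcongr

theorem pow_div_factorial_le (n : ℕ) :
    ((n : ℝ) + 1) ^ n / (n.factorial : ℝ) ≤ 3 * exp n / √((n : ℝ) + 1) := by
  have h := Stirling.le_factorial_stirling (n + 1)
  have hf : ((n + 1).factorial : ℝ) = (n + 1) * n.factorial := by
    rw [Nat.factorial_succ]; push_cast; ring
  rw [hf] at h
  push_cast at h
  have hs : √(2 * π * ((n : ℝ) + 1)) = √(2 * π) * √((n : ℝ) + 1) := by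
    rw [sqrt_mul (by positivity)]
  have h2 : (1 : ℝ) ≤ √(2 * π) := by
    rw [one_le_sqrt]; nlinarith [pi_gt_three]
  rw [hs, div_pow, ← exp_nat_mul, pow_succ] at h
  have he : exp ((n + 1 : ℕ) * 1) = exp n * exp 1 := by
    rw [← exp_add]; push_cast; ring_nf
  rw [he] at h
  have hn : (0 : ℝ) < n + 1 := by positivity
  have h3 : √((n : ℝ) + 1) * (((n : ℝ) + 1) ^ n / (exp n * exp 1)) ≤ n.factorial := by
    have h4 : √((n : ℝ) + 1) * (((n : ℝ) + 1) ^ n / (exp n * exp 1)) * (n + 1) ≤ n.factorial * (n + 1) := by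
      calc _ ≤ √(2 * π) * (√((n : ℝ) + 1) * (((n : ℝ) + 1) ^ n / (exp n * exp 1)) * (n + 1)) :=
            le_mul_of_one_le_left (by positivity) h2
        _ = √(2 * π) * √((n : ℝ) + 1) * (((n : ℝ) + 1) ^ n * (n + 1) / (exp n * exp 1)) := by ring
        _ ≤ _ := by linarith
    exact le_of_mul_le_mul_right h4 hn
  have hf0 : (0 : ℝ) < n.factorial := by positivity
  have hsq : 0 < √((n : ℝ) + 1) := by positivity
  rw [div_le_div_iff₀ hf0 hsq]
  have h5 : √((n : ℝ) + 1) * ((n : ℝ) + 1) ^ n ≤ n.factorial * (exp n * exp 1) := by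
    rw [← mul_div_assoc, div_le_iff₀ (by positivity)] at h3
    exact h3
  have h6 : exp 1 ≤ 3 := exp_one_lt_three.le
  calc ((n : ℝ) + 1) ^ n * √((n : ℝ) + 1) ≤ n.factorial * (exp n * exp 1) := by linarith
    _ ≤ n.factorial * (exp n * 3) := by gcongr
    _ = _ := by ring

theorem le_pow_div_factorial (n : ℕ) :
    exp n / √((n : ℝ) + 1) ≤ ((n : ℝ) + 1) ^ n / (n.factorial : ℝ) := by
  have h : Stirling.stirlingSeq (n + 1) ≤ Stirling.stirlingSeq 1 :=
    Stirling.stirlingSeq'_antitone (Nat.zero_le n)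
  rw [Stirling.stirlingSeq_one] at h
  unfold Stirling.stirlingSeq at h
  have hf : ((n + 1).factorial : ℝ) = (n + 1) * n.factorial := by
    rw [Nat.factorial_succ]; push_cast; ring
  rw [hf] at h
  push_cast at h
  have hs : √(2 * ((n : ℝ) + 1)) = √2 * √((n : ℝ) + 1) := by
    rw [sqrt_mul (by positivity)]
  rw [hs, div_pow, ← exp_nat_mul, pow_succ] at h
  have he : exp ((n + 1 : ℕ) * 1) = exp n * exp 1 := by
    rw [← exp_add]; push_cast; ring_nf
  rw [he] at h
  have h2 : 0 < √(2 : ℝ) := by positivity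
  have hn : (0 : ℝ) < n + 1 := by positivity
  have hf0 : (0 : ℝ) < n.factorial := by positivity
  have hsq : 0 < √((n : ℝ) + 1) := by positivity
  rw [div_le_div_iff₀ (by positivity) h2] at h
  rw [div_le_div_iff₀ hsq hf0]
  have he1 := exp_pos 1
  have hen := exp_pos (n : ℝ)
  have h3 : (n + 1) * (n.factorial : ℝ) * √2 = (n.factorial * exp n) * ((n + 1) * √2 / exp n) := by
    field_simp
  have h4 : exp 1 * (√2 * √((n : ℝ) + 1) * (((n : ℝ) + 1) ^ n * (n + 1) / (exp n * exp 1))) =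
     (((n : ℝ) + 1) ^ n * √((n : ℝ) + 1)) * ((n + 1) * √2 / exp n) := by
    field_simp
  rw [h3, h4] at h
  have := le_of_mul_le_mul_right h (by positivity)
  linarith

theorem ballotLE_sub (n l : ℕ) (h : l ≤ n) :
    ballotLE n (n - l) = ((l : ℝ) + 1) / (n + 1) * ((n + 1) ^ (n - l) / ((n - l).factorial : ℝ)) := by
  rw [ballotLE_closed n _ (by omega), Nat.cast_sub h]
  congr 2
  ring

theorem ballotLE_le (n l : ℕ) (h : l ≤ n) :
    ballotLE n (n - l) ≤ 3 * (l + 1) * exp n * decay n := by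
  rw [ballotLE_sub n l h]
  have h1 : ((n : ℝ) + 1) ^ (n - l) / ((n - l).factorial : ℝ) ≤ ((n : ℝ) + 1) ^ n / (n.factorial : ℝ) := by
    rw [div_le_div_iff₀ (by positivity) (by positivity)]
    have h2 : (n.factorial : ℝ) ≤ (n - l).factorial * ((n : ℝ) + 1) ^ l := by
      rw [← Nat.factorial_mul_descFactorial h]
      push_cast
      gcongr
      have := Nat.descFactorial_le_pow n l
      have h3 : (n.descFactorial l : ℝ) ≤ (n : ℝ) ^ l := by exact_mod_cast this
      refine h3.trans ?_
      gcongr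
      linarith
    have h4 : ((n : ℝ) + 1) ^ n = (n + 1) ^ (n - l) * (n + 1) ^ l := by
      rw [← pow_add]; congr 1; omega
    rw [h4, mul_assoc]
    gcongr
    linarith
  calc _ ≤ ((l : ℝ) + 1) / (n + 1) * (3 * exp n / √((n : ℝ) + 1)) := by
        exact mul_le_mul_of_nonneg_left (h1.trans (pow_div_factorial_le n)) (by positivity)
    _ = _ := by
      unfold decay
      field_simp

theorem le_ballotLE_self (n : ℕ) : exp n * decay n ≤ ballotLE n n := by
  have := ballotLE_sub n 0 (Nat.zero_le _)
  simp only [Nat.sub_zero, Nat.cast_zero, zero_add] at this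
  rw [this]
  calc _ = 1 / ((n : ℝ) + 1) * (exp n / √((n : ℝ) + 1)) := by
        unfold decay; field_simp
    _ ≤ _ := mul_le_mul_of_nonneg_left (le_pow_div_factorial n) (by positivity)

theorem le_ballotLE_two_sq (m : ℕ) :
    exp ((2 * m ^ 2 : ℕ)) * decay (2 * m ^ 2) / 2 ≤ ballotLE (2 * m ^ 2) (2 * m ^ 2 - m) := by
  set s := 2 * m ^ 2 with hs
  have hms : m ≤ s := by rw [hs]; nlinarith
  rw [ballotLE_sub s m hms]
  have h1 : ((s : ℝ) + 1) ^ s / (s.factorial : ℝ) / 2 ≤ ((s : ℝ) + 1) ^ (s - m) / ((s - m).factorial : ℝ) := by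
    rw [div_div, div_le_div_iff₀ (by positivity) (by positivity)]
    have h4 : ((s : ℝ) + 1) ^ s = (s + 1) ^ (s - m) * (s + 1) ^ m := by
      rw [← pow_add]; congr 1; omega
    have h5 : ((s : ℝ) + 1) ^ m / 2 ≤ ((s + 1 - m : ℕ) : ℝ) ^ m := by
      have hb := one_add_mul_le_pow (a := -((m : ℝ) / (s + 1))) (by
        have : (m : ℝ) / (s + 1) ≤ 1 := by
          rw [div_le_one (by positivity)]
          have : (m : ℝ) ≤ s := by exact_mod_cast hms
          linarith
        linarith) m
      have h6 : (1 : ℝ) / 2 ≤ 1 + m * -((m : ℝ) / (s + 1)) := by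
        have : (m : ℝ) * (m / (s + 1)) ≤ 1 / 2 := by
          rw [← mul_div_assoc, div_le_div_iff₀ (by positivity) (by positivity)]
          have : (s : ℝ) = 2 * m ^ 2 := by rw [hs]; push_cast; ring
          rw [this]; nlinarith
        linarith
      have h7 : ((s + 1 - m : ℕ) : ℝ) = (s + 1) * (1 + -((m : ℝ) / (s + 1))) := by
        rw [Nat.cast_sub (by omega)]; push_cast; field_simp; ring
      rw [h7, mul_pow, div_eq_mul_one_div]
      gcongr
      linarith
    have h8 := Nat.pow_sub_le_descFactorial s m
    have h9 : ((s + 1 - m : ℕ) : ℝ) ^ m ≤ s.descFactorial m := by exact_mod_cast h8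
    have h10 : (s.factorial : ℝ) = (s - m).factorial * s.descFactorial m := by
      exact_mod_cast (Nat.factorial_mul_descFactorial hms).symm
    rw [h4, h10]
    have h11 : ((s : ℝ) + 1) ^ m ≤ s.descFactorial m * 2 := by linarith
    calc ((s : ℝ) + 1) ^ (s - m) * (s + 1) ^ m * ((s - m).factorial : ℝ)
        ≤ ((s : ℝ) + 1) ^ (s - m) * (s.descFactorial m * 2) * ((s - m).factorial : ℝ) := by gcongr
      _ = _ := by ring
  calc exp (s : ℝ) * decay s / 2 = 1 / ((s : ℝ) + 1) * (exp s / √((s : ℝ) + 1) / 2) := by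
        unfold decay; field_simp
    _ ≤ ((m : ℝ) + 1) / (s + 1) * (((s : ℝ) + 1) ^ s / (s.factorial : ℝ) / 2) := by
        refine mul_le_mul ?_ ?_ (by positivity) (by positivity)
        · rw [div_le_div_iff_of_pos_right (by positivity)]
          linarith [(Nat.cast_nonneg m : (0 : ℝ) ≤ m)]
        · exact div_le_div_of_nonneg_right (le_pow_div_factorial s) (by norm_num)
    _ ≤ _ := mul_le_mul_of_nonneg_left h1 (by positivity)

theorem ballotGE_le (T m : ℕ) :
    ballotGE 0 T (T + m) ≤ 24 * ((m : ℝ) + 1) ^ 4 * exp T * decay T := by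
  set s := 2 * m ^ 2 with hs
  have hms : m ≤ s := by rw [hs]; nlinarith
  have h1 : ballotLE s (s - m) * ballotGE 0 T (T + m) ≤ ballotLE (s + T) (s + T) := by
    refine le_trans ?_ (sum_ballotLE_mul_ballotGE s T)
    exact single_le_sum (f := fun m => ballotLE s (s - m) * ballotGE 0 T (T + m))
      (fun i _ => mul_nonneg (ballotLE_nonneg _ _) (ballotGE_nonneg _ _ _)) (mem_range.2 (by omega))
  have h2 := le_ballotLE_two_sq m
  rw [← hs] at h2
  have h3 := ballotLE_le (s + T) 0 (Nat.zero_le _)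
  simp only [Nat.sub_zero, Nat.cast_zero, zero_add, mul_one] at h3
  have h4 : exp s * decay s / 2 * ballotGE 0 T (T + m) ≤ 3 * exp ((s + T : ℕ) : ℝ) * decay T := by
    calc _ ≤ ballotLE s (s - m) * ballotGE 0 T (T + m) := by
          gcongr
          exact ballotGE_nonneg _ _ _
      _ ≤ _ := h1
      _ ≤ _ := h3
      _ ≤ _ := by
        gcongr
        exact decay_anti (by omega)
  have h5 : decay s * (4 * ((m : ℝ) + 1) ^ 4) ≥ 1 := by
    have hsr : (s : ℝ) + 1 = 2 * m ^ 2 + 1 := by rw [hs]; push_cast; ring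
    have h6 : √((s : ℝ) + 1) ≤ s + 1 := by
      rw [sqrt_le_left (by positivity)]
      nlinarith [(Nat.cast_nonneg s : (0 : ℝ) ≤ s)]
    unfold decay
    rw [ge_iff_le, div_mul_eq_mul_div, one_mul, le_div_iff₀ (by positivity), one_mul]
    calc ((s : ℝ) + 1) * √((s : ℝ) + 1) ≤ (s + 1) * (s + 1) := by gcongr
      _ = (2 * (m : ℝ) ^ 2 + 1) ^ 2 := by rw [hsr]; ring
      _ ≤ (2 * ((m : ℝ) + 1) ^ 2) ^ 2 := by
          have : (0 : ℝ) ≤ m := Nat.cast_nonneg m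
          gcongr
          nlinarith
      _ = _ := by ring
  have hE : exp ((s + T : ℕ) : ℝ) = exp s * exp T := by rw [← exp_add]; push_cast; rfl
  rw [hE] at h4
  have h7 : decay s * ballotGE 0 T (T + m) ≤ 6 * exp T * decay T := by
    have : exp (s : ℝ) * (decay s * ballotGE 0 T (T + m)) ≤ exp s * (6 * exp T * decay T) := by linarith
    exact le_of_mul_le_mul_left this (exp_pos _)
  calc ballotGE 0 T (T + m) ≤ decay s * (4 * ((m : ℝ) + 1) ^ 4) * ballotGE 0 T (T + m) :=
        le_mul_of_one_le_left (ballotGE_nonneg _ _ _) h5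
    _ = 4 * ((m : ℝ) + 1) ^ 4 * (decay s * ballotGE 0 T (T + m)) := by ring
    _ ≤ 4 * ((m : ℝ) + 1) ^ 4 * (6 * exp T * decay T) := by gcongr
    _ = _ := by ring

theorem sum_decay_le (n : ℕ) : ∑ i ∈ range n, decay i ≤ 3 := by
  have key : ∀ n : ℕ, ∑ i ∈ range (n + 1), decay i ≤ 3 - 2 / √((n : ℝ) + 1) := by
    intro n
    induction n with
    | zero => simp [decay]; norm_num
    | succ n ih =>
      rw [sum_range_succ]
      have h : decay (n + 1) ≤ 2 / √((n : ℝ) + 1) - 2 / √((n : ℝ) + 1 + 1) := by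
        set a := √((n : ℝ) + 1) with ha
        set b := √((n : ℝ) + 1 + 1) with hb
        have ha0 : 0 < a := by positivity
        have hb0 : 0 < b := by positivity
        have ha2 : a ^ 2 = n + 1 := sq_sqrt (by positivity)
        have hb2 : b ^ 2 = n + 1 + 1 := sq_sqrt (by positivity)
        have hd : decay (n + 1) = 1 / (b ^ 2 * b) := by
          unfold decay; push_cast; rw [hb2]
        have hab : a ≤ b := sqrt_le_sqrt (by linarith)
        have e : (b - a) * (b + a) = 1 := by nlinarith
        have e2 : 1 / (2 * b) ≤ b - a := by
          rw [div_le_iff₀ (by positivity)]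
          nlinarith
        rw [hd]
        have : 2 / a - 2 / b = 2 * (b - a) / (a * b) := by field_simp
        rw [this]
        calc 1 / (b ^ 2 * b) = 2 * (1 / (2 * b)) / (b * b) := by field_simp
          _ ≤ 2 * (b - a) / (a * b) := by gcongr
      push_cast
      linarith
  cases n with
  | zero => simp
  | succ n => 
    have := key n
    have h2 : 0 ≤ 2 / √((n : ℝ) + 1) := by positivity
    linarith

theorem decay_le_of_le_two_mul {m n : ℕ} (h : n ≤ 2 * m) : decay m ≤ 3 * decay n := by
  unfold decay
  have hm : (0 : ℝ) < m + 1 := by positivity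
  have hn : (0 : ℝ) < n + 1 := by positivity
  have h1 : (n : ℝ) + 1 ≤ 2 * (m + 1) := by
    have : (n : ℝ) ≤ 2 * m := by exact_mod_cast h
    linarith
  have h2 : √((n : ℝ) + 1) ≤ 3 / 2 * √((m : ℝ) + 1) := by
    rw [sqrt_le_left (by positivity), mul_pow, sq_sqrt hm.le]
    linarith
  rw [mul_one_div, div_le_div_iff₀ (by positivity) (by positivity), one_mul]
  calc ((n : ℝ) + 1) * √((n : ℝ) + 1) ≤ 2 * (m + 1) * (3 / 2 * √((m : ℝ) + 1)) := by gcongr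
    _ = _ := by ring

theorem sum_decay_mul_decay_le (v : ℕ) :
    ∑ T ∈ range (v + 1), decay T * decay (v - T) ≤ 18 * decay v := by
  have h : ∀ T ∈ range (v + 1), decay T * decay (v - T) ≤ 3 * decay v * decay T + 3 * decay v * decay (v - T) := by
    intro T hT
    rw [mem_range] at hT
    have p1 := decay_pos T
    have p2 := decay_pos (v - T)
    have p3 := decay_pos v
    by_cases hc : v ≤ 2 * T
    · have := decay_le_of_le_two_mul hc
      nlinarith [mul_pos p3 p1, mul_le_mul_of_nonneg_right this p2.le]
    · have := decay_le_of_le_two_mul (m := v - T) (n := v) (by omega)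
      nlinarith [mul_pos p3 p2, mul_le_mul_of_nonneg_left this p1.le]
  refine (sum_le_sum h).trans ?_
  rw [sum_add_distrib, ← mul_sum, ← mul_sum]
  have e : ∑ T ∈ range (v + 1), decay (v - T) = ∑ T ∈ range (v + 1), decay T := by
    have := sum_range_reflect decay (v + 1)
    simpa using this
  rw [e]
  have := sum_decay_le (v + 1)
  have p3 := decay_pos v
  nlinarith

theorem sum_powerset_union {α : Type*} [DecidableEq α] {S T : Finset α} (h : Disjoint S T) (f : Finset α → ℝ) :
    ∑ A ∈ (S ∪ T).powerset, f A = ∑ B ∈ S.powerset, ∑ C ∈ T.powerset, f (B ∪ C) := by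
  rw [sum_sigma']
  refine sum_bij' (fun A _ => (⟨A ∩ S, A ∩ T⟩ : (_ : Finset α) × Finset α)) (fun x _ => x.1 ∪ x.2) ?_ ?_ ?_ ?_ ?_
  · intro A hA
    simp [inter_subset_right]
  · intro x hx
    simp only [mem_sigma, mem_powerset] at hx ⊢
    exact union_subset_union hx.1 hx.2
  · intro A hA
    simp only [mem_powerset] at hA ⊢
    rw [← inter_union_distrib_left]
    exact inter_eq_left.2 hA
  · rintro ⟨B, C⟩ hx
    simp only [mem_sigma, mem_powerset] at hx ⊢
    rw [disjoint_left] at h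
    have e1 : (B ∪ C) ∩ S = B := by
      ext p; simp only [mem_inter, mem_union]
      constructor
      · rintro ⟨h1 | h1, h2⟩
        · exact h1
        · exact absurd (hx.2 h1) (h h2)
      · exact fun h1 => ⟨Or.inl h1, hx.1 h1⟩
    have e2 : (B ∪ C) ∩ T = C := by
      ext p; simp only [mem_inter, mem_union]
      constructor
      · rintro ⟨h1 | h1, h2⟩
        · exact absurd h2 (h (hx.1 h1))
        · exact h1
      · exact fun h1 => ⟨Or.inr h1, hx.2 h1⟩
    rw [e1, e2]
  · intro A hA
    simp only [mem_powerset] at hA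
    rw [← inter_union_distrib_left, inter_eq_left.2 hA]

theorem sum_powerset_sum_mem {α : Type*} [DecidableEq α] (S : Finset α) (f : Finset α → α → ℝ) :
    ∑ A ∈ S.powerset, ∑ p ∈ A, f A p = ∑ A ∈ S.powerset, ∑ p ∈ S \ A, f (insert p A) p := by
  rw [sum_sigma', sum_sigma']
  refine sum_bij' (fun x _ => (⟨x.1.erase x.2, x.2⟩ : (_ : Finset α) × α))
    (fun x _ => ⟨insert x.2 x.1, x.2⟩) ?_ ?_ ?_ ?_ ?_
  · rintro ⟨A, p⟩ hx
    simp only [mem_sigma, mem_powerset, mem_sdiff, mem_erase, ne_eq, not_true_eq_false, false_and,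
      not_false_eq_true, and_true] at hx ⊢
    exact ⟨(erase_subset _ _).trans hx.1, hx.1 hx.2⟩
  · rintro ⟨A, p⟩ hx
    simp only [mem_sigma, mem_powerset, mem_sdiff, mem_insert, true_or, and_true] at hx ⊢
    exact insert_subset hx.2.1 hx.1
  · rintro ⟨A, p⟩ hx
    simp only [mem_sigma, mem_powerset] at hx ⊢
    rw [insert_erase hx.2]
  · rintro ⟨A, p⟩ hx
    simp only [mem_sigma, mem_powerset, mem_sdiff] at hx ⊢
    rw [erase_insert hx.2.2]
  · rintro ⟨A, p⟩ hx
    simp only [mem_sigma, mem_powerset] at hx ⊢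
    rw [insert_erase hx.2]

/-- The elementary symmetric polynomial of degree `b` in the values of `w` on `S`. -/
noncomputable def esum (w : ℕ → ℝ) (S : Finset ℕ) (b : ℕ) : ℝ :=
  ∑ A ∈ S.powerset, if A.card = b then ∏ p ∈ A, w p else 0

theorem esum_nonneg {w : ℕ → ℝ} (hw : ∀ p, 0 ≤ w p) (S : Finset ℕ) (b : ℕ) : 0 ≤ esum w S b := by
  refine sum_nonneg fun A _ => ?_
  split_ifs
  · exact prod_nonneg fun p _ => hw p
  · exact le_rfl

theorem esum_zero (w : ℕ → ℝ) (S : Finset ℕ) : esum w S 0 = 1 := by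
  unfold esum
  rw [sum_eq_single ∅]
  · simp
  · intro A _ hA
    rw [if_neg (by rwa [card_eq_zero])]
  · simp

theorem esum_succ (w : ℕ → ℝ) (S : Finset ℕ) (b : ℕ) :
    ((b : ℝ) + 1) * esum w S (b + 1) =
      ∑ A ∈ S.powerset, if A.card = b then (∏ p ∈ A, w p) * ∑ p ∈ S \ A, w p else 0 := by
  have h := sum_powerset_sum_mem S (fun A p => if A.card = b + 1 then ∏ p ∈ A, w p else 0)
  have h1 : ∑ A ∈ S.powerset, ∑ p ∈ A, (if A.card = b + 1 then ∏ p ∈ A, w p else 0) =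
      ((b : ℝ) + 1) * esum w S (b + 1) := by
    unfold esum
    rw [mul_sum]
    refine sum_congr rfl fun A _ => ?_
    rw [sum_const]
    split_ifs with hA
    · rw [hA]; simp
    · simp
  rw [← h1, h]
  refine sum_congr rfl fun A _ => ?_
  split_ifs with hA
  · rw [mul_sum]
    refine sum_congr rfl fun p hp => ?_
    rw [mem_sdiff] at hp
    rw [card_insert_of_notMem hp.2, if_pos (by omega), prod_insert hp.2, mul_comm]
  · refine sum_eq_zero fun p hp => ?_
    rw [mem_sdiff] at hp
    rw [card_insert_of_notMem hp.2, if_neg (by omega)]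

theorem esum_le {w : ℕ → ℝ} (hw : ∀ p, 0 ≤ w p) {S : Finset ℕ} {c : ℝ} (hc : ∑ p ∈ S, w p ≤ c) (b : ℕ) :
    esum w S b ≤ c ^ b / (b.factorial : ℝ) := by
  have hc0 : 0 ≤ c := (sum_nonneg fun p _ => hw p).trans hc
  induction b with
  | zero => rw [esum_zero]; simp
  | succ b ih =>
    have h := esum_succ w S b
    have h1 : ((b : ℝ) + 1) * esum w S (b + 1) ≤ c * esum w S b := by
      rw [h, esum, mul_sum]
      refine sum_le_sum fun A _ => ?_
      split_ifs
      · rw [mul_comm]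
        refine mul_le_mul_of_nonneg_right ?_ (prod_nonneg fun p _ => hw p)
        exact (sum_le_sum_of_subset_of_nonneg sdiff_subset fun p _ _ => hw p).trans hc
      · simp
    rw [Nat.factorial_succ, pow_succ]
    push_cast
    have h2 : c * esum w S b ≤ c * (c ^ b / (b.factorial : ℝ)) := mul_le_mul_of_nonneg_left ih hc0
    have h3 : c ^ b * c / (((b : ℝ) + 1) * b.factorial) = (c * (c ^ b / (b.factorial : ℝ))) / (b + 1) := by
      field_simp
    rw [h3, le_div_iff₀ (by positivity)]
    linarith

theorem le_esum {w : ℕ → ℝ} (hw : ∀ p, 0 ≤ w p) {S : Finset ℕ} {μ ω : ℝ} (hμ : μ ≤ ∑ p ∈ S, w p)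
    (hω : ∀ p ∈ S, w p ≤ ω) (hω0 : 0 ≤ ω) (n : ℕ) (hn : n * ω ≤ μ) (b : ℕ) (hb : b ≤ n) :
    (μ - n * ω) ^ b / (b.factorial : ℝ) ≤ esum w S b := by
  induction b with
  | zero => rw [esum_zero]; simp
  | succ b ih =>
    have ih := ih (by omega)
    have h := esum_succ w S b
    have h1 : (μ - n * ω) * esum w S b ≤ ((b : ℝ) + 1) * esum w S (b + 1) := by
      rw [h, esum, mul_sum]
      refine sum_le_sum fun A hA => ?_
      rw [mem_powerset] at hA
      split_ifs with hcard
      · rw [mul_comm]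
        refine mul_le_mul_of_nonneg_left ?_ (prod_nonneg fun p _ => hw p)
        have h4 := sum_sdiff (f := w) hA
        have h5 : ∑ p ∈ A, w p ≤ n * ω := by
          calc ∑ p ∈ A, w p ≤ ∑ p ∈ A, ω := sum_le_sum fun p hp => hω p (hA hp)
            _ = b * ω := by rw [sum_const, hcard, nsmul_eq_mul]
            _ ≤ n * ω := by gcongr; omega
        linarith
      · simp
    rw [Nat.factorial_succ, pow_succ]
    push_cast
    have h2 := mul_le_mul_of_nonneg_left ih (sub_nonneg.2 hn)
    have h3 : (μ - n * ω) ^ b * (μ - n * ω) / (((b : ℝ) + 1) * b.factorial) =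
        ((μ - n * ω) * ((μ - n * ω) ^ b / (b.factorial : ℝ))) / (b + 1) := by
      field_simp
    rw [h3, div_le_iff₀ (by positivity)]
    linarith

/-- The union of the windows `D a, …, D (b - 1)`. -/
def winUnion (D : ℕ → Finset ℕ) (a b : ℕ) : Finset ℕ := (Ico a b).biUnion D

/-- From `a` on, no initial block of windows is overfull. -/
def SubBallot (D : ℕ → Finset ℕ) (a b : ℕ) (A : Finset ℕ) : Prop :=
  ∀ t, a ≤ t → t ≤ b → a + (A ∩ winUnion D a t).card ≤ t

/-- Up to `b`, no final block of windows is underfull, with slack `r`. -/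
def SuperBallot (D : ℕ → Finset ℕ) (r a b : ℕ) (A : Finset ℕ) : Prop :=
  ∀ t, a ≤ t → t ≤ b → b ≤ t + (A ∩ winUnion D t b).card + r

theorem winUnion_self (D : ℕ → Finset ℕ) (a : ℕ) : winUnion D a a = ∅ := by simp [winUnion]

theorem winUnion_succ_right (D : ℕ → Finset ℕ) {a b : ℕ} (h : a ≤ b) :
    winUnion D a (b + 1) = winUnion D a b ∪ D b := by
  ext p
  simp only [winUnion, mem_biUnion, mem_Ico, mem_union]
  constructor
  · rintro ⟨i, hi, hp⟩
    by_cases hib : i = b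
    · subst hib; exact Or.inr hp
    · exact Or.inl ⟨i, by omega, hp⟩
  · rintro (⟨i, hi, hp⟩ | hp)
    · exact ⟨i, by omega, hp⟩
    · exact ⟨b, by omega, hp⟩

theorem winUnion_union (D : ℕ → Finset ℕ) {a b c : ℕ} (h : a ≤ b) (h2 : b ≤ c) :
    winUnion D a c = winUnion D a b ∪ winUnion D b c := by
  ext p
  simp only [winUnion, mem_biUnion, mem_Ico, mem_union]
  constructor
  · rintro ⟨i, hi, hp⟩
    by_cases hib : i < b
    · exact Or.inl ⟨i, by omega, hp⟩
    · exact Or.inr ⟨i, by omega, hp⟩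
  · rintro (⟨i, hi, hp⟩ | ⟨i, hi, hp⟩)
    · exact ⟨i, by omega, hp⟩
    · exact ⟨i, by omega, hp⟩

theorem winUnion_one (D : ℕ → Finset ℕ) (a : ℕ) : winUnion D a (a + 1) = D a := by
  simp [winUnion]

theorem winUnion_mono (D : ℕ → Finset ℕ) {a b a' b' : ℕ} (h : a' ≤ a) (h2 : b ≤ b') :
    winUnion D a b ⊆ winUnion D a' b' :=
  biUnion_subset_biUnion_of_subset_left _ (Ico_subset_Ico h h2)

theorem disjoint_winUnion {D : ℕ → Finset ℕ} (hD : ∀ i j, i ≠ j → Disjoint (D i) (D j))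
    {a b c d : ℕ} (h : b ≤ c) : Disjoint (winUnion D a b) (winUnion D c d) := by
  rw [winUnion, winUnion, disjoint_biUnion_left]
  intro i hi
  rw [disjoint_biUnion_right]
  intro j hj
  rw [mem_Ico] at hi hj
  exact hD i j (by omega)

theorem sum_powerset_card_split (w : ℕ → ℝ) (S T : Finset ℕ) (hST : Disjoint S T) (P : Finset ℕ → Prop)
    (k : ℕ) :
    ∑ B ∈ S.powerset, ∑ C ∈ T.powerset,
      (if B.card + C.card = k ∧ P B then (∏ p ∈ B ∪ C, w p) else 0) =
    ∑ x ∈ antidiagonal k, (∑ B ∈ S.powerset, if B.card = x.1 ∧ P B then ∏ p ∈ B, w p else 0) *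
      esum w T x.2 := by
  simp_rw [esum, sum_mul_sum]
  rw [sum_comm (s := antidiagonal k)]
  refine sum_congr rfl fun B hB => ?_
  rw [sum_comm (s := antidiagonal k)]
  refine sum_congr rfl fun C hC => ?_
  rw [mem_powerset] at hB hC
  have hdis : Disjoint B C := disjoint_of_subset_left hB (disjoint_of_subset_right hC hST)
  split_ifs with h
  · rw [sum_eq_single (B.card, C.card)]
    · simp only [true_and, if_pos h.2, if_true]
      rw [prod_union hdis]
    · intro x _ hx
      by_cases h1 : B.card = x.1
      · by_cases h2 : C.card = x.2
        · exact absurd (by rw [h1, h2]) hx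
        · rw [if_neg h2, mul_zero]
      · rw [if_neg (by tauto), zero_mul]
    · intro hx
      rw [HasAntidiagonal.mem_antidiagonal] at hx
      exact absurd h.1 hx
  · symm
    refine sum_eq_zero fun x hx => ?_
    rw [HasAntidiagonal.mem_antidiagonal] at hx
    by_cases h1 : B.card = x.1 ∧ P B
    · by_cases h2 : C.card = x.2
      · exact absurd ⟨by omega, h1.2⟩ h
      · rw [if_neg h2, mul_zero]
    · rw [if_neg h1, zero_mul]

/-- Total weight of the `k`-element subsets of the windows `a, …, b - 1` satisfying `SubBallot`. -/
noncomputable def subSum (D : ℕ → Finset ℕ) (w : ℕ → ℝ) (a b k : ℕ) : ℝ :=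
  ∑ A ∈ (winUnion D a b).powerset, if A.card = k ∧ SubBallot D a b A then ∏ p ∈ A, w p else 0

/-- Total weight of the `k`-element subsets of the windows `a, …, b - 1` satisfying `SuperBallot`. -/
noncomputable def superSum (D : ℕ → Finset ℕ) (w : ℕ → ℝ) (r a b k : ℕ) : ℝ :=
  ∑ A ∈ (winUnion D a b).powerset, if A.card = k ∧ SuperBallot D r a b A then ∏ p ∈ A, w p else 0

theorem subBallot_succ {D : ℕ → Finset ℕ} (hD : ∀ i j, i ≠ j → Disjoint (D i) (D j)) {a b : ℕ} (h : a ≤ b)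
    {B C : Finset ℕ} (hB : B ⊆ winUnion D a b) (hC : C ⊆ D b) :
    SubBallot D a (b + 1) (B ∪ C) ↔ SubBallot D a b B ∧ a + (B.card + C.card) ≤ b + 1 := by
  have hd : Disjoint (winUnion D a b) (D b) := by
    rw [← winUnion_one D b]; exact disjoint_winUnion hD le_rfl
  have hdBC : Disjoint B C := disjoint_of_subset_left hB (disjoint_of_subset_right hC hd)
  have e1 : ∀ t, a ≤ t → t ≤ b → (B ∪ C) ∩ winUnion D a t = B ∩ winUnion D a t := by
    intro t _ ht
    rw [union_inter_distrib_right, union_eq_left]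
    have : C ∩ winUnion D a t = ∅ := by
      rw [← disjoint_iff_inter_eq_empty]
      exact (disjoint_of_subset_left (winUnion_mono D le_rfl ht) (disjoint_of_subset_right hC hd)).symm
    rw [this]; exact empty_subset _
  have e2 : (B ∪ C) ∩ winUnion D a (b + 1) = B ∪ C := by
    rw [inter_eq_left, winUnion_succ_right D h]
    exact union_subset_union hB hC
  constructor
  · intro hs
    refine ⟨fun t h1 h2 => ?_, ?_⟩
    · rw [← e1 t h1 h2]; exact hs t h1 (by omega)
    · have := hs (b + 1) (by omega) le_rfl
      rwa [e2, card_union_of_disjoint hdBC] at this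
  · rintro ⟨hs, hc⟩ t h1 h2
    by_cases ht : t = b + 1
    · subst ht
      rwa [e2, card_union_of_disjoint hdBC]
    · rw [e1 t h1 (by omega)]; exact hs t h1 (by omega)

theorem subSum_succ {D : ℕ → Finset ℕ} (hD : ∀ i j, i ≠ j → Disjoint (D i) (D j)) (w : ℕ → ℝ) {a b : ℕ}
    (h : a ≤ b) (k : ℕ) :
    subSum D w a (b + 1) k = if a + k ≤ b + 1 then
      ∑ x ∈ antidiagonal k, subSum D w a b x.1 * esum w (D b) x.2 else 0 := by
  have hd : Disjoint (winUnion D a b) (D b) := by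
    rw [← winUnion_one D b]; exact disjoint_winUnion hD le_rfl
  unfold subSum
  rw [winUnion_succ_right D h, sum_powerset_union hd]
  rw [← sum_powerset_card_split w _ _ hd]
  split_ifs with hk
  · refine sum_congr rfl fun B hB => sum_congr rfl fun C hC => ?_
    rw [mem_powerset] at hB hC
    have hdBC : Disjoint B C := disjoint_of_subset_left hB (disjoint_of_subset_right hC hd)
    rw [subBallot_succ hD h hB hC, card_union_of_disjoint hdBC]
    split_ifs with h1 h2 h2
    · rfl
    · exact absurd ⟨h1.1, h1.2.1⟩ h2
    · exact absurd ⟨h2.1, h2.2, by omega⟩ h1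
    · rfl
  · refine sum_eq_zero fun B hB => sum_eq_zero fun C hC => ?_
    rw [mem_powerset] at hB hC
    have hdBC : Disjoint B C := disjoint_of_subset_left hB (disjoint_of_subset_right hC hd)
    rw [subBallot_succ hD h hB hC, card_union_of_disjoint hdBC]
    rw [if_neg]
    rintro ⟨h1, h2⟩
    omega

theorem subSum_zero (D : ℕ → Finset ℕ) (w : ℕ → ℝ) (a k : ℕ) :
    subSum D w a a k = if k = 0 then 1 else 0 := by
  unfold subSum
  rw [winUnion_self]
  have : SubBallot D a a ∅ := by intro t h1 h2; simp [h1]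
  simp only [powerset_empty, sum_singleton, card_empty, prod_empty, this, and_true]
  simp [eq_comm]

theorem subSum_le {D : ℕ → Finset ℕ} (hD : ∀ i j, i ≠ j → Disjoint (D i) (D j)) {w : ℕ → ℝ}
    (hw : ∀ p, 0 ≤ w p) {c : ℝ} (hc : ∀ i, ∑ p ∈ D i, w p ≤ c) (a n k : ℕ) :
    subSum D w a (a + n) k ≤ c ^ k * ballotLE n k := by
  have hc0 : 0 ≤ c := (sum_nonneg fun p _ => hw p).trans (hc 0)
  induction n generalizing k with
  | zero =>
    rw [Nat.add_zero, subSum_zero, ballotLE]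
    split_ifs with h
    · simp [h]
    · simp
  | succ n ih =>
    rw [← Nat.add_assoc, subSum_succ hD w (by omega), ballotLE]
    by_cases hk : k ≤ n + 1
    · rw [if_pos (by omega), if_pos hk, mul_sum]
      refine sum_le_sum fun x hx => ?_
      rw [HasAntidiagonal.mem_antidiagonal] at hx
      calc _ ≤ (c ^ x.1 * ballotLE n x.1) * (c ^ x.2 / (x.2.factorial : ℝ)) :=
            mul_le_mul (ih _) (esum_le hw (hc _) _) (esum_nonneg hw _ _)
              (mul_nonneg (pow_nonneg hc0 _) (ballotLE_nonneg _ _))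
        _ = _ := by rw [← hx, pow_add]; ring
    · rw [if_neg (by omega), if_neg hk, mul_zero]

theorem subSum_nonneg (D : ℕ → Finset ℕ) {w : ℕ → ℝ} (hw : ∀ p, 0 ≤ w p) (a b k : ℕ) :
    0 ≤ subSum D w a b k := by
  refine sum_nonneg fun A _ => ?_
  split_ifs
  · exact prod_nonneg fun p _ => hw p
  · exact le_rfl

theorem le_subSum {D : ℕ → Finset ℕ} (hD : ∀ i j, i ≠ j → Disjoint (D i) (D j)) {w : ℕ → ℝ}
    (hw : ∀ p, 0 ≤ w p) {c : ℝ} (hc : 0 ≤ c) {θ : ℕ → ℝ} (hθ : ∀ i, 0 ≤ θ i)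
    (he : ∀ i b, b ≤ i + 1 → θ i * (c ^ b / (b.factorial : ℝ)) ≤ esum w (D i) b) (n k : ℕ) :
    (∏ i ∈ range n, θ i) * (c ^ k * ballotLE n k) ≤ subSum D w 0 n k := by
  induction n generalizing k with
  | zero =>
    rw [subSum_zero, ballotLE]
    split_ifs with h
    · simp [h]
    · simp
  | succ n ih =>
    rw [subSum_succ hD w (by omega), ballotLE]
    by_cases hk : k ≤ n + 1
    · rw [if_pos hk, if_pos (by omega), mul_sum, mul_sum]
      refine sum_le_sum fun x hx => ?_
      rw [HasAntidiagonal.mem_antidiagonal] at hx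
      calc _ = ((∏ i ∈ range n, θ i) * (c ^ x.1 * ballotLE n x.1)) * (θ n * (c ^ x.2 / (x.2.factorial : ℝ))) := by
            rw [← hx, pow_add, prod_range_succ]; ring
        _ ≤ _ := by
          refine mul_le_mul (ih _) (he _ _ (by omega)) ?_ (subSum_nonneg D hw _ _ _)
          exact mul_nonneg (hθ _) (by positivity)
    · rw [if_neg hk, if_neg (by omega), mul_zero, mul_zero]

theorem winUnion_succ_left (D : ℕ → Finset ℕ) {a b : ℕ} (h : a < b) :
    winUnion D a b = D a ∪ winUnion D (a + 1) b := by
  rw [winUnion_union D (by omega : a ≤ a + 1) h, winUnion_one]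

theorem superBallot_succ {D : ℕ → Finset ℕ} (hD : ∀ i j, i ≠ j → Disjoint (D i) (D j)) {r a b : ℕ} (h : a < b)
    {B C : Finset ℕ} (hB : B ⊆ winUnion D (a + 1) b) (hC : C ⊆ D a) :
    SuperBallot D r a b (B ∪ C) ↔ SuperBallot D r (a + 1) b B ∧ b ≤ a + (B.card + C.card) + r := by
  have hd : Disjoint (winUnion D (a + 1) b) (D a) := by
    rw [← winUnion_one D a]; exact (disjoint_winUnion hD le_rfl).symm
  have hdBC : Disjoint B C := disjoint_of_subset_left hB (disjoint_of_subset_right hC hd)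
  have e1 : ∀ t, a + 1 ≤ t → (B ∪ C) ∩ winUnion D t b = B ∩ winUnion D t b := by
    intro t ht
    rw [union_inter_distrib_right, union_eq_left]
    have : C ∩ winUnion D t b = ∅ := by
      rw [← disjoint_iff_inter_eq_empty]
      exact (disjoint_of_subset_left (winUnion_mono D ht le_rfl) (disjoint_of_subset_right hC hd)).symm
    rw [this]; exact empty_subset _
  have e2 : (B ∪ C) ∩ winUnion D a b = B ∪ C := by
    rw [inter_eq_left, winUnion_succ_left D h, union_comm B C]
    exact union_subset_union hC hB
  constructor
  · intro hs
    refine ⟨fun t h1 h2 => ?_, ?_⟩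
    · rw [← e1 t h1]; exact hs t (by omega) h2
    · have := hs a le_rfl (by omega)
      rwa [e2, card_union_of_disjoint hdBC] at this
  · rintro ⟨hs, hc⟩ t h1 h2
    by_cases ht : t = a
    · subst ht
      rwa [e2, card_union_of_disjoint hdBC]
    · rw [e1 t (by omega)]; exact hs t (by omega) h2

theorem superSum_succ {D : ℕ → Finset ℕ} (hD : ∀ i j, i ≠ j → Disjoint (D i) (D j)) (w : ℕ → ℝ) {a b : ℕ}
    (h : a < b) (r k : ℕ) :
    superSum D w r a b k = if b ≤ a + k + r then
      ∑ x ∈ antidiagonal k, superSum D w r (a + 1) b x.1 * esum w (D a) x.2 else 0 := by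
  have hd : Disjoint (winUnion D (a + 1) b) (D a) := by
    rw [← winUnion_one D a]; exact (disjoint_winUnion hD le_rfl).symm
  unfold superSum
  rw [winUnion_succ_left D h, union_comm, sum_powerset_union hd]
  rw [← sum_powerset_card_split w _ _ hd]
  split_ifs with hk
  · refine sum_congr rfl fun B hB => sum_congr rfl fun C hC => ?_
    rw [mem_powerset] at hB hC
    have hdBC : Disjoint B C := disjoint_of_subset_left hB (disjoint_of_subset_right hC hd)
    rw [superBallot_succ hD h hB hC, card_union_of_disjoint hdBC]
    split_ifs with h1 h2 h2
    · rfl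
    · exact absurd ⟨h1.1, h1.2.1⟩ h2
    · exact absurd ⟨h2.1, h2.2, by omega⟩ h1
    · rfl
  · refine sum_eq_zero fun B hB => sum_eq_zero fun C hC => ?_
    rw [mem_powerset] at hB hC
    have hdBC : Disjoint B C := disjoint_of_subset_left hB (disjoint_of_subset_right hC hd)
    rw [superBallot_succ hD h hB hC, card_union_of_disjoint hdBC]
    rw [if_neg]
    rintro ⟨h1, h2⟩
    omega

theorem superSum_zero (D : ℕ → Finset ℕ) (w : ℕ → ℝ) (r a k : ℕ) :
    superSum D w r a a k = if k = 0 then 1 else 0 := by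
  unfold superSum
  rw [winUnion_self]
  have : SuperBallot D r a a ∅ := by intro t h1 h2; omega
  simp only [powerset_empty, sum_singleton, card_empty, prod_empty, this, and_true]
  simp [eq_comm]

theorem superSum_le {D : ℕ → Finset ℕ} (hD : ∀ i j, i ≠ j → Disjoint (D i) (D j)) {w : ℕ → ℝ}
    (hw : ∀ p, 0 ≤ w p) {c : ℝ} (hc : ∀ i, ∑ p ∈ D i, w p ≤ c) (r a n k : ℕ) :
    superSum D w r a (a + n) k ≤ c ^ k * ballotGE r n k := by
  have hc0 : 0 ≤ c := (sum_nonneg fun p _ => hw p).trans (hc 0)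
  induction n generalizing k a with
  | zero =>
    rw [Nat.add_zero, superSum_zero, ballotGE]
    split_ifs with h
    · simp [h]
    · simp
  | succ n ih =>
    rw [superSum_succ hD w (by omega), ballotGE]
    by_cases hk : n + 1 ≤ k + r
    · rw [if_pos (by omega), if_pos hk, mul_sum]
      refine sum_le_sum fun x hx => ?_
      rw [HasAntidiagonal.mem_antidiagonal] at hx
      have e : a + (n + 1) = a + 1 + n := by ring
      rw [e]
      calc _ ≤ (c ^ x.1 * ballotGE r n x.1) * (c ^ x.2 / (x.2.factorial : ℝ)) :=
            mul_le_mul (ih _ _) (esum_le hw (hc _) _) (esum_nonneg hw _ _)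
              (mul_nonneg (pow_nonneg hc0 _) (ballotGE_nonneg _ _ _))
        _ = _ := by rw [← hx, pow_add]; ring
    · rw [if_neg (by omega), if_neg hk, mul_zero]

theorem log_factorial_ge (n : ℕ) : n * log n - n ≤ log (n.factorial : ℝ) := by
  induction n with
  | zero => simp
  | succ n ih =>
    rw [Nat.factorial_succ]
    push_cast
    rw [log_mul (by positivity) (by positivity)]
    rcases Nat.eq_zero_or_pos n with h | h
    · subst h; simp
    · have hn : (0 : ℝ) < n := by exact_mod_cast h
      have h1 : log ((n : ℝ) + 1) - log n ≤ 1 / n := by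
        rw [← log_div (by positivity) (by positivity)]
        have := log_le_sub_one_of_pos (x := ((n : ℝ) + 1) / n) (by positivity)
        have e : ((n : ℝ) + 1) / n - 1 = 1 / n := by field_simp; ring
        linarith
      have h2 : n * (log ((n : ℝ) + 1) - log n) ≤ 1 := by
        calc _ ≤ n * (1 / (n : ℝ)) := by gcongr
          _ = 1 := by field_simp
      nlinarith

theorem log_factorial_le (n : ℕ) : log (n.factorial : ℝ) ≤ n * log n := by
  rw [← log_pow]
  refine log_le_log (by positivity) ?_
  exact_mod_cast Nat.factorial_le_pow n

theorem log_factorial_eq (n : ℕ) :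
    log (n.factorial : ℝ) = ∑ p ∈ (Icc 1 n).filter Nat.Prime, (n.factorial.factorization p : ℝ) * log p := by
  rw [log_nat_eq_sum_factorization, Finsupp.sum]
  refine sum_subset_zero_on_sdiff ?_ ?_ (fun _ _ => rfl)
  · intro p hp
    rw [Nat.support_factorization, Nat.mem_primeFactors] at hp
    rw [mem_filter, mem_Icc]
    exact ⟨⟨hp.1.one_lt.le, (hp.1.dvd_factorial).1 hp.2.1⟩, hp.1⟩
  · intro p hp
    rw [mem_sdiff, Finsupp.notMem_support_iff] at hp
    rw [hp.2]; simp

theorem theta_nat (n : ℕ) : Chebyshev.theta n = ∑ p ∈ (Icc 1 n).filter Nat.Prime, log p := by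
  rw [Chebyshev.theta_eq_sum_Icc, Nat.floor_natCast]
  refine sum_congr ?_ fun _ _ => rfl
  ext p
  simp only [mem_filter, mem_Icc]
  constructor
  · rintro ⟨h, h2⟩; exact ⟨⟨h2.one_lt.le, h.2⟩, h2⟩
  · rintro ⟨h, h2⟩; exact ⟨⟨Nat.zero_le _, h.2⟩, h2⟩

/-- Mertens' first theorem. -/
theorem abs_sum_log_div_sub_log_le {n : ℕ} (hn : 1 ≤ n) :
    |∑ p ∈ (Icc 1 n).filter Nat.Prime, log p / p - log n| ≤ 13 := by
  have hn0 : (0 : ℝ) < n := by exact_mod_cast hn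
  rw [abs_le]
  constructor
  · have h1 : (n : ℝ) * log n - n ≤ n * ∑ p ∈ (Icc 1 n).filter Nat.Prime, log p / p + n * 12 := by
      refine (log_factorial_ge n).trans ?_
      rw [log_factorial_eq]
      have h2 : ∀ p ∈ (Icc 1 n).filter Nat.Prime, (n.factorial.factorization p : ℝ) * log p ≤
          n * (log p / p) + n * (4 * decay (p - 1)) := by
        intro p hp
        rw [mem_filter] at hp
        have hp2 := hp.2.two_le
        have hpr : (2 : ℝ) ≤ p := by exact_mod_cast hp2
        have hlog : 0 ≤ log (p : ℝ) := log_nonneg (by linarith)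
        have h3 : (n.factorial.factorization p : ℝ) ≤ n / (p - 1) := by
          have h4 := Nat.factorization_factorial_le_div_pred hp.2 n
          calc (n.factorial.factorization p : ℝ) ≤ ((n / (p - 1) : ℕ) : ℝ) := by exact_mod_cast h4
            _ ≤ (n : ℝ) / ((p - 1 : ℕ) : ℝ) := Nat.cast_div_le
            _ = _ := by rw [Nat.cast_sub (by omega)]; simp
        have h5 : log (p : ℝ) ≤ 2 * √p := by
          have h6 : (p : ℝ) = √p ^ 2 := (sq_sqrt (by linarith)).symm
          have h7 : log (√(p : ℝ)) ≤ √p - 1 := log_le_sub_one_of_pos (by positivity)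
          rw [h6, log_pow]
          push_cast
          rw [sqrt_sq (sqrt_nonneg _)]
          linarith
        have h8 : decay (p - 1) = 1 / (p * √p) := by
          unfold decay
          rw [Nat.cast_sub (by omega)]; simp
        have hs : 0 < √(p : ℝ) := by positivity
        calc (n.factorial.factorization p : ℝ) * log p ≤ n / (p - 1) * log p := by gcongr
          _ = n * (log p / p) + n * (log p / (p * (p - 1))) := by
            have : (p : ℝ) - 1 ≠ 0 := by linarith
            field_simp; ring
          _ ≤ n * (log p / p) + n * (4 * decay (p - 1)) := by
            refine add_le_add le_rfl (mul_le_mul_of_nonneg_left ?_ hn0.le)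
            rw [h8, mul_one_div, div_le_div_iff₀ (mul_pos (by linarith) (by linarith)) (by positivity)]
            have h9 : √(p : ℝ) * √p = p := mul_self_sqrt (by linarith)
            calc log (p : ℝ) * (p * √p) ≤ 2 * √p * (p * √p) := by gcongr
              _ = 2 * p * (√p * √p) := by ring
              _ = 2 * p * p := by rw [h9]
              _ ≤ _ := by nlinarith
      refine (sum_le_sum h2).trans ?_
      rw [sum_add_distrib, ← mul_sum, ← mul_sum, ← mul_sum]
      refine add_le_add le_rfl (mul_le_mul_of_nonneg_left ?_ hn0.le)
      have h10 : ∑ p ∈ (Icc 1 n).filter Nat.Prime, decay (p - 1) ≤ ∑ i ∈ range n, decay i := by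
        calc _ ≤ ∑ p ∈ Icc 1 n, decay (p - 1) :=
              sum_le_sum_of_subset_of_nonneg (filter_subset _ _) fun _ _ _ => (decay_pos _).le
          _ = _ := by
            rw [range_eq_Ico, sum_Ico_eq_sum_range]
            rw [← Finset.Ico_succ_right_eq_Icc, sum_Ico_eq_sum_range]
            simp
      linarith [sum_decay_le n]
    have h11 : n * (log n - 13) ≤ n * ∑ p ∈ (Icc 1 n).filter Nat.Prime, log p / p := by linarith
    have := le_of_mul_le_mul_left h11 hn0
    linarith
  · have h1 : (n : ℝ) * ∑ p ∈ (Icc 1 n).filter Nat.Prime, log p / p - Chebyshev.theta n ≤ n * log n := by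
      refine le_trans ?_ (log_factorial_le n)
      rw [log_factorial_eq, theta_nat, mul_sum, ← sum_sub_distrib]
      refine sum_le_sum fun p hp => ?_
      rw [mem_filter] at hp
      have hp2 := hp.2.two_le
      have hpr : (2 : ℝ) ≤ p := by exact_mod_cast hp2
      have hlog : 0 ≤ log (p : ℝ) := log_nonneg (by linarith)
      have h3 : (n : ℝ) / p - 1 ≤ n.factorial.factorization p := by
        have h4 : n / p ≤ n.factorial.factorization p := by
          have hd : (p * (n / p)).factorial ∣ n.factorial := Nat.factorial_dvd_factorial (Nat.mul_div_le n p)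
          have h5 := (Nat.factorization_le_iff_dvd (Nat.factorial_ne_zero _) (Nat.factorial_ne_zero _)).2 hd p
          rw [Nat.factorization_factorial_mul hp.2] at h5
          omega
        have h6 : (n : ℝ) / p < (n / p : ℕ) + 1 := by
          rw [div_lt_iff₀ (by linarith)]
          have := Nat.lt_div_mul_add (a := n) hp.2.pos
          have h7 : (n : ℝ) < (n / p : ℕ) * p + p := by exact_mod_cast this
          linarith
        have h8 : ((n / p : ℕ) : ℝ) ≤ n.factorial.factorization p := by exact_mod_cast h4
        linarith
      calc (n : ℝ) * (log p / p) - log p = (n / p - 1) * log p := by ring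
        _ ≤ _ := by gcongr
    have h2 := Chebyshev.theta_le_log4_mul_x (x := n) hn0.le
    have h3 : log 4 ≤ 13 := by
      have := log_le_sub_one_of_pos (x := 4) (by norm_num)
      linarith
    have h4 : (n : ℝ) * ∑ p ∈ (Icc 1 n).filter Nat.Prime, log p / p ≤ n * (log n + 13) := by nlinarith
    have := le_of_mul_le_mul_left h4 hn0
    linarith

/-- Mertens' second theorem, between two integers. -/
theorem abs_sum_prime_inv_sub_le {a b : ℕ} (ha : 2 ≤ a) (hab : a ≤ b) :
    |∑ p ∈ (Ioc a b).filter Nat.Prime, 1 / (p : ℝ) - (log (log b) - log (log a))| ≤ 40 / log a := by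
  set R : ℕ → ℝ := fun n => ∑ p ∈ (Icc 1 n).filter Nat.Prime, log p / p - log n with hR
  have hRb : ∀ n, a ≤ n → |R n| ≤ 13 := fun n hn => abs_sum_log_div_sub_log_le (by omega)
  have hl : ∀ n : ℕ, a ≤ n → 0 < log (n : ℝ) := fun n hn => log_pos (by exact_mod_cast (by omega : 1 < n))
  have hmain : ∀ n, a ≤ n → |∑ p ∈ (Ioc a n).filter Nat.Prime, 1 / (p : ℝ) - (log (log n) - log (log a))
      - (R n / log n - R a / log a)| ≤ 14 * (1 / log a - 1 / log n) := by
    intro n hn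
    induction n, hn using Nat.le_induction with
    | base => simp
    | succ n hn ih =>
      have h1 := hl n hn
      have h2 := hl (n + 1) (by omega)
      have h0 := hl a le_rfl
      have hn1 : (2 : ℝ) ≤ n := by exact_mod_cast ha.trans hn
      have hb := hRb n hn
      have hΔ : log ((n + 1 : ℕ) : ℝ) - log n ≤ 1 := by
        rw [← log_div (by positivity) (by positivity)]
        have := log_le_sub_one_of_pos (x := ((n + 1 : ℕ) : ℝ) / n) (by positivity)
        have e : ((n + 1 : ℕ) : ℝ) / n - 1 = 1 / n := by push_cast; field_simp; ring
        have : 1 / (n : ℝ) ≤ 1 := by rw [div_le_one (by linarith)]; linarith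
        linarith
      have hmono : log (n : ℝ) ≤ log ((n + 1 : ℕ) : ℝ) := log_le_log (by linarith) (by push_cast; linarith)
      set c : ℝ := if (n + 1).Prime then log ((n + 1 : ℕ) : ℝ) / ((n + 1 : ℕ) : ℝ) else 0 with hc
      have hRs : R (n + 1) = R n + c - (log ((n + 1 : ℕ) : ℝ) - log n) := by
        simp only [hR]
        rw [sum_filter, sum_filter, sum_Icc_succ_top (by omega)]
        ring
      have hPs : ∑ p ∈ (Ioc a (n + 1)).filter Nat.Prime, 1 / (p : ℝ) =
          ∑ p ∈ (Ioc a n).filter Nat.Prime, 1 / (p : ℝ) + c / log ((n + 1 : ℕ) : ℝ) := by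
        rw [sum_filter, sum_filter, sum_Ioc_succ_top hn]
        congr 1
        rw [hc]
        split_ifs
        · field_simp
        · simp
      rw [hRs, hPs]
      set x := log (n : ℝ) with hx
      set y := log ((n + 1 : ℕ) : ℝ) with hy
      have hll : log y - log x ≤ (y - x) / x := by
        rw [← log_div h2.ne' h1.ne']
        have := log_le_sub_one_of_pos (x := y / x) (by positivity)
        have e : y / x - 1 = (y - x) / x := by field_simp
        linarith
      have hll2 : (y - x) / y ≤ log y - log x := by
        rw [← log_div h2.ne' h1.ne', ← neg_le_neg_iff, ← log_inv, inv_div]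
        have := log_le_sub_one_of_pos (x := x / y) (by positivity)
        have e : x / y - 1 = -((y - x) / y) := by field_simp; ring
        linarith
      have hfd : 0 ≤ 1 / x - 1 / y := by
        rw [sub_nonneg]; exact one_div_le_one_div_of_le h1 hmono
      have h5 : |R n * (1 / x - 1 / y)| ≤ 13 * (1 / x - 1 / y) := by
        rw [abs_mul, abs_of_nonneg hfd]; gcongr
      have h6 : (y - x) / x - (y - x) / y ≤ 1 / x - 1 / y := by
        have : (y - x) / x - (y - x) / y = (y - x) * (1 / x - 1 / y) := by ring
        rw [this]
        exact mul_le_of_le_one_left hfd hΔ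
      have e2 : (R n + c - (y - x)) / y = R n / y + c / y - (y - x) / y := by ring
      rw [e2]
      have e3 : R n * (1 / x - 1 / y) = R n / x - R n / y := by ring
      rw [e3] at h5
      rw [abs_le] at ih h5 ⊢
      constructor <;> linarith
  have h := hmain b hab
  have h0 := hl a le_rfl
  have h1 := hl b hab
  have h2 : log (a : ℝ) ≤ log b := log_le_log (by exact_mod_cast (by omega : 0 < a)) (by exact_mod_cast hab)
  have h3 : |R b / log b| ≤ 13 / log a := by
    rw [abs_div, abs_of_pos h1]
    exact div_le_div₀ (by norm_num) (hRb b hab) h0 h2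
  have h4 : |R a / log a| ≤ 13 / log a := by
    rw [abs_div, abs_of_pos h0]
    exact div_le_div_of_nonneg_right (hRb a le_rfl) h0.le
  have h5 : 0 < 1 / log (b : ℝ) := by positivity
  have e : 40 / log (a : ℝ) = 14 * (1 / log a) + 13 / log a + 13 / log a := by ring
  rw [e]
  rw [abs_le] at *
  constructor <;> linarith

/-- The primes in the interval `(a, b]`. -/
noncomputable def primesIoc (a b : ℝ) : Finset ℕ := (Ioc ⌊a⌋₊ ⌊b⌋₊).filter Nat.Prime

theorem mem_primesIoc {a b : ℝ} (ha : 0 ≤ a) (hb : 0 ≤ b) {p : ℕ} :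
    p ∈ primesIoc a b ↔ p.Prime ∧ a < p ∧ (p : ℝ) ≤ b := by
  rw [primesIoc, mem_filter, mem_Ioc, Nat.floor_lt ha, Nat.le_floor_iff hb]
  tauto

/-- Mertens' second theorem on a logarithmic scale. -/
theorem abs_sum_primesIoc_exp_sub_le {x y : ℝ} (hx : 1 ≤ x) (hxy : x ≤ y) :
    |∑ p ∈ primesIoc (exp x) (exp y), 1 / (p : ℝ) - log (y / x)| ≤ 84 / x := by
  have key : ∀ z : ℝ, 1 ≤ z → 2 ≤ ⌊exp z⌋₊ ∧ log ⌊exp z⌋₊ ≤ z ∧ z / 2 ≤ log ⌊exp z⌋₊ ∧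
      |log z - log (log ⌊exp z⌋₊)| ≤ 2 / z := by
    intro z hz
    have h1 : 2 ≤ ⌊exp z⌋₊ := by
      rw [Nat.le_floor_iff (exp_pos z).le]
      push_cast
      linarith [add_one_le_exp z]
    have h1r : (2 : ℝ) ≤ ⌊exp z⌋₊ := by exact_mod_cast h1
    have h2 : log ⌊exp z⌋₊ ≤ z := by
      rw [log_le_iff_le_exp (by linarith)]
      exact Nat.floor_le (exp_pos z).le
    have h3 : exp z < ⌊exp z⌋₊ + 1 := Nat.lt_floor_add_one _
    have h4 : z - log ⌊exp z⌋₊ ≤ 1 / 2 := by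
      have h5 : z ≤ log (⌊exp z⌋₊ + 1) := by
        rw [le_log_iff_exp_le (by linarith)]; exact h3.le
      have h6 : log ((⌊exp z⌋₊ : ℝ) + 1) - log ⌊exp z⌋₊ ≤ 1 / 2 := by
        rw [← log_div (by positivity) (by positivity)]
        have := log_le_sub_one_of_pos (x := ((⌊exp z⌋₊ : ℝ) + 1) / ⌊exp z⌋₊) (by positivity)
        have e : ((⌊exp z⌋₊ : ℝ) + 1) / ⌊exp z⌋₊ - 1 = 1 / ⌊exp z⌋₊ := by field_simp; ring
        have : 1 / (⌊exp z⌋₊ : ℝ) ≤ 1 / 2 := one_div_le_one_div_of_le (by norm_num) h1r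
        linarith
      linarith
    have h7 : z / 2 ≤ log ⌊exp z⌋₊ := by linarith
    refine ⟨h1, h2, h7, ?_⟩
    have h8 : 0 < log (⌊exp z⌋₊ : ℝ) := by linarith
    rw [abs_of_nonneg (by rw [sub_nonneg]; exact log_le_log h8 h2), ← log_div (by linarith) h8.ne']
    have := log_le_sub_one_of_pos (x := z / log ⌊exp z⌋₊) (by positivity)
    have e : z / log ⌊exp z⌋₊ - 1 = (z - log ⌊exp z⌋₊) / log ⌊exp z⌋₊ := by field_simp
    have h9 : (z - log ⌊exp z⌋₊) / log ⌊exp z⌋₊ ≤ (1 / 2) / (z / 2) := by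
      refine div_le_div₀ (by norm_num) h4 (by linarith) h7
    have e2 : (1 / 2) / (z / 2) = 1 / z := by field_simp
    have h10 : 1 / z ≤ 2 / z := by gcongr; norm_num
    linarith
  obtain ⟨a1, a2, a3, a4⟩ := key x hx
  obtain ⟨b1, b2, b3, b4⟩ := key y (hx.trans hxy)
  have h := abs_sum_prime_inv_sub_le a1 (Nat.floor_mono (exp_le_exp.2 hxy))
  have h1 : 40 / log (⌊exp x⌋₊ : ℝ) ≤ 80 / x := by
    rw [div_le_div_iff₀ (by linarith) (by linarith)]; linarith
  have h2 : 2 / y ≤ 2 / x := div_le_div_of_nonneg_left (by norm_num) (by linarith) hxy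
  rw [log_div (by linarith) (by linarith), primesIoc]
  have e : 84 / x = 80 / x + 2 / x + 2 / x := by ring
  rw [e]
  rw [abs_le] at *
  constructor <;> linarith

theorem log_two_gt : (1 : ℝ) / 2 < log 2 := by linarith [log_two_gt_d9]

theorem log_two_lt : log 2 < (7 : ℝ) / 10 := by linarith [log_two_lt_d9]

/-- Logarithms of the end points of the windows. -/
noncomputable def winX (i : ℕ) : ℝ := 12144 * 2 ^ i + 168

theorem winX_succ (i : ℕ) : winX (i + 1) = 2 * winX i - 168 := by
  unfold winX; rw [pow_succ]; ring

theorem winX_ge (i : ℕ) : 12144 * 2 ^ i ≤ winX i := by unfold winX; linarith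

theorem winX_le (i : ℕ) : winX i ≤ 2 ^ 14 * 2 ^ i := by
  unfold winX
  have : (1 : ℝ) ≤ 2 ^ i := one_le_pow₀ (by norm_num)
  linarith

theorem two_pow_le_winX (i : ℕ) : 2 ^ i ≤ winX i := by
  have : (1 : ℝ) ≤ 2 ^ i := one_le_pow₀ (by norm_num)
  linarith [winX_ge i]

theorem winX_big (i : ℕ) : 12144 ≤ winX i := by
  have : (1 : ℝ) ≤ 2 ^ i := one_le_pow₀ (by norm_num)
  linarith [winX_ge i]

theorem winX_mono {i j : ℕ} (h : i ≤ j) : winX i ≤ winX j := by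
  unfold winX
  have : (2 : ℝ) ^ i ≤ 2 ^ j := pow_le_pow_right₀ (by norm_num) h
  linarith

/-- The windows of primes. -/
noncomputable def winD (i : ℕ) : Finset ℕ := primesIoc (exp (winX i)) (exp (winX (i + 1)))

theorem mem_winD {i p : ℕ} :
    p ∈ winD i ↔ p.Prime ∧ exp (winX i) < p ∧ (p : ℝ) ≤ exp (winX (i + 1)) :=
  mem_primesIoc (exp_pos _).le (exp_pos _).le

theorem mem_winD_log {i p : ℕ} :
    p ∈ winD i ↔ p.Prime ∧ winX i < log p ∧ log p ≤ winX (i + 1) := by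
  rw [mem_winD]
  refine and_congr_right fun hp => ?_
  have : (0 : ℝ) < p := by exact_mod_cast hp.pos
  rw [lt_log_iff_exp_lt this, log_le_iff_le_exp this]

theorem disjoint_winD (i j : ℕ) (h : i ≠ j) : Disjoint (winD i) (winD j) := by
  rw [disjoint_left]
  intro p hi hj
  rw [mem_winD_log] at hi hj
  rcases lt_or_gt_of_ne h with h | h
  · linarith [winX_mono (show i + 1 ≤ j from h)]
  · linarith [winX_mono (show j + 1 ≤ i from h)]

theorem mem_winUnion_winD {a b p : ℕ} (hab : a ≤ b) :
    p ∈ winUnion winD a b ↔ p.Prime ∧ winX a < log p ∧ log p ≤ winX b := by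
  induction b, hab using Nat.le_induction with
  | base =>
    rw [winUnion_self]
    constructor
    · intro h; simp at h
    · rintro ⟨_, h1, h2⟩; linarith
  | succ b hb ih =>
    rw [winUnion_succ_right _ hb, mem_union, ih, mem_winD_log]
    have h1 := winX_mono hb
    have h2 := winX_mono (Nat.le_succ b)
    constructor
    · rintro (⟨h, h3, h4⟩ | ⟨h, h3, h4⟩)
      · exact ⟨h, h3, h4.trans h2⟩
      · exact ⟨h, by linarith, h4⟩
    · rintro ⟨h, h3, h4⟩
      by_cases h5 : log (p : ℝ) ≤ winX b
      · exact Or.inl ⟨h, h3, h5⟩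
      · exact Or.inr ⟨h, by linarith, h4⟩

/-- The weight `1 / p`. -/
noncomputable def invw (p : ℕ) : ℝ := 1 / (p : ℝ)

theorem invw_nonneg (p : ℕ) : 0 ≤ invw p := by unfold invw; positivity

theorem abs_sum_winD_sub (i : ℕ) :
    |∑ p ∈ winD i, invw p - log (winX (i + 1) / winX i)| ≤ 84 / winX i := by
  have := winX_big i
  exact abs_sum_primesIoc_exp_sub_le (by linarith) (winX_mono (Nat.le_succ i))

theorem sum_winD_le (i : ℕ) : ∑ p ∈ winD i, invw p ≤ log 2 := by
  have h := abs_sum_winD_sub i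
  have hb := winX_big i
  rw [winX_succ] at h
  have e : (2 * winX i - 168) / winX i = 2 * (1 - 84 / winX i) := by
    have : winX i ≠ 0 := by linarith
    field_simp; ring
  have h2 : 84 / winX i < 1 := by rw [div_lt_one (by linarith)]; linarith
  rw [e, log_mul (by norm_num) (by linarith)] at h
  have := log_le_sub_one_of_pos (x := 1 - 84 / winX i) (by linarith)
  rw [abs_le] at h
  linarith

theorem le_sum_winD (i : ℕ) : log 2 - 252 / winX i ≤ ∑ p ∈ winD i, invw p := by
  have h := abs_sum_winD_sub i
  have hb := winX_big i
  rw [winX_succ] at h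
  set t := 84 / winX i with ht
  have e : (2 * winX i - 168) / winX i = 2 * (1 - t) := by
    have : winX i ≠ 0 := by linarith
    rw [ht]; field_simp; ring
  have ht0 : 0 ≤ t := by rw [ht]; exact div_nonneg (by norm_num) (by linarith)
  have h2 : t ≤ 1 / 2 := by rw [ht, div_le_iff₀ (by linarith)]; linarith
  rw [e, log_mul (by norm_num) (by linarith)] at h
  have h3 : -(2 * t) ≤ log (1 - t) := by
    have h4 := log_le_sub_one_of_pos (x := (1 - t)⁻¹) (by rw [inv_pos]; linarith)
    rw [log_inv] at h4
    have h5 : (1 - t)⁻¹ ≤ 1 + 2 * t := by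
      rw [inv_le_iff_one_le_mul₀ (by linarith)]
      nlinarith
    linarith
  have e2 : 252 / winX i = 3 * t := by rw [ht]; ring
  rw [abs_le] at h
  rw [e2]
  linarith

theorem one_sub_sum_le_prod_one_sub {a : ℕ → ℝ} (h0 : ∀ i, 0 ≤ a i) (h1 : ∀ i, a i ≤ 1) (n : ℕ) :
    1 - ∑ i ∈ range n, a i ≤ ∏ i ∈ range n, (1 - a i) := by
  induction n with
  | zero => simp
  | succ n ih =>
    rw [sum_range_succ, prod_range_succ]
    have h2 : ∏ i ∈ range n, (1 - a i) ≤ 1 :=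
      prod_le_one (fun i _ => by linarith [h1 i]) (fun i _ => by linarith [h0 i])
    have := mul_le_mul_of_nonneg_right h2 (h0 n)
    nlinarith

theorem sum_sq_div_two_pow (n : ℕ) : ∑ i ∈ range n, ((i : ℝ) + 1) ^ 2 / 2 ^ i ≤ 12 := by
  have : ∑ i ∈ range n, ((i : ℝ) + 1) ^ 2 / 2 ^ i = 12 - 2 * ((n : ℝ) ^ 2 + 4 * n + 6) / 2 ^ n := by
    induction n with
    | zero => norm_num
    | succ n ih =>
      rw [sum_range_succ, ih]
      push_cast
      field_simp
      ring
  rw [this]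
  have : 0 ≤ 2 * ((n : ℝ) ^ 2 + 4 * n + 6) / 2 ^ n := by positivity
  linarith

theorem le_subSum_winD (n k : ℕ) :
    1 / 2 * (log 2 ^ k * ballotLE n k) ≤ subSum winD invw 0 n k := by
  set a : ℕ → ℝ := fun i => ((i : ℝ) + 1) ^ 2 / 2 ^ i / 24 with ha
  have ha0 : ∀ i, 0 ≤ a i := fun i => by positivity
  have ha1 : ∀ i, a i ≤ 1 := fun i => by
    have h1 : ((i : ℝ) + 1) ^ 2 / 2 ^ i ≤ ∑ i ∈ range (i + 1), ((i : ℝ) + 1) ^ 2 / 2 ^ i :=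
      single_le_sum (f := fun i : ℕ => ((i : ℝ) + 1) ^ 2 / 2 ^ i) (fun i _ => by positivity)
        (self_mem_range_succ i)
    have := sum_sq_div_two_pow (i + 1)
    simp only [ha]
    linarith
  have hl := log_two_gt
  have hprod : 1 / 2 ≤ ∏ i ∈ range n, (1 - a i) := by
    refine le_trans ?_ (one_sub_sum_le_prod_one_sub ha0 ha1 n)
    simp only [ha]
    rw [← sum_div]
    have := sum_sq_div_two_pow n
    linarith
  have he : ∀ i b, b ≤ i + 1 → (1 - a i) * (log 2 ^ b / (b.factorial : ℝ)) ≤ esum invw (winD i) b := by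
    intro i b hb
    have hX := winX_big i
    have hX2 := winX_ge i
    have hp : (0 : ℝ) < 2 ^ i := by positivity
    set ε : ℝ := ((i : ℝ) + 1) / 2 ^ i / 24 with hε
    have hε0 : 0 ≤ ε := by positivity
    have haε : a i = ((i + 1 : ℕ) : ℝ) * ε := by
      simp only [ha, hε]; push_cast; ring
    have hε1 : ε ≤ 1 := by
      refine le_trans ?_ (ha1 i)
      rw [haε]
      exact le_mul_of_one_le_left hε0 (by push_cast; linarith [(Nat.cast_nonneg i : (0 : ℝ) ≤ i)])
    have hmain : log 2 * (1 - ε) ≤ (log 2 - 252 / winX i) - ((i + 1 : ℕ) : ℝ) * (1 / winX i) := by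
      have h1 : 252 / winX i + ((i + 1 : ℕ) : ℝ) * (1 / winX i) ≤ 253 * (((i : ℝ) + 1) / (12144 * 2 ^ i)) := by
        have h2 : 1 / winX i ≤ 1 / (12144 * 2 ^ i) := one_div_le_one_div_of_le (by positivity) hX2
        have e1 : 252 / winX i + ((i + 1 : ℕ) : ℝ) * (1 / winX i) = (253 + i) * (1 / winX i) := by
          push_cast; ring
        have e2 : 253 * (((i : ℝ) + 1) / (12144 * 2 ^ i)) = (253 * (i + 1)) * (1 / (12144 * 2 ^ i)) := by ring
        rw [e1, e2]
        refine mul_le_mul ?_ h2 (one_div_nonneg.2 (by linarith)) (by positivity)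
        linarith [(Nat.cast_nonneg i : (0 : ℝ) ≤ i)]
      have e3 : 253 * (((i : ℝ) + 1) / (12144 * 2 ^ i)) = 1 / 2 * ε := by
        rw [hε]; field_simp; norm_num
      have : 1 / 2 * ε ≤ log 2 * ε := by gcongr
      linarith
    have hmain0 : 0 ≤ log 2 * (1 - ε) := mul_nonneg (by linarith) (by linarith)
    have h3 := le_esum invw_nonneg (le_sum_winD i) (ω := 1 / winX i) (by
      intro p hp
      rw [mem_winD] at hp
      unfold invw
      refine one_div_le_one_div_of_le (by linarith) ?_
      linarith [add_one_le_exp (winX i)]) (one_div_nonneg.2 (by linarith)) (i + 1) (by linarith) b hb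
    refine le_trans ?_ h3
    rw [← mul_div_assoc]
    refine div_le_div_of_nonneg_right ?_ (by positivity)
    calc (1 - a i) * log 2 ^ b ≤ (1 - ε) ^ b * log 2 ^ b := by
          refine mul_le_mul_of_nonneg_right ?_ (by positivity)
          have h4 := one_add_mul_le_pow (a := -ε) (by linarith) b
          have h5 : (b : ℝ) * ε ≤ ((i + 1 : ℕ) : ℝ) * ε := by gcongr
          have e : 1 + -ε = 1 - ε := by ring
          rw [e] at h4
          rw [haε]; linarith
      _ = (log 2 * (1 - ε)) ^ b := by rw [mul_pow]; ring
      _ ≤ _ := pow_le_pow_left₀ hmain0 hmain b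
  refine le_trans ?_ (le_subSum disjoint_winD invw_nonneg (by linarith) (fun i => by linarith [ha1 i]) he n k)
  exact mul_le_mul_of_nonneg_right hprod (mul_nonneg (by positivity) (ballotLE_nonneg _ _))

theorem sum_log_mul_invw_winD_le (i : ℕ) : ∑ p ∈ winD i, log p * invw p ≤ winX (i + 1) * log 2 := by
  calc _ ≤ ∑ p ∈ winD i, winX (i + 1) * invw p := by
        refine sum_le_sum fun p hp => ?_
        exact mul_le_mul_of_nonneg_right (mem_winD_log.1 hp).2.2 (invw_nonneg p)
    _ = winX (i + 1) * ∑ p ∈ winD i, invw p := by rw [mul_sum]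
    _ ≤ _ := mul_le_mul_of_nonneg_left (sum_winD_le i) (by linarith [winX_big (i + 1)])

theorem sum_log_mul_invw_winUnion_le (n : ℕ) :
    ∑ p ∈ winUnion winD 0 n, log p * invw p ≤ 2 ^ 15 * 2 ^ n := by
  induction n with
  | zero => rw [winUnion_self]; simp
  | succ n ih =>
    rw [winUnion_succ_right _ (Nat.zero_le n), sum_union]
    · have h1 := sum_log_mul_invw_winD_le n
      have h2 := winX_le (n + 1)
      have h3 : winX (n + 1) * log 2 ≤ winX (n + 1) * 1 :=
        mul_le_mul_of_nonneg_left (by linarith [log_two_lt]) (by linarith [winX_big (n + 1)])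
      have e : (2 : ℝ) ^ (n + 1) = 2 * 2 ^ n := by ring
      rw [e] at h2 ⊢
      linarith
    · rw [← winUnion_one winD n]; exact disjoint_winUnion disjoint_winD le_rfl

theorem sum_prime_inv_ratio_le {x : ℝ} (hx : 1 ≤ x) {z : ℝ} (S : Finset ℕ)
    (hS : ∀ p ∈ S, p.Prime ∧ x < log p ∧ z / 16 < p ∧ (p : ℝ) ≤ z) :
    ∑ p ∈ S, invw p ≤ 100 / x := by
  rcases S.eq_empty_or_nonempty with h | ⟨p0, hp0⟩
  · subst h; rw [sum_empty]; exact div_nonneg (by norm_num) (by linarith)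
  obtain ⟨h1, h2, h3, h4⟩ := hS p0 hp0
  have hp0' : (0 : ℝ) < p0 := by exact_mod_cast h1.pos
  have hz : 0 < z := by linarith
  set y := log z with hy
  have hxy : x < y := h2.trans_le (log_le_log hp0' h4)
  set a := max (y - log 16) x with ha
  have hax : x ≤ a := le_max_right _ _
  have hl16 : 0 < log (16 : ℝ) := log_pos (by norm_num)
  have hl16' : log (16 : ℝ) ≤ 16 := by
    have := log_le_sub_one_of_pos (x := 16) (by norm_num); linarith
  have hay : a ≤ y := max_le (by linarith) hxy.le
  have h := abs_sum_primesIoc_exp_sub_le (x := a) (y := y) (by linarith) hay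
  have hsub : S ⊆ primesIoc (exp a) (exp y) := by
    intro p hp
    obtain ⟨q1, q2, q3, q4⟩ := hS p hp
    have hp' : (0 : ℝ) < p := by exact_mod_cast q1.pos
    rw [mem_primesIoc (exp_pos _).le (exp_pos _).le]
    refine ⟨q1, ?_, ?_⟩
    · rw [← lt_log_iff_exp_lt hp', ha, max_lt_iff]
      refine ⟨?_, q2⟩
      rw [hy, ← log_div hz.ne' (by norm_num)]
      exact log_lt_log (div_pos hz (by norm_num)) q3
    · rw [hy, exp_log hz]; exact q4
  have h5 : ∑ p ∈ S, invw p ≤ ∑ p ∈ primesIoc (exp a) (exp y), 1 / (p : ℝ) :=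
    sum_le_sum_of_subset_of_nonneg hsub fun p _ _ => invw_nonneg p
  have h6 : log (y / a) ≤ 16 / a := by
    have h7 := log_le_sub_one_of_pos (x := y / a) (div_pos (by linarith) (by linarith))
    have e : y / a - 1 = (y - a) / a := by
      have : a ≠ 0 := by linarith
      field_simp
    have h8 : (y - a) / a ≤ 16 / a := by
      refine div_le_div_of_nonneg_right ?_ (by linarith)
      linarith [le_max_left (y - log 16) x]
    linarith
  have h9 : 100 / a ≤ 100 / x := div_le_div_of_nonneg_left (by norm_num) (by linarith) hax
  have e : 100 / a = 84 / a + 16 / a := by ring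
  rw [abs_le] at h
  linarith

theorem exists_le_card_primesIoc : ∃ W : ℝ, 4 ≤ W ∧ ∀ w : ℝ, W ≤ w →
    1 / 10 * w / log w ≤ ((primesIoc (w / 4) w).card : ℝ) := by
  have h1 : ∀ᶠ w : ℝ in Filter.atTop, log w ≤ 1 / 100 * √w := by
    have h := isLittleO_log_rpow_atTop (r := 1 / 2) (by norm_num)
    have h2 := h.def (c := 1 / 100) (by norm_num)
    filter_upwards [h2, Filter.eventually_ge_atTop 1] with w hw h1w
    rw [← sqrt_eq_rpow, norm_of_nonneg (log_nonneg h1w), norm_of_nonneg (sqrt_nonneg _)] at hw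
    exact hw
  obtain ⟨W0, hW0⟩ := Filter.eventually_atTop.1 h1
  refine ⟨max W0 100, le_max_of_le_right (by norm_num), fun w hw => ?_⟩
  have hw1 : W0 ≤ w := le_trans (le_max_left _ _) hw
  have hw2 : 100 ≤ w := le_trans (le_max_right _ _) hw
  have hlog := hW0 w hw1
  have hs : √w * √w = w := mul_self_sqrt (by linarith)
  have hs1 : 1 ≤ √w := by rw [one_le_sqrt]; linarith
  have h2 := Chebyshev.theta_ge' (x := w) (by linarith)
  have h3 := Chebyshev.theta_le_log4_mul_x (x := w / 4) (by linarith)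
  have h4 : log (w + 2) ≤ 2 + log w := by
    have : w + 2 ≤ 2 * w := by linarith
    calc log (w + 2) ≤ log (2 * w) := log_le_log (by linarith) this
      _ = log 2 + log w := log_mul (by norm_num) (by linarith)
      _ ≤ _ := by linarith [log_two_lt]
  have h5 : log 4 = 2 * log 2 := by
    rw [show (4 : ℝ) = 2 ^ 2 by norm_num, log_pow]; norm_num
  rw [h5] at h3
  have h6 : 1 / 10 * w ≤ Chebyshev.theta w - Chebyshev.theta (w / 4) := by
    have h7 : 2 * √w * log w ≤ 1 / 50 * w := by
      calc 2 * √w * log w ≤ 2 * √w * (1 / 100 * √w) := by gcongr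
        _ = 1 / 50 * (√w * √w) := by ring
        _ = _ := by rw [hs]
    have h8 : √w ≤ w := by nlinarith
    have := log_two_gt
    have := log_two_lt
    nlinarith
  have h7 : Chebyshev.theta w - Chebyshev.theta (w / 4) = ∑ p ∈ primesIoc (w / 4) w, log p := by
    rw [Chebyshev.theta, Chebyshev.theta, primesIoc, sub_eq_iff_eq_add, sum_filter, sum_filter, sum_filter,
      add_comm]
    have := Nat.floor_mono (show w / 4 ≤ w by linarith)
    exact (sum_Ioc_consecutive _ (Nat.zero_le _) this).symm
  have h8 : ∑ p ∈ primesIoc (w / 4) w, log p ≤ (primesIoc (w / 4) w).card * log w := by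
    rw [← nsmul_eq_mul]
    refine sum_le_card_nsmul _ _ _ fun p hp => ?_
    rw [mem_primesIoc (by linarith) (by linarith)] at hp
    exact log_le_log (by exact_mod_cast hp.1.pos) hp.2.2
  rw [div_le_iff₀ (log_pos (by linarith))]
  linarith

/-- The integers in `[1, X]` all of whose prime factors are at least `p`. -/
noncomputable def rough (p X : ℕ) : Finset ℕ :=
  (Icc 1 X).filter fun b => ∀ q, q.Prime → q ∣ b → p ≤ q

theorem mem_rough {p X b : ℕ} :
    b ∈ rough p X ↔ (1 ≤ b ∧ b ≤ X) ∧ ∀ q, q.Prime → q ∣ b → p ≤ q := by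
  rw [rough, mem_filter, mem_Icc]

theorem rough_mul_inj {p X m m' n n' : ℕ} (hm : m ∈ rough p X) (hm' : m' ∈ rough p X)
    (hn : n ∈ Icc 1 (p - 1)) (hn' : n' ∈ Icc 1 (p - 1)) (h : m * n = m' * n') : m = m' := by
  have key : ∀ {a b : ℕ}, a ∈ rough p X → b ∈ Icc 1 (p - 1) → Nat.Coprime a b := by
    intro a b ha hb
    rw [mem_rough] at ha
    rw [mem_Icc] at hb
    refine Nat.coprime_of_dvd' fun q hq h1 h2 => ?_
    have h3 := ha.2 q hq h1
    have h4 := Nat.le_of_dvd (by omega) h2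
    omega
  apply Nat.dvd_antisymm
  · exact (key hm hn').dvd_of_dvd_mul_right (h ▸ Dvd.intro _ rfl)
  · exact (key hm' hn).dvd_of_dvd_mul_right (h ▸ Dvd.intro _ rfl)

theorem sum_inv_Icc_le (n : ℕ) : ∑ k ∈ Icc 1 n, 1 / (k : ℝ) ≤ 1 + log n := by
  have := harmonic_le_one_add_log n
  rw [harmonic_eq_sum_Icc] at this
  push_cast at this
  simpa using this

theorem le_sum_inv_Icc (n : ℕ) : log (n + 1 : ℕ) ≤ ∑ k ∈ Icc 1 n, 1 / (k : ℝ) := by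
  have := log_add_one_le_harmonic n
  rw [harmonic_eq_sum_Icc] at this
  push_cast at this ⊢
  simpa using this

theorem card_rough_mul_log_le (p X : ℕ) (hX : 1 ≤ X) :
    ((rough p X).card : ℝ) * log X ≤ (log 4 + 5) * X * ∑ m ∈ rough p X, 1 / (m : ℝ) := by
  have hX0 : (0 : ℝ) < X := by exact_mod_cast hX
  have h1 : ∑ b ∈ rough p X, log b ≤ (log 4 + 4) * X * ∑ m ∈ rough p X, 1 / (m : ℝ) := by
    have h2 : ∑ b ∈ rough p X, log b = ∑ b ∈ rough p X, ∑ x ∈ b.divisorsAntidiagonal, ArithmeticFunction.vonMangoldt x.2 := by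
      refine sum_congr rfl fun b _ => ?_
      rw [Nat.sum_divisorsAntidiagonal' (fun _ d => ArithmeticFunction.vonMangoldt d), ArithmeticFunction.vonMangoldt_sum]
    rw [h2, sum_sigma']
    have h3 : ∑ x ∈ (rough p X).sigma (fun b => b.divisorsAntidiagonal), ArithmeticFunction.vonMangoldt x.2.2 ≤
        ∑ y ∈ (rough p X).sigma (fun m => Ioc 0 (X / m)), ArithmeticFunction.vonMangoldt y.2 := by
      have hinj : Set.InjOn (fun x : (_ : ℕ) × ℕ × ℕ => (⟨x.2.1, x.2.2⟩ : (_ : ℕ) × ℕ))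
          ((rough p X).sigma (fun b => b.divisorsAntidiagonal)) := by
        rintro ⟨b, m, d⟩ h ⟨b', m', d'⟩ h' e
        simp only [coe_sigma, Set.mem_sigma_iff, mem_coe, Nat.mem_divisorsAntidiagonal] at h h'
        simp only [Sigma.mk.injEq, heq_eq_eq] at e
        obtain ⟨e1, e2⟩ := e
        subst e1; subst e2
        obtain ⟨_, h, _⟩ := h
        obtain ⟨_, h', _⟩ := h'
        subst h; subst h'; rfl
      calc _ = ∑ y ∈ ((rough p X).sigma (fun b => b.divisorsAntidiagonal)).image (fun x => (⟨x.2.1, x.2.2⟩ : (_ : ℕ) × ℕ)),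
            ArithmeticFunction.vonMangoldt y.2 := by rw [sum_image hinj]
        _ ≤ _ := by
          refine sum_le_sum_of_subset_of_nonneg ?_ fun _ _ _ => ArithmeticFunction.vonMangoldt_nonneg
          intro y hy
          rw [mem_image] at hy
          obtain ⟨⟨b, m, d⟩, hx, rfl⟩ := hy
          simp only [mem_sigma, Nat.mem_divisorsAntidiagonal, mem_rough] at hx ⊢
          obtain ⟨⟨⟨hb1, hb2⟩, hq⟩, hmd, hb0⟩ := hx
          have hm0 : 0 < m := Nat.pos_of_ne_zero (by rintro rfl; omega)
          have hd0 : 0 < d := Nat.pos_of_ne_zero (by rintro rfl; omega)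
          refine ⟨⟨⟨hm0, ?_⟩, fun q h1 h2 => hq q h1 (h2.trans (hmd ▸ Dvd.intro _ rfl))⟩, ?_⟩
          · have : m ≤ m * d := Nat.le_mul_of_pos_right _ hd0
            omega
          · rw [mem_Ioc]
            refine ⟨hd0, ?_⟩
            rw [Nat.le_div_iff_mul_le hm0]
            have : d * m = m * d := mul_comm _ _
            omega
    refine h3.trans ?_
    rw [sum_sigma, mul_sum]
    refine sum_le_sum fun m hm => ?_
    rw [mem_rough] at hm
    have hm0 : (0 : ℝ) < m := by exact_mod_cast hm.1.1
    have h4 := Chebyshev.psi_le_const_mul_self (x := ((X / m : ℕ) : ℝ)) (by positivity)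
    rw [Chebyshev.psi, Nat.floor_natCast] at h4
    refine h4.trans ?_
    have h5 : ((X / m : ℕ) : ℝ) ≤ X / m := Nat.cast_div_le
    have h6 : 0 ≤ log (4 : ℝ) := log_nonneg (by norm_num)
    calc (log 4 + 4) * ((X / m : ℕ) : ℝ) ≤ (log 4 + 4) * (X / m) := by gcongr
      _ = _ := by ring
  have h2 : ∑ b ∈ rough p X, (log X - log b) ≤ X * ∑ m ∈ rough p X, 1 / (m : ℝ) := by
    rw [mul_sum]
    refine sum_le_sum fun m hm => ?_
    rw [mem_rough] at hm
    have hm0 : (0 : ℝ) < m := by exact_mod_cast hm.1.1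
    rw [← log_div hX0.ne' hm0.ne', mul_one_div]
    linarith [log_le_sub_one_of_pos (x := (X : ℝ) / m) (by positivity)]
  rw [sum_sub_distrib, sum_const, nsmul_eq_mul] at h2
  have e : (log 4 + 5) * X * ∑ m ∈ rough p X, 1 / (m : ℝ) =
    (log 4 + 4) * X * ∑ m ∈ rough p X, 1 / (m : ℝ) + X * ∑ m ∈ rough p X, 1 / (m : ℝ) := by ring
  rw [e]; linarith

theorem sum_inv_rough_mul_log_le (p X : ℕ) (hp : 2 ≤ p) (hX : p ≤ X) :
    (∑ m ∈ rough p X, 1 / (m : ℝ)) * log p ≤ 4 * log X := by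
  have hX0 : (0 : ℝ) < X := by exact_mod_cast (by omega : 0 < X)
  have hp0 : (0 : ℝ) < p := by exact_mod_cast (by omega : 0 < p)
  have h1 : log (p : ℝ) ≤ ∑ k ∈ Icc 1 (p - 1), 1 / (k : ℝ) := by
    have := le_sum_inv_Icc (p - 1)
    rwa [Nat.sub_add_cancel (by omega)] at this
  have hnn : 0 ≤ ∑ m ∈ rough p X, 1 / (m : ℝ) := sum_nonneg fun _ _ => by positivity
  refine (mul_le_mul_of_nonneg_left h1 hnn).trans ?_
  rw [sum_mul_sum, ← sum_product']
  have h2 : ∑ x ∈ rough p X ×ˢ Icc 1 (p - 1), 1 / (x.1 : ℝ) * (1 / (x.2 : ℝ)) ≤ ∑ k ∈ Icc 1 (X * p), 1 / (k : ℝ) := by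
    have hinj : Set.InjOn (fun x : ℕ × ℕ => x.1 * x.2) (rough p X ×ˢ Icc 1 (p - 1) : Finset (ℕ × ℕ)) := by
      rintro ⟨m, n⟩ h ⟨m', n'⟩ h' e
      rw [mem_coe, mem_product] at h h'
      have e1 := rough_mul_inj h.1 h'.1 h.2 h'.2 e
      simp only at e1 e
      subst e1
      have : 0 < m := (mem_rough.1 h.1).1.1
      rw [Nat.mul_right_inj this.ne'] at e
      rw [e]
    calc _ = ∑ k ∈ (rough p X ×ˢ Icc 1 (p - 1)).image (fun x : ℕ × ℕ => x.1 * x.2), 1 / (k : ℝ) := by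
          rw [sum_image hinj]
          refine sum_congr rfl fun x _ => ?_
          push_cast
          rw [one_div_mul_one_div]
      _ ≤ _ := by
        refine sum_le_sum_of_subset_of_nonneg ?_ fun _ _ _ => by positivity
        intro k hk
        rw [mem_image] at hk
        obtain ⟨⟨m, n⟩, hx, rfl⟩ := hk
        rw [mem_product, mem_rough, mem_Icc] at hx
        obtain ⟨⟨⟨h1, h2⟩, _⟩, h3, h4⟩ := hx
        rw [mem_Icc]
        simp only at *
        exact ⟨Nat.mul_pos h1 h3, Nat.mul_le_mul h2 (by omega)⟩
  refine h2.trans ((sum_inv_Icc_le _).trans ?_)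
  push_cast
  rw [log_mul hX0.ne' hp0.ne']
  have h3 : log (p : ℝ) ≤ log X := log_le_log hp0 (by exact_mod_cast hX)
  have h4 : log 2 ≤ log (p : ℝ) := log_le_log (by norm_num) (by exact_mod_cast hp)
  have := log_two_gt
  linarith

theorem card_rough_le (p X : ℕ) (hp : 2 ≤ p) (hX : p ≤ X) :
    ((rough p X).card : ℝ) ≤ 32 * X / log p := by
  have hX0 : (0 : ℝ) < X := by exact_mod_cast (by omega : 0 < X)
  have hlp : 0 < log (p : ℝ) := log_pos (by exact_mod_cast (by omega : 1 < p))
  have hlX : 0 < log (X : ℝ) := log_pos (by exact_mod_cast (by omega : 1 < X))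
  have h1 := card_rough_mul_log_le p X (by omega)
  have h2 := sum_inv_rough_mul_log_le p X hp hX
  have h3 : log (4 : ℝ) ≤ 3 := by
    have := log_le_sub_one_of_pos (x := 4) (by norm_num); linarith
  rw [le_div_iff₀ hlp]
  have hnn : 0 ≤ ∑ m ∈ rough p X, 1 / (m : ℝ) := sum_nonneg fun _ _ => by positivity
  have h4 : ((rough p X).card : ℝ) * log p * log X ≤ 32 * X * log X := by
    calc ((rough p X).card : ℝ) * log p * log X = ((rough p X).card : ℝ) * log X * log p := by ring
      _ ≤ (log 4 + 5) * X * (∑ m ∈ rough p X, 1 / (m : ℝ)) * log p := by gcongr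
      _ = (log 4 + 5) * X * ((∑ m ∈ rough p X, 1 / (m : ℝ)) * log p) := by ring
      _ ≤ 8 * X * (4 * log X) := by
        refine mul_le_mul ?_ h2 (by positivity) (by positivity)
        exact mul_le_mul_of_nonneg_right (by linarith) hX0.le
      _ = _ := by ring
  exact le_of_mul_le_mul_right h4 hlX

/-- The number of intervals `[4 ^ j, 4 ^ (j + 1))` containing a divisor of `a`. -/
noncomputable def logCount (a : ℕ) : ℕ := (a.divisors.image (Nat.log 4)).card

theorem nat_log_mul {a b : ℕ} (ha : a ≠ 0) (hb : b ≠ 0) :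
    Nat.log 4 a + Nat.log 4 b ≤ Nat.log 4 (a * b) ∧ Nat.log 4 (a * b) ≤ Nat.log 4 a + Nat.log 4 b + 1 := by
  have h1 := Nat.pow_log_le_self 4 ha
  have h2 := Nat.pow_log_le_self 4 hb
  have h3 := Nat.lt_pow_succ_log_self (b := 4) (by norm_num) a
  have h4 := Nat.lt_pow_succ_log_self (b := 4) (by norm_num) b
  constructor
  · apply Nat.le_log_of_pow_le (by norm_num)
    rw [pow_add]; exact Nat.mul_le_mul h1 h2
  · rw [← Nat.lt_succ_iff]
    apply Nat.log_lt_of_lt_pow (Nat.mul_ne_zero ha hb)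
    have e : (4 : ℕ) ^ (Nat.log 4 a + Nat.log 4 b + 1).succ = 4 ^ (Nat.log 4 a).succ * 4 ^ (Nat.log 4 b).succ := by
      rw [← pow_add]; congr 1; simp only [Nat.succ_eq_add_one]; ring
    rw [e]
    exact Nat.mul_lt_mul'' h3 h4

theorem logCount_mul_le (a b : ℕ) :
    logCount (a * b) ≤ 2 * b.divisors.card * logCount a := by
  have h : ((a * b).divisors.image (Nat.log 4)) ⊆
      ((range 2 ×ˢ b.divisors) ×ˢ (a.divisors.image (Nat.log 4))).image
        (fun x => x.2 + Nat.log 4 x.1.2 + x.1.1) := by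
    intro j hj
    rw [mem_image] at hj
    obtain ⟨d, hd, rfl⟩ := hj
    rw [Nat.divisors_mul, mem_mul] at hd
    obtain ⟨e, he, f, hf, rfl⟩ := hd
    have he0 := (Nat.pos_of_mem_divisors he).ne'
    have hf0 := (Nat.pos_of_mem_divisors hf).ne'
    obtain ⟨h1, h2⟩ := nat_log_mul he0 hf0
    rw [mem_image]
    refine ⟨((Nat.log 4 (e * f) - (Nat.log 4 e + Nat.log 4 f), f), Nat.log 4 e), ?_, ?_⟩
    · simp only [mem_product, mem_range]
      exact ⟨⟨by omega, hf⟩, mem_image_of_mem _ he⟩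
    · simp only; omega
  calc logCount (a * b) ≤ _ := card_le_card h
    _ ≤ _ := card_image_le
    _ = _ := by rw [card_product, card_product, card_range]; rfl

theorem logCount_le {a : ℕ} (ha : a ≠ 0) : (logCount a : ℝ) ≤ 1 + log a := by
  have h : a.divisors.image (Nat.log 4) ⊆ range (Nat.log 4 a + 1) := by
    intro j hj
    rw [mem_image] at hj
    obtain ⟨d, hd, rfl⟩ := hj
    rw [mem_range, Nat.lt_succ_iff]
    exact Nat.log_mono_right (Nat.divisor_le hd)
  have h1 := card_le_card h
  rw [card_range] at h1
  have h2 : (logCount a : ℝ) ≤ Nat.log 4 a + 1 := by exact_mod_cast h1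
  have h3 : ((4 : ℝ) ^ (Nat.log 4 a)) ≤ a := by exact_mod_cast Nat.pow_log_le_self 4 ha
  have h4 := log_le_log (by positivity) h3
  rw [log_pow] at h4
  have h5 : 1 ≤ log (4 : ℝ) := by
    rw [show (4 : ℝ) = 2 ^ 2 by norm_num, log_pow]; push_cast; linarith [log_two_gt]
  have h6 : (Nat.log 4 a : ℝ) * 1 ≤ Nat.log 4 a * log 4 := by gcongr
  linarith

theorem card_divisors_mul_le (a b : ℕ) : (a * b).divisors.card ≤ a.divisors.card * b.divisors.card := by
  rw [Nat.divisors_mul]; exact card_mul_le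

theorem card_divisors_le_sqrt (n : ℕ) : (n.divisors.card : ℝ) ≤ 2 * √n := by
  rcases Nat.eq_zero_or_pos n with h | h
  · subst h; simp
  have h1 : n.divisors ⊆ (Icc 1 (Nat.sqrt n)) ∪ (Icc 1 (Nat.sqrt n)).image (fun d => n / d) := by
    intro d hd
    have hd0 := Nat.pos_of_mem_divisors hd
    have hdn := Nat.dvd_of_mem_divisors hd
    rw [mem_union, mem_image]
    by_cases hc : d ≤ Nat.sqrt n
    · left; rw [mem_Icc]; exact ⟨hd0, hc⟩
    · right
      refine ⟨n / d, ?_, Nat.div_div_self hdn h.ne'⟩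
      rw [mem_Icc]
      refine ⟨Nat.div_pos (Nat.le_of_dvd h hdn) hd0, ?_⟩
      by_contra hc2
      have h2 : (Nat.sqrt n + 1) * (Nat.sqrt n + 1) ≤ d * (n / d) := Nat.mul_le_mul (by omega) (by omega)
      rw [Nat.mul_div_cancel' hdn] at h2
      exact absurd (Nat.lt_succ_sqrt n) (by simpa using h2)
  have h2 : n.divisors.card ≤ 2 * Nat.sqrt n := by
    calc n.divisors.card ≤ _ := card_le_card h1
      _ ≤ _ := card_union_le _ _
      _ ≤ Nat.sqrt n + Nat.sqrt n := by
        refine add_le_add (by simp) (card_image_le.trans (by simp))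
      _ = _ := by ring
  calc (n.divisors.card : ℝ) ≤ 2 * (Nat.sqrt n : ℝ) := by exact_mod_cast h2
    _ ≤ _ := by gcongr; exact Real.nat_sqrt_le_real_sqrt

theorem exists_sum_card_divisors_le : ∃ K : ℝ, 0 < K ∧ ∀ S : Finset ℕ,
    ∑ b ∈ S, ((b ^ 2).divisors.card : ℝ) * (1 + log b) / (b : ℝ) ^ 2 ≤ K := by
  have hs : Summable fun n : ℕ => (n : ℝ) ^ (-(5 / 4) : ℝ) := by
    rw [Real.summable_nat_rpow]; norm_num
  set Z := ∑' n : ℕ, (n : ℝ) ^ (-(5 / 4) : ℝ) with hZ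
  have hZ0 : 0 ≤ Z := tsum_nonneg fun n => by positivity
  refine ⟨8 * Z ^ 2 + 1, by positivity, fun S => ?_⟩
  have h1 : ∀ b ∈ S, ((b ^ 2).divisors.card : ℝ) * (1 + log b) / (b : ℝ) ^ 2 ≤
      8 * ∑ x ∈ b.divisorsAntidiagonal, (x.1 : ℝ) ^ (-(5 / 4) : ℝ) * (x.2 : ℝ) ^ (-(5 / 4) : ℝ) := by
    intro b _
    rcases Nat.eq_zero_or_pos b with h | h
    · subst h; simp
    have hb : (0 : ℝ) < b := by exact_mod_cast h
    have h2 : ((b ^ 2).divisors.card : ℝ) ≤ 2 * √b * b.divisors.card := by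
      calc ((b ^ 2).divisors.card : ℝ) ≤ b.divisors.card * b.divisors.card := by
            rw [sq]; exact_mod_cast card_divisors_mul_le b b
        _ ≤ _ := by gcongr; exact card_divisors_le_sqrt b
    have h3 : 1 + log b ≤ 4 * (b : ℝ) ^ (1 / 4 : ℝ) := by
      have h4 := log_le_sub_one_of_pos (x := (b : ℝ) ^ (1 / 4 : ℝ)) (by positivity)
      rw [log_rpow hb] at h4
      linarith
    have h0 : 0 ≤ 1 + log (b : ℝ) := by
      have : 0 ≤ log (b : ℝ) := log_nonneg (by exact_mod_cast h)
      linarith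
    have h5 : ∑ x ∈ b.divisorsAntidiagonal, (x.1 : ℝ) ^ (-(5 / 4) : ℝ) * (x.2 : ℝ) ^ (-(5 / 4) : ℝ) =
        b.divisors.card * (b : ℝ) ^ (-(5 / 4) : ℝ) := by
      have h6 : ∀ x ∈ b.divisorsAntidiagonal, (x.1 : ℝ) ^ (-(5 / 4) : ℝ) * (x.2 : ℝ) ^ (-(5 / 4) : ℝ) =
          (b : ℝ) ^ (-(5 / 4) : ℝ) := by
        intro x hx
        rw [Nat.mem_divisorsAntidiagonal] at hx
        rw [← mul_rpow (by positivity) (by positivity), ← hx.1]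
        push_cast; rfl
      rw [sum_congr rfl h6, sum_const, nsmul_eq_mul, ← Nat.map_div_right_divisors, card_map]
    rw [h5, div_le_iff₀ (by positivity)]
    have e : (b : ℝ) ^ (-(5 / 4) : ℝ) * (b : ℝ) ^ 2 = √b * (b : ℝ) ^ (1 / 4 : ℝ) := by
      rw [sqrt_eq_rpow, ← rpow_add hb, ← rpow_natCast, ← rpow_add hb]; norm_num
    calc ((b ^ 2).divisors.card : ℝ) * (1 + log b) ≤ (2 * √b * b.divisors.card) * (4 * (b : ℝ) ^ (1 / 4 : ℝ)) := by
          gcongr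
      _ = 8 * (b.divisors.card * (√b * (b : ℝ) ^ (1 / 4 : ℝ))) := by ring
      _ = _ := by rw [← e]; ring
  refine (sum_le_sum h1).trans ?_
  rw [← mul_sum, sum_sigma']
  have h2 : ∑ x ∈ S.sigma (fun b => b.divisorsAntidiagonal), (x.2.1 : ℝ) ^ (-(5 / 4) : ℝ) * (x.2.2 : ℝ) ^ (-(5 / 4) : ℝ) ≤
      Z ^ 2 := by
    have hinj : Set.InjOn (fun x : (_ : ℕ) × ℕ × ℕ => x.2) (S.sigma (fun b => b.divisorsAntidiagonal)) := by
      rintro ⟨b, x⟩ h ⟨b', x'⟩ h' e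
      simp only at e
      subst e
      simp only [coe_sigma, Set.mem_sigma_iff, mem_coe, Nat.mem_divisorsAntidiagonal] at h h'
      have : b = b' := by rw [← h.2.1, ← h'.2.1]
      subst this; rfl
    set P := (S.sigma (fun b => b.divisorsAntidiagonal)).image (fun x : (_ : ℕ) × ℕ × ℕ => x.2) with hP
    calc _ = ∑ y ∈ P, (y.1 : ℝ) ^ (-(5 / 4) : ℝ) * (y.2 : ℝ) ^ (-(5 / 4) : ℝ) := by rw [hP, sum_image hinj]
      _ ≤ ∑ y ∈ (P.image Prod.fst) ×ˢ (P.image Prod.snd), (y.1 : ℝ) ^ (-(5 / 4) : ℝ) * (y.2 : ℝ) ^ (-(5 / 4) : ℝ) := by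
        refine sum_le_sum_of_subset_of_nonneg ?_ fun _ _ _ => by positivity
        intro y hy
        rw [mem_product]
        exact ⟨mem_image_of_mem _ hy, mem_image_of_mem _ hy⟩
      _ = (∑ m ∈ P.image Prod.fst, (m : ℝ) ^ (-(5 / 4) : ℝ)) * ∑ n ∈ P.image Prod.snd, (n : ℝ) ^ (-(5 / 4) : ℝ) := by
        rw [sum_mul_sum, sum_product]
      _ ≤ Z * Z := by
        refine mul_le_mul (hs.sum_le_tsum _ fun _ _ => by positivity) (hs.sum_le_tsum _ fun _ _ => by positivity)
          (sum_nonneg fun _ _ => by positivity) hZ0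
      _ = _ := by ring
  linarith

theorem sum_powerset_eq_sum_card {α : Type*} [DecidableEq α] (S : Finset α) (P : Finset α → Prop) (f : Finset α → ℝ) :
    ∑ A ∈ S.powerset, (if P A then f A else 0) =
      ∑ k ∈ range (S.card + 1), ∑ A ∈ S.powerset, if A.card = k ∧ P A then f A else 0 := by
  rw [sum_comm]
  refine sum_congr rfl fun A hA => ?_
  rw [mem_powerset] at hA
  have hc := card_le_card hA
  rw [sum_eq_single A.card]
  · by_cases h : P A <;> simp [h]
  · intro k _ hk
    rw [if_neg]
    exact fun h => hk h.1.symm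
  · intro h
    exact absurd (mem_range.2 (Nat.lt_succ_of_le hc)) h

theorem exists_sum_pow_mul_geometric_le {r : ℝ} (h0 : 0 ≤ r) (h1 : r < 1) (d : ℕ) :
    ∃ K : ℝ, 0 < K ∧ ∀ S : Finset ℕ, ∑ m ∈ S, ((m : ℝ) + 1) ^ d * r ^ m ≤ K := by
  have hs : Summable fun m : ℕ => ((m : ℝ) + 1) ^ d * r ^ m := by
    rcases h0.eq_or_lt with h | h
    · subst h
      refine summable_of_ne_finset_zero (s := {0}) fun m hm => ?_
      rw [mem_singleton] at hm
      simp [hm]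
    have := (summable_nat_add_iff 1).2 (summable_pow_mul_geometric_of_norm_lt_one d (r := r) (by rwa [norm_of_nonneg h0]))
    refine (this.mul_left (1 / r)).congr fun m => ?_
    push_cast
    rw [pow_succ]
    field_simp
  refine ⟨∑' m : ℕ, ((m : ℝ) + 1) ^ d * r ^ m + 1, ?_, fun S => ?_⟩
  · have : 0 ≤ ∑' m : ℕ, ((m : ℝ) + 1) ^ d * r ^ m := tsum_nonneg fun m => by positivity
    linarith
  · have := hs.sum_le_tsum S fun m _ => by positivity
    linarith

theorem exists_sum_superBallot_one_le : ∃ K : ℝ, 0 < K ∧ ∀ T : ℕ,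
    ∑ A ∈ (winUnion winD 0 T).powerset, (if SuperBallot winD 1 0 T A then ∏ p ∈ A, invw p else 0) ≤
      K * ((log 2 * exp 1) ^ T * decay T) := by
  have hl0 : 0 < log (2 : ℝ) := by linarith [log_two_gt]
  obtain ⟨K, hK, hsum⟩ := exists_sum_pow_mul_geometric_le hl0.le (by linarith [log_two_lt]) 4
  refine ⟨48 * exp 1 / log 2 * K, by positivity, fun T => ?_⟩
  rw [sum_powerset_eq_sum_card]
  set R := (winUnion winD 0 T).card + 1
  have h1 : ∀ k ∈ range R, (∑ A ∈ (winUnion winD 0 T).powerset,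
      if A.card = k ∧ SuperBallot winD 1 0 T A then ∏ p ∈ A, invw p else 0) ≤
      if T ≤ k + 1 then 48 * exp 1 / log 2 * ((log 2 * exp 1) ^ T * decay T) *
        ((((k + 1 - T : ℕ) : ℝ) + 1) ^ 4 * log 2 ^ (k + 1 - T)) else 0 := by
    intro k _
    have h2 := superSum_le disjoint_winD invw_nonneg sum_winD_le 1 0 T k
    rw [zero_add] at h2
    refine (show _ ≤ _ from h2).trans ?_
    split_ifs with h
    · obtain ⟨m, hm⟩ := Nat.exists_eq_add_of_le h
      have e : k + 1 - T = m := by omega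
      rw [e]
      have h3 := ballotGE_one_le T k
      have e2 : k + 2 = T + 1 + m := by omega
      rw [e2] at h3
      have h4 := ballotGE_le (T + 1) m
      have h5 := decay_anti (Nat.le_succ T)
      have e3 : exp ((T + 1 : ℕ) : ℝ) = exp 1 ^ T * exp 1 := by
        rw [← pow_succ, ← exp_nat_mul, mul_one]
      have e4 : log 2 ^ k = log 2 ^ T * log 2 ^ m / log 2 := by
        rw [eq_div_iff hl0.ne', ← pow_succ, ← pow_add, hm]
      calc log 2 ^ k * ballotGE 1 T k ≤ log 2 ^ k * (2 * (24 * ((m : ℝ) + 1) ^ 4 * exp ((T + 1 : ℕ) : ℝ) * decay T)) := by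
            refine mul_le_mul_of_nonneg_left ?_ (by positivity)
            refine h3.trans (mul_le_mul_of_nonneg_left (h4.trans ?_) (by norm_num))
            exact mul_le_mul_of_nonneg_left h5 (by positivity)
        _ = _ := by
            rw [e3, e4, mul_pow]; ring
    · rw [ballotGE_eq_zero (by omega), mul_zero]
  refine (sum_le_sum h1).trans ?_
  rw [← sum_filter, ← mul_sum]
  have h6 : ∑ k ∈ (range R).filter (fun k => T ≤ k + 1), ((((k + 1 - T : ℕ) : ℝ) + 1) ^ 4 * log 2 ^ (k + 1 - T)) =
      ∑ m ∈ ((range R).filter (fun k => T ≤ k + 1)).image (fun k => k + 1 - T), (((m : ℝ) + 1) ^ 4 * log 2 ^ m) := by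
    rw [sum_image]
    intro k hk k' hk' h
    simp only [coe_filter, mem_range, Set.mem_ofPred_eq] at hk hk' h
    omega
  rw [h6]
  have hd := decay_pos T
  calc _ ≤ 48 * exp 1 / log 2 * ((log 2 * exp 1) ^ T * decay T) * K :=
        mul_le_mul_of_nonneg_left (hsum _) (by positivity)
    _ = _ := by ring

theorem exists_sum_subBallot_two_pow_le : ∃ K : ℝ, 0 < K ∧ ∀ a n : ℕ,
    ∑ A ∈ (winUnion winD a (a + n)).powerset,
      (if SubBallot winD a (a + n) A then (∏ p ∈ A, invw p) * 2 ^ A.card else 0) ≤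
      K * ((2 * log 2 * exp 1) ^ n * decay n) := by
  have hl := log_two_gt
  have hl0 : 0 < log (2 : ℝ) := by linarith
  obtain ⟨K, hK, hsum⟩ := exists_sum_pow_mul_geometric_le (r := 1 / (2 * log 2)) (by positivity)
    (by rw [div_lt_one (by positivity)]; linarith) 1
  refine ⟨3 * K, by positivity, fun a n => ?_⟩
  rw [sum_powerset_eq_sum_card]
  set R := (winUnion winD a (a + n)).card + 1
  have h1 : ∀ k ∈ range R, (∑ A ∈ (winUnion winD a (a + n)).powerset,
      if A.card = k ∧ SubBallot winD a (a + n) A then (∏ p ∈ A, invw p) * 2 ^ A.card else 0) ≤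
      if k ≤ n then 3 * ((2 * log 2 * exp 1) ^ n * decay n) *
        ((((n - k : ℕ) : ℝ) + 1) ^ 1 * (1 / (2 * log 2)) ^ (n - k)) else 0 := by
    intro k _
    have h2 := subSum_le disjoint_winD invw_nonneg sum_winD_le a n k
    have e1 : (∑ A ∈ (winUnion winD a (a + n)).powerset,
      if A.card = k ∧ SubBallot winD a (a + n) A then (∏ p ∈ A, invw p) * 2 ^ A.card else 0) =
      subSum winD invw a (a + n) k * 2 ^ k := by
      rw [subSum, sum_mul]
      refine sum_congr rfl fun A _ => ?_
      split_ifs with h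
      · rw [h.1]
      · rw [zero_mul]
    rw [e1]
    refine (mul_le_mul_of_nonneg_right h2 (by positivity)).trans ?_
    split_ifs with h
    · have h3 := ballotLE_le n (n - k) (Nat.sub_le _ _)
      rw [Nat.sub_sub_self h] at h3
      obtain ⟨m, rfl⟩ := Nat.exists_eq_add_of_le h
      rw [Nat.add_sub_cancel_left] at h3 ⊢
      calc log 2 ^ k * ballotLE (k + m) k * 2 ^ k ≤ log 2 ^ k * (3 * ((m : ℝ) + 1) * exp (k + m : ℕ) * decay (k + m)) * 2 ^ k := by
            refine mul_le_mul_of_nonneg_right (mul_le_mul_of_nonneg_left h3 (by positivity)) (by positivity)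
        _ = _ := by
            have e3 : exp ((k + m : ℕ) : ℝ) = exp 1 ^ (k + m) := by rw [← exp_nat_mul, mul_one]
            rw [e3, div_pow, one_pow, mul_pow (2 * log 2), mul_pow 2 (log 2), mul_pow 2 (log 2), pow_add (log 2),
              pow_add (2 : ℝ)]
            field_simp
    · rw [ballotLE_eq_zero (by omega), mul_zero, zero_mul]
  refine (sum_le_sum h1).trans ?_
  rw [← sum_filter, ← mul_sum]
  have h6 : ∑ k ∈ (range R).filter (fun k => k ≤ n), ((((n - k : ℕ) : ℝ) + 1) ^ 1 * (1 / (2 * log 2)) ^ (n - k)) =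
      ∑ m ∈ ((range R).filter (fun k => k ≤ n)).image (fun k => n - k), (((m : ℝ) + 1) ^ 1 * (1 / (2 * log 2)) ^ m) := by
    rw [sum_image]
    intro k hk k' hk' h
    simp only [coe_filter, mem_range, Set.mem_ofPred_eq] at hk hk' h
    omega
  rw [h6]
  have hd := decay_pos n
  calc _ ≤ 3 * ((2 * log 2 * exp 1) ^ n * decay n) * K :=
        mul_le_mul_of_nonneg_left (hsum _) (by positivity)
    _ = _ := by ring

theorem exists_superBallot_subBallot {D : ℕ → Finset ℕ} (hD : ∀ i j, i ≠ j → Disjoint (D i) (D j)) (v : ℕ)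
    (A : Finset ℕ) : ∃ T ≤ v, SuperBallot D 0 0 T (A ∩ winUnion D 0 T) ∧
      SubBallot D T v (A ∩ winUnion D T v) := by
  obtain ⟨T, hT, hmax⟩ := exists_max_image (range (v + 1))
    (fun t => ((A ∩ winUnion D 0 t).card : ℤ) - t) ⟨0, by simp⟩
  rw [mem_range, Nat.lt_succ_iff] at hT
  have key : ∀ s t, s ≤ t → (A ∩ winUnion D 0 t).card = (A ∩ winUnion D 0 s).card + (A ∩ winUnion D s t).card := by
    intro s t h
    rw [winUnion_union D (Nat.zero_le s) h, inter_union_distrib_left, card_union_of_disjoint]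
    exact (disjoint_winUnion hD le_rfl).mono inter_subset_right inter_subset_right
  refine ⟨T, hT, fun t _ ht => ?_, fun t ht htv => ?_⟩
  · have h1 := hmax t (mem_range.2 (by omega))
    have h2 := key t T ht
    have e : A ∩ winUnion D 0 T ∩ winUnion D t T = A ∩ winUnion D t T := by
      rw [inter_assoc, inter_eq_right.2 (winUnion_mono D (Nat.zero_le t) le_rfl)]
    rw [e]; omega
  · have h1 := hmax t (mem_range.2 (by omega))
    have h2 := key T t ht
    have e : A ∩ winUnion D T v ∩ winUnion D T t = A ∩ winUnion D T t := by
      rw [inter_assoc, inter_eq_right.2 (winUnion_mono D le_rfl htv)]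
    rw [e]; omega

theorem card_divisors_prod_le {A : Finset ℕ} (hA : ∀ p ∈ A, p.Prime) :
    (∏ p ∈ A, p).divisors.card ≤ 2 ^ A.card := by
  induction A using Finset.induction_on with
  | empty => simp
  | insert p A hp ih =>
    rw [prod_insert hp, card_insert_of_notMem hp, pow_succ']
    refine (card_divisors_mul_le _ _).trans (Nat.mul_le_mul ?_ (ih fun q hq => hA q (mem_insert_of_mem hq)))
    rw [(hA p (mem_insert_self _ _)).divisors, card_pair (hA p (mem_insert_self _ _)).one_lt.ne]

theorem prime_of_mem_winUnion {a b p : ℕ} (h : p ∈ winUnion winD a b) : p.Prime := by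
  rw [winUnion, mem_biUnion] at h
  obtain ⟨i, _, h⟩ := h
  exact (mem_winD.1 h).1

theorem superBallot_of_insert {D : ℕ → Finset ℕ} {T p : ℕ} {A : Finset ℕ} (h : SuperBallot D 0 0 T (insert p A)) :
    SuperBallot D 1 0 T A := by
  intro t h0 ht
  have h1 := h t h0 ht
  have h2 : (insert p A ∩ winUnion D t T).card ≤ (A ∩ winUnion D t T).card + 1 := by
    refine le_trans (card_le_card ?_) (card_insert_le p _)
    intro q hq
    simp only [mem_inter, mem_insert] at hq ⊢
    tauto
  omega

theorem log_prod_eq {A : Finset ℕ} (hA : ∀ p ∈ A, p.Prime) :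
    log ((∏ p ∈ A, p : ℕ) : ℝ) = ∑ p ∈ A, log (p : ℝ) := by
  push_cast
  exact log_prod fun p hp => by exact_mod_cast (hA p hp).ne_zero

theorem prod_primes_ne_zero {A : Finset ℕ} (hA : ∀ p ∈ A, p.Prime) : ∏ p ∈ A, p ≠ 0 :=
  prod_ne_zero_iff.2 fun p hp => (hA p hp).ne_zero

theorem exists_sum_superBallot_logCount_le : ∃ K : ℝ, 0 < K ∧ ∀ T : ℕ,
    ∑ A ∈ (winUnion winD 0 T).powerset,
      (if SuperBallot winD 0 0 T A then (∏ p ∈ A, invw p) * logCount (∏ p ∈ A, p) else 0) ≤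
      K * ((2 * log 2 * exp 1) ^ T * decay T) := by
  obtain ⟨K, hK, h⟩ := exists_sum_superBallot_one_le
  refine ⟨2 ^ 16 * K, by positivity, fun T => ?_⟩
  set U := winUnion winD 0 T with hU
  set Z := ∑ A ∈ U.powerset, (if SuperBallot winD 1 0 T A then ∏ p ∈ A, invw p else 0) with hZ
  have hZ0 : ∀ A : Finset ℕ, 0 ≤ ∏ p ∈ A, invw p := fun A => prod_nonneg fun p _ => invw_nonneg p
  have hprime : ∀ A ∈ U.powerset, ∀ p ∈ A, p.Prime := fun A hA p hp =>
    prime_of_mem_winUnion (mem_powerset.1 hA hp)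
  have h1 : ∑ A ∈ U.powerset, (if SuperBallot winD 0 0 T A then (∏ p ∈ A, invw p) * logCount (∏ p ∈ A, p) else 0) ≤
      Z + ∑ A ∈ U.powerset, ∑ p ∈ A, (if SuperBallot winD 0 0 T A then (∏ p ∈ A, invw p) * log p else 0) := by
    rw [hZ, ← sum_add_distrib]
    refine sum_le_sum fun A hA => ?_
    by_cases hs : SuperBallot winD 0 0 T A
    · have hs1 : SuperBallot winD 1 0 T A := fun t h0 ht => by have := hs t h0 ht; omega
      simp only [hs, hs1, if_true]
      rw [← mul_sum, ← log_prod_eq (hprime A hA)]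
      have := mul_le_mul_of_nonneg_left (logCount_le (prod_primes_ne_zero (hprime A hA))) (hZ0 A)
      linarith
    · simp only [hs, if_false, sum_const_zero, add_zero]
      split_ifs
      · exact hZ0 A
      · exact le_rfl
  have h2 : ∑ A ∈ U.powerset, ∑ p ∈ A, (if SuperBallot winD 0 0 T A then (∏ p ∈ A, invw p) * log p else 0) ≤
      2 ^ 15 * 2 ^ T * Z := by
    rw [sum_powerset_sum_mem U (fun A p => if SuperBallot winD 0 0 T A then (∏ p ∈ A, invw p) * log p else 0), hZ, mul_sum]
    refine sum_le_sum fun A hA => ?_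
    by_cases hs1 : SuperBallot winD 1 0 T A
    · simp only [hs1, if_true]
      calc _ ≤ ∑ p ∈ U \ A, (∏ q ∈ A, invw q) * (log p * invw p) := by
            refine sum_le_sum fun p hp => ?_
            rw [mem_sdiff] at hp
            have hlog : 0 ≤ log (p : ℝ) := log_natCast_nonneg p
            split_ifs
            · rw [prod_insert hp.2]; apply le_of_eq; ring
            · exact mul_nonneg (hZ0 A) (mul_nonneg hlog (invw_nonneg p))
        _ = (∏ q ∈ A, invw q) * ∑ p ∈ U \ A, (log p * invw p) := by rw [mul_sum]
        _ ≤ (∏ q ∈ A, invw q) * (2 ^ 15 * 2 ^ T) := by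
            refine mul_le_mul_of_nonneg_left ?_ (hZ0 A)
            refine le_trans ?_ (sum_log_mul_invw_winUnion_le T)
            exact sum_le_sum_of_subset_of_nonneg sdiff_subset fun p _ _ =>
              mul_nonneg (log_natCast_nonneg p) (invw_nonneg p)
        _ = _ := by ring
    · simp only [hs1, if_false, mul_zero]
      refine sum_nonpos fun p _ => ?_
      rw [if_neg fun hs => hs1 (superBallot_of_insert hs)]
  have hT : (1 : ℝ) ≤ 2 ^ T := one_le_pow₀ (by norm_num)
  have hZ1 : 0 ≤ Z := sum_nonneg fun A _ => by split_ifs; exacts [hZ0 A, le_rfl]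
  have h3 : Z + 2 ^ 15 * 2 ^ T * Z ≤ 2 ^ 16 * 2 ^ T * Z := by nlinarith
  have e : (2 * log 2 * exp 1) ^ T = 2 ^ T * (log 2 * exp 1) ^ T := by rw [mul_assoc, mul_pow]
  calc _ ≤ 2 ^ 16 * 2 ^ T * Z := by linarith
    _ ≤ 2 ^ 16 * 2 ^ T * (K * ((log 2 * exp 1) ^ T * decay T)) := mul_le_mul_of_nonneg_left (h T) (by positivity)
    _ = _ := by rw [e]; ring

/-- The sum of `logCount a / a` over the squarefree `a` composed of primes from the first `v` windows. -/
noncomputable def coreSum (v : ℕ) : ℝ :=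
  ∑ A ∈ (winUnion winD 0 v).powerset, (∏ p ∈ A, invw p) * logCount (∏ p ∈ A, p)

theorem exists_coreSum_le : ∃ K : ℝ, 0 < K ∧ ∀ v : ℕ,
    coreSum v ≤ K * ((2 * log 2 * exp 1) ^ v * decay v) := by
  obtain ⟨K, hK, hpre⟩ := exists_sum_superBallot_logCount_le
  obtain ⟨K', hK', hpost⟩ := exists_sum_subBallot_two_pow_le
  refine ⟨2 * K * K' * 18, by positivity, fun v => ?_⟩
  have hl0 : 0 < log (2 : ℝ) := by linarith [log_two_gt]
  have hw : ∀ A : Finset ℕ, 0 ≤ ∏ p ∈ A, invw p := fun A => prod_nonneg fun p _ => invw_nonneg p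
  set f : ℕ → Finset ℕ → ℝ := fun T A =>
    if SuperBallot winD 0 0 T (A ∩ winUnion winD 0 T) ∧ SubBallot winD T v (A ∩ winUnion winD T v) then
      (∏ p ∈ A, invw p) * logCount (∏ p ∈ A, p) else 0 with hf
  have hf0 : ∀ T A, 0 ≤ f T A := by
    intro T A
    simp only [hf]
    split_ifs
    · exact mul_nonneg (hw A) (Nat.cast_nonneg _)
    · exact le_rfl
  have h1 : coreSum v ≤ ∑ T ∈ range (v + 1), ∑ A ∈ (winUnion winD 0 v).powerset, f T A := by
    rw [sum_comm, coreSum]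
    refine sum_le_sum fun A _ => ?_
    obtain ⟨T, hT, hs⟩ := exists_superBallot_subBallot disjoint_winD v A
    calc _ = f T A := by simp only [hf]; rw [if_pos hs]
      _ ≤ _ := single_le_sum (f := fun T => f T A) (fun T _ => hf0 T A) (mem_range.2 (Nat.lt_succ_of_le hT))
  refine h1.trans ?_
  have h2 : ∀ T ∈ range (v + 1), ∑ A ∈ (winUnion winD 0 v).powerset, f T A ≤
      2 * K * K' * (2 * log 2 * exp 1) ^ v * (decay T * decay (v - T)) := by
    intro T hT
    rw [mem_range, Nat.lt_succ_iff] at hT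
    have hdis : Disjoint (winUnion winD 0 T) (winUnion winD T v) := disjoint_winUnion disjoint_winD le_rfl
    rw [winUnion_union winD (Nat.zero_le T) hT, sum_powerset_union hdis]
    have hq := hpost T (v - T)
    rw [Nat.add_sub_cancel' hT] at hq
    calc _ ≤ ∑ B ∈ (winUnion winD 0 T).powerset, ∑ C ∈ (winUnion winD T v).powerset,
          2 * (if SuperBallot winD 0 0 T B then (∏ p ∈ B, invw p) * logCount (∏ p ∈ B, p) else 0) *
            (if SubBallot winD T v C then (∏ p ∈ C, invw p) * 2 ^ C.card else 0) := by
          refine sum_le_sum fun B hB => sum_le_sum fun C hC => ?_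
          rw [mem_powerset] at hB hC
          have e1 : (B ∪ C) ∩ winUnion winD 0 T = B := by
            rw [union_inter_distrib_right, inter_eq_left.2 hB,
              disjoint_iff_inter_eq_empty.1 (hdis.symm.mono_left hC), union_empty]
          have e2 : (B ∪ C) ∩ winUnion winD T v = C := by
            rw [union_inter_distrib_right, inter_eq_left.2 hC,
              disjoint_iff_inter_eq_empty.1 (hdis.mono_left hB), empty_union]
          simp only [hf]
          rw [e1, e2]
          by_cases hs : SuperBallot winD 0 0 T B
          · by_cases ht : SubBallot winD T v C
            · simp only [hs, ht, and_self, if_true]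
              rw [prod_union (hdis.mono hB hC), prod_union (hdis.mono hB hC)]
              have h3 := logCount_mul_le (∏ p ∈ B, p) (∏ p ∈ C, p)
              have h4 := card_divisors_prod_le (A := C) fun p hp => prime_of_mem_winUnion (hC hp)
              have h5 : (logCount ((∏ p ∈ B, p) * ∏ p ∈ C, p) : ℝ) ≤ 2 * 2 ^ C.card * logCount (∏ p ∈ B, p) := by
                exact_mod_cast h3.trans (Nat.mul_le_mul_right _ (Nat.mul_le_mul_left _ h4))
              calc _ ≤ (∏ p ∈ B, invw p) * (∏ p ∈ C, invw p) * (2 * 2 ^ C.card * logCount (∏ p ∈ B, p)) :=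
                    mul_le_mul_of_nonneg_left h5 (mul_nonneg (hw B) (hw C))
                _ = _ := by ring
            · simp [ht]
          · simp [hs]
      _ = 2 * (∑ B ∈ (winUnion winD 0 T).powerset,
            if SuperBallot winD 0 0 T B then (∏ p ∈ B, invw p) * logCount (∏ p ∈ B, p) else 0) *
          ∑ C ∈ (winUnion winD T v).powerset,
            if SubBallot winD T v C then (∏ p ∈ C, invw p) * 2 ^ C.card else 0 := by
          rw [mul_assoc, sum_mul_sum, mul_sum]
          refine sum_congr rfl fun B _ => ?_
          rw [mul_sum]
          refine sum_congr rfl fun C _ => ?_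
          ring
      _ ≤ 2 * (K * ((2 * log 2 * exp 1) ^ T * decay T)) *
          (K' * ((2 * log 2 * exp 1) ^ (v - T) * decay (v - T))) := by
          have hd := decay_pos T
          refine mul_le_mul (mul_le_mul_of_nonneg_left (hpre T) (by norm_num)) hq ?_ (by positivity)
          refine sum_nonneg fun C _ => ?_
          split_ifs
          · exact mul_nonneg (hw C) (by positivity)
          · exact le_rfl
      _ = _ := by
          rw [← Nat.add_sub_cancel' hT, pow_add, Nat.add_sub_cancel_left]; ring
  refine (sum_le_sum h2).trans ?_
  rw [← mul_sum]
  calc _ ≤ 2 * K * K' * (2 * log 2 * exp 1) ^ v * (18 * decay v) :=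
        mul_le_mul_of_nonneg_left (sum_decay_mul_decay_le v) (by positivity)
    _ = _ := by ring

theorem coreSum_nonneg (v : ℕ) : 0 ≤ coreSum v :=
  sum_nonneg fun _ _ => mul_nonneg (prod_nonneg fun p _ => invw_nonneg p) (Nat.cast_nonneg _)

theorem sum_logCount_mul_log_le (v : ℕ) :
    ∑ A ∈ (winUnion winD 0 v).powerset,
      (∏ p ∈ A, invw p) * logCount (∏ p ∈ A, p) * (2 ^ v + log ((∏ p ∈ A, p : ℕ) : ℝ)) ≤
      2 ^ 18 * 2 ^ v * coreSum v := by
  set U := winUnion winD 0 v with hU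
  have hw : ∀ A : Finset ℕ, 0 ≤ ∏ p ∈ A, invw p := fun A => prod_nonneg fun p _ => invw_nonneg p
  have hprime : ∀ A ∈ U.powerset, ∀ p ∈ A, p.Prime := fun A hA p hp =>
    prime_of_mem_winUnion (mem_powerset.1 hA hp)
  have h1 : ∑ A ∈ U.powerset, (∏ p ∈ A, invw p) * logCount (∏ p ∈ A, p) * (2 ^ v + log ((∏ p ∈ A, p : ℕ) : ℝ)) =
      2 ^ v * coreSum v + ∑ A ∈ U.powerset, ∑ p ∈ A, (∏ p ∈ A, invw p) * logCount (∏ p ∈ A, p) * log p := by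
    rw [coreSum, mul_sum, ← sum_add_distrib]
    refine sum_congr rfl fun A hA => ?_
    rw [← mul_sum, log_prod_eq (hprime A hA)]; ring
  have h2 : ∑ A ∈ U.powerset, ∑ p ∈ A, (∏ p ∈ A, invw p) * logCount (∏ p ∈ A, p) * log p ≤
      2 ^ 17 * 2 ^ v * coreSum v := by
    rw [sum_powerset_sum_mem U (fun A p => (∏ p ∈ A, invw p) * logCount (∏ p ∈ A, p) * log p), coreSum, mul_sum]
    refine sum_le_sum fun A hA => ?_
    calc _ ≤ ∑ p ∈ U \ A, (∏ p ∈ A, invw p) * (4 * logCount (∏ p ∈ A, p)) * (log p * invw p) := by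
          refine sum_le_sum fun p hp => ?_
          rw [mem_sdiff] at hp
          have hpp := prime_of_mem_winUnion hp.1
          have h3 := logCount_mul_le (∏ p ∈ A, p) p
          rw [hpp.divisors, card_pair hpp.one_lt.ne] at h3
          have h4 : (logCount ((∏ p ∈ A, p) * p) : ℝ) ≤ 4 * logCount (∏ p ∈ A, p) := by exact_mod_cast h3
          rw [prod_insert hp.2, prod_insert hp.2, mul_comm p]
          calc _ = (∏ p ∈ A, invw p) * (logCount ((∏ p ∈ A, p) * p)) * (log p * invw p) := by ring
            _ ≤ _ := by
              refine mul_le_mul_of_nonneg_right (mul_le_mul_of_nonneg_left h4 (hw A)) ?_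
              exact mul_nonneg (log_natCast_nonneg p) (invw_nonneg p)
      _ = (∏ p ∈ A, invw p) * (4 * logCount (∏ p ∈ A, p)) * ∑ p ∈ U \ A, (log p * invw p) := by rw [mul_sum]
      _ ≤ (∏ p ∈ A, invw p) * (4 * logCount (∏ p ∈ A, p)) * (2 ^ 15 * 2 ^ v) := by
          refine mul_le_mul_of_nonneg_left ?_ (mul_nonneg (hw A) (by positivity))
          refine le_trans ?_ (sum_log_mul_invw_winUnion_le v)
          exact sum_le_sum_of_subset_of_nonneg sdiff_subset fun p _ _ =>
            mul_nonneg (log_natCast_nonneg p) (invw_nonneg p)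
      _ = _ := by ring
  have hv : (0 : ℝ) ≤ 2 ^ v * coreSum v := mul_nonneg (by positivity) (coreSum_nonneg v)
  rw [h1]; linarith

/-- The product of all primes up to `exp (winX 0)`. -/
noncomputable def smallPrimorial : ℕ := ∏ p ∈ primesIoc 0 (exp (winX 0)), p

theorem smallPrimorial_ne_zero : smallPrimorial ≠ 0 := by
  refine prod_primes_ne_zero fun p hp => ?_
  exact ((mem_primesIoc le_rfl (exp_pos _).le).1 hp).1

theorem exists_smooth_decomposition (v a : ℕ) (ha : a ≠ 0) (h : ∀ p, p.Prime → p ∣ a → log p ≤ winX v) :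
    ∃ x : ℕ × ℕ × Finset ℕ, a = (∏ p ∈ x.2.2, p) * (x.2.1 * x.1 ^ 2) ∧ x.2.1 ∣ smallPrimorial ∧
      x.2.2 ⊆ winUnion winD 0 v ∧ x.1 ≠ 0 := by
  obtain ⟨m, b, hbm, hm⟩ := Nat.sq_mul_squarefree a
  have hb : b ≠ 0 := by rintro rfl; simp at hbm; exact ha hbm.symm
  refine ⟨(b, ∏ p ∈ m.primeFactors.filter (fun p : ℕ => log (p : ℝ) ≤ winX 0), p,
    m.primeFactors.filter (fun p : ℕ => ¬ log (p : ℝ) ≤ winX 0)), ?_, ?_, ?_, hb⟩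
  · simp only
    rw [← mul_assoc, mul_comm (∏ p ∈ _, p), prod_filter_mul_prod_filter_not,
      Nat.prod_primeFactors_of_squarefree hm, mul_comm, hbm]
  · show _ ∣ smallPrimorial
    rw [smallPrimorial]
    show ∏ p ∈ m.primeFactors.filter (fun p : ℕ => log (p : ℝ) ≤ winX 0), p ∣ _
    refine prod_dvd_prod_of_subset _ (primesIoc 0 (exp (winX 0))) (fun p : ℕ => p) fun p hp => ?_
    rw [mem_filter, Nat.mem_primeFactors] at hp
    rw [mem_primesIoc le_rfl (exp_pos _).le]
    have hp0 : (0 : ℝ) < p := by exact_mod_cast hp.1.1.pos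
    exact ⟨hp.1.1, hp0, (log_le_iff_le_exp hp0).1 hp.2⟩
  · intro p hp
    rw [mem_filter, Nat.mem_primeFactors] at hp
    rw [mem_winUnion_winD (Nat.zero_le v)]
    refine ⟨hp.1.1, not_le.1 hp.2, h p hp.1.1 (hp.1.2.1.trans ?_)⟩
    rw [← hbm]; exact dvd_mul_left m (b ^ 2)

theorem exists_sum_smooth_logCount_le : ∃ K : ℝ, 0 < K ∧ ∀ v : ℕ, ∀ S : Finset ℕ,
    (∀ a ∈ S, a ≠ 0 ∧ ∀ p, p.Prime → p ∣ a → log p ≤ winX v) →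
    ∑ a ∈ S, logCount a * (2 ^ v + log a) / (a : ℝ) ≤ K * (2 ^ v * (2 * log 2 * exp 1) ^ v * decay v) := by
  obtain ⟨K, hK, hcore⟩ := exists_coreSum_le
  obtain ⟨K', hK', hsq⟩ := exists_sum_card_divisors_le
  have hdec := exists_smooth_decomposition
  have hM := smallPrimorial_ne_zero
  generalize smallPrimorial = M at hdec hM
  have hlM : 0 ≤ log (M : ℝ) := log_natCast_nonneg M
  set τ : ℝ := (M.divisors.card : ℝ) with hτ
  have hτ0 : 0 < τ := by
    rw [hτ]; exact_mod_cast card_pos.2 (Nat.nonempty_divisors.2 hM)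
  have hw : ∀ A : Finset ℕ, 0 ≤ ∏ p ∈ A, invw p := fun A => prod_nonneg fun p _ => invw_nonneg p
  refine ⟨4 * τ * (1 + log M) * τ * K' * 2 ^ 18 * K, by positivity, fun v S hS => ?_⟩
  have hex : ∀ a : ℕ, ∃ x : ℕ × ℕ × Finset ℕ, a ∈ S → a = (∏ p ∈ x.2.2, p) * (x.2.1 * x.1 ^ 2) ∧
      x.2.1 ∣ M ∧ x.2.2 ⊆ winUnion winD 0 v ∧ x.1 ≠ 0 := by
    intro a
    by_cases ha : a ∈ S
    · obtain ⟨x, hx⟩ := hdec v a (hS a ha).1 (hS a ha).2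
      exact ⟨x, fun _ => hx⟩
    · exact ⟨(0, 0, ∅), fun h => absurd h ha⟩
  choose g hg using hex
  set F : ℕ × ℕ × Finset ℕ → ℝ := fun x =>
    4 * τ * (1 + log M) * ((((x.1 ^ 2).divisors.card : ℝ) * (1 + log x.1) / (x.1 : ℝ) ^ 2) *
      ((∏ p ∈ x.2.2, invw p) * logCount (∏ p ∈ x.2.2, p) * (2 ^ v + log ((∏ p ∈ x.2.2, p : ℕ) : ℝ)))) with hF
  have hF0 : ∀ x, 0 ≤ F x := by
    intro x
    simp only [hF]
    have h1 := log_natCast_nonneg x.1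
    have h2 := log_natCast_nonneg (∏ p ∈ x.2.2, p)
    have h3 := hw x.2.2
    positivity
  have h1 : ∀ a ∈ S, logCount a * (2 ^ v + log a) / (a : ℝ) ≤ F (g a) := by
    intro a ha
    obtain ⟨h1, h2, h3, h4⟩ := hg a ha
    simp only [hF]
    set b := (g a).1
    set s := (g a).2.1
    set A := (g a).2.2
    have hA : ∀ p ∈ A, p.Prime := fun p hp => prime_of_mem_winUnion (h3 hp)
    set P := ∏ p ∈ A, p with hP
    have hP0 : P ≠ 0 := prod_primes_ne_zero hA
    have hs0 : s ≠ 0 := ne_zero_of_dvd_ne_zero hM h2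
    have hPr : (0 : ℝ) < P := by exact_mod_cast Nat.pos_of_ne_zero hP0
    have hsr : (1 : ℝ) ≤ s := by exact_mod_cast Nat.pos_of_ne_zero hs0
    have hbr : (0 : ℝ) < b := by exact_mod_cast Nat.pos_of_ne_zero h4
    have hlb := log_natCast_nonneg b
    have hlP := log_natCast_nonneg P
    have hlog : log (a : ℝ) ≤ log P + log M + 2 * log b := by
      rw [h1]; push_cast
      rw [log_mul hPr.ne' (by positivity), log_mul (by positivity) (by positivity), log_pow]
      have : log (s : ℝ) ≤ log M := log_le_log (by linarith) (by exact_mod_cast Nat.le_of_dvd (Nat.pos_of_ne_zero hM) h2)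
      push_cast; linarith
    have hcnt : (logCount a : ℝ) ≤ 2 * (τ * (b ^ 2).divisors.card) * logCount P := by
      have e1 := logCount_mul_le P (s * b ^ 2)
      rw [← h1] at e1
      have e2 := card_divisors_mul_le s (b ^ 2)
      have e3 : s.divisors.card ≤ M.divisors.card := card_le_card (Nat.divisors_subset_of_dvd hM h2)
      rw [hτ]
      exact_mod_cast e1.trans (Nat.mul_le_mul_right _ (Nat.mul_le_mul_left _ (e2.trans (Nat.mul_le_mul_right _ e3))))
    have h2v : (1 : ℝ) ≤ 2 ^ v := one_le_pow₀ (by norm_num)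
    have hinv : ∏ p ∈ A, invw p = 1 / (P : ℝ) := by
      rw [hP]; push_cast
      simp only [invw, one_div, prod_inv_distrib]
    have ha' : (1 : ℝ) / a ≤ 1 / (P * (b : ℝ) ^ 2) := by
      refine one_div_le_one_div_of_le (by positivity) ?_
      rw [h1]; push_cast
      calc (P : ℝ) * (b : ℝ) ^ 2 = P * (1 * (b : ℝ) ^ 2) := by ring
        _ ≤ _ := by gcongr
    have hlog2 : 2 ^ v + log (a : ℝ) ≤ 2 * (1 + log M) * (1 + log b) * (2 ^ v + log P) := by
      have i1 : 2 ^ v + log (a : ℝ) ≤ (2 ^ v + log P) + (log M + 2 * log b) := by linarith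
      have i2 : (log M + 2 * log b) * 1 ≤ (log M + 2 * log b) * (2 ^ v + log P) :=
        mul_le_mul_of_nonneg_left (by linarith) (by positivity)
      have i3 : 1 + log M + 2 * log b ≤ 2 * (1 + log M) * (1 + log b) := by nlinarith [mul_nonneg hlM hlb]
      have i4 := mul_le_mul_of_nonneg_right i3 (show (0:ℝ) ≤ 2 ^ v + log P by linarith)
      linarith
    have hla := log_natCast_nonneg a
    calc logCount a * (2 ^ v + log a) / (a : ℝ) = (logCount a * (2 ^ v + log a)) * (1 / a) := by ring
      _ ≤ ((2 * (τ * (b ^ 2).divisors.card) * logCount P) * (2 * (1 + log M) * (1 + log b) * (2 ^ v + log P))) *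
          (1 / (P * (b : ℝ) ^ 2)) := by
        have n1 : 0 ≤ 2 ^ v + log (a : ℝ) := by linarith
        have n2 : 0 ≤ 2 * (τ * (b ^ 2).divisors.card) * logCount P := (Nat.cast_nonneg _).trans hcnt
        refine mul_le_mul (mul_le_mul hcnt hlog2 n1 n2) ha' ?_ (mul_nonneg n2 (n1.trans hlog2))
        exact one_div_nonneg.2 (Nat.cast_nonneg a)
      _ = _ := by rw [hinv]; ring
  have hinj : Set.InjOn g S := by
    intro a ha a' ha' h
    rw [mem_coe] at ha ha'
    rw [(hg a ha).1, (hg a' ha').1, h]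
  have hsub : S.image g ⊆ S.image (fun a => (g a).1) ×ˢ (M.divisors ×ˢ (winUnion winD 0 v).powerset) := by
    intro x hx
    rw [mem_image] at hx
    obtain ⟨a, ha, rfl⟩ := hx
    obtain ⟨h1, h2, h3, h4⟩ := hg a ha
    simp only [mem_product, mem_powerset, Nat.mem_divisors]
    exact ⟨mem_image_of_mem _ ha, ⟨h2, hM⟩, h3⟩
  calc _ ≤ ∑ a ∈ S, F (g a) := sum_le_sum h1
    _ = ∑ x ∈ S.image g, F x := (sum_image hinj).symm
    _ ≤ ∑ x ∈ S.image (fun a => (g a).1) ×ˢ (M.divisors ×ˢ (winUnion winD 0 v).powerset), F x :=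
        sum_le_sum_of_subset_of_nonneg hsub fun x _ _ => hF0 x
    _ = 4 * τ * (1 + log M) * ((∑ b ∈ S.image (fun a => (g a).1), ((b ^ 2).divisors.card : ℝ) * (1 + log b) / (b : ℝ) ^ 2) *
          (τ * ∑ A ∈ (winUnion winD 0 v).powerset,
      (∏ p ∈ A, invw p) * logCount (∏ p ∈ A, p) * (2 ^ v + log ((∏ p ∈ A, p : ℕ) : ℝ)))) := by
        simp only [hF]
        rw [sum_product, sum_mul, mul_sum]
        refine sum_congr rfl fun b _ => ?_
        rw [sum_product]
        simp only [sum_const, nsmul_eq_mul]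
        rw [← hτ, mul_sum, mul_sum, mul_sum, mul_sum]
        refine sum_congr rfl fun A _ => ?_
        ring
    _ ≤ 4 * τ * (1 + log M) * (K' * (τ * (2 ^ 18 * 2 ^ v * (K * ((2 * log 2 * exp 1) ^ v * decay v))))) := by
        refine mul_le_mul_of_nonneg_left ?_ (by positivity)
        refine mul_le_mul (hsq _) (mul_le_mul_of_nonneg_left ?_ hτ0.le) (mul_nonneg hτ0.le ?_) hK'.le
        · refine (sum_logCount_mul_log_le v).trans ?_
          exact mul_le_mul_of_nonneg_left (hcore v) (by positivity)
        · refine sum_nonneg fun A _ => mul_nonneg (mul_nonneg (hw A) (Nat.cast_nonneg _)) ?_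
          have := log_natCast_nonneg (∏ p ∈ A, p)
          positivity
    _ = _ := by ring

theorem decay_le_sub_sq_mul {u v : ℕ} (h : u ≤ v) : decay u ≤ (((v - u : ℕ) : ℝ) + 1) ^ 2 * decay v := by
  obtain ⟨m, rfl⟩ := Nat.exists_eq_add_of_le h
  rw [Nat.add_sub_cancel_left]
  unfold decay
  rw [mul_one_div, div_le_div_iff₀ (by positivity) (by positivity), one_mul]
  push_cast
  have h1 : (u : ℝ) + m + 1 ≤ (m + 1) * (u + 1) := by
    have : (0 : ℝ) ≤ m * u := by positivity
    nlinarith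
  have h2 : √((u : ℝ) + m + 1) ≤ (m + 1) * √((u : ℝ) + 1) := by
    rw [sqrt_le_left (by positivity), mul_pow, sq_sqrt (by positivity)]
    refine h1.trans ?_
    have : (0 : ℝ) ≤ m * ((m + 1) * (u + 1)) := by positivity
    nlinarith
  calc ((u : ℝ) + m + 1) * √((u : ℝ) + m + 1) ≤ ((m + 1) * (u + 1)) * ((m + 1) * √((u : ℝ) + 1)) := by gcongr
    _ = _ := by ring

theorem one_lt_log_two_mul_exp : 1 < log 2 * exp 1 := by
  have h1 := log_two_gt
  have h2 := add_one_le_exp (1 : ℝ)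
  have h3 := exp_one_gt_d9
  nlinarith

theorem exists_sum_pow_mul_decay_le : ∃ K : ℝ, 0 < K ∧ ∀ v : ℕ,
    ∑ u ∈ range (v + 1), (log 2 * exp 1) ^ u * decay u ≤ K * ((log 2 * exp 1) ^ v * decay v) := by
  have hr := one_lt_log_two_mul_exp
  generalize log 2 * exp 1 = r at hr
  obtain ⟨K, hK, hsum⟩ := exists_sum_pow_mul_geometric_le (r := 1 / r) (by positivity)
    (by rw [div_lt_one (by positivity)]; exact hr) 2
  refine ⟨K, hK, fun v => ?_⟩
  have h1 : ∀ u ∈ range (v + 1), r ^ u * decay u ≤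
      r ^ v * decay v * ((((v - u : ℕ) : ℝ) + 1) ^ 2 * (1 / r) ^ (v - u)) := by
    intro u hu
    rw [mem_range, Nat.lt_succ_iff] at hu
    have e : r ^ v * (1 / r) ^ (v - u) = r ^ u := by
      obtain ⟨m, rfl⟩ := Nat.exists_eq_add_of_le hu
      have : 0 < r := by linarith
      rw [Nat.add_sub_cancel_left, pow_add, div_pow, one_pow]
      field_simp
    calc r ^ u * decay u ≤ r ^ u * ((((v - u : ℕ) : ℝ) + 1) ^ 2 * decay v) :=
          mul_le_mul_of_nonneg_left (decay_le_sub_sq_mul hu) (by positivity)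
      _ = _ := by rw [← e]; ring
  refine (sum_le_sum h1).trans ?_
  have h2 := sum_range_reflect (fun m : ℕ => ((m : ℝ) + 1) ^ 2 * (1 / r) ^ m) (v + 1)
  simp only [Nat.add_sub_cancel] at h2
  rw [← mul_sum, h2]
  have hd := decay_pos v
  rw [mul_comm K]
  refine mul_le_mul_of_nonneg_left (hsum (range (v + 1))) (by positivity)

/-- The primes up to `exp (winX 0)` for `u = 0`, the window `u - 1` otherwise. -/
noncomputable def cell : ℕ → Finset ℕ
  | 0 => primesIoc 0 (exp (winX 0))
  | u + 1 => winD u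

theorem mem_cell_bounds {u p : ℕ} (h : p ∈ cell u) : p.Prime ∧ 2 ^ u / 2 ≤ log (p : ℝ) ∧ log (p : ℝ) ≤ winX u := by
  cases u with
  | zero =>
    rw [cell, mem_primesIoc le_rfl (exp_pos _).le] at h
    have h2 : (2 : ℝ) ≤ p := by exact_mod_cast h.1.two_le
    refine ⟨h.1, ?_, ?_⟩
    · have := log_le_log (by norm_num) h2
      rw [pow_zero]; linarith [log_two_gt]
    · rw [log_le_iff_le_exp (by linarith)]; exact h.2.2
  | succ u =>
    rw [cell, mem_winD_log] at h
    refine ⟨h.1, ?_, h.2.2⟩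
    have := two_pow_le_winX u
    have e : (2 : ℝ) ^ (u + 1) = 2 * 2 ^ u := by ring
    linarith

theorem exists_mem_cell {v p : ℕ} (hp : p.Prime) (h : log (p : ℝ) ≤ winX v) : ∃ u ≤ v, p ∈ cell u := by
  have hp0 : (0 : ℝ) < p := by exact_mod_cast hp.pos
  by_cases h0 : log (p : ℝ) ≤ winX 0
  · refine ⟨0, Nat.zero_le v, ?_⟩
    rw [cell, mem_primesIoc le_rfl (exp_pos _).le]
    exact ⟨hp, hp0, (log_le_iff_le_exp hp0).1 h0⟩
  · have := (mem_winUnion_winD (Nat.zero_le v)).2 ⟨hp, not_le.1 h0, h⟩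
    rw [winUnion, mem_biUnion] at this
    obtain ⟨u, hu, hpu⟩ := this
    exact ⟨u + 1, (mem_Ico.1 hu).2, hpu⟩

theorem exists_sum_cell_ratio_le : ∃ K : ℝ, 0 < K ∧ ∀ (u : ℕ) (z : ℝ) (S : Finset ℕ), S ⊆ cell u →
    (∀ p ∈ S, z / 16 < p ∧ (p : ℝ) ≤ z) → ∑ p ∈ S, invw p ≤ K / 2 ^ u := by
  refine ⟨200 + ∑ p ∈ cell 0, invw p, ?_, fun u z S hS hz => ?_⟩
  · have : 0 ≤ ∑ p ∈ cell 0, invw p := sum_nonneg fun p _ => invw_nonneg p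
    linarith
  have h0 : 0 ≤ ∑ p ∈ cell 0, invw p := sum_nonneg fun p _ => invw_nonneg p
  cases u with
  | zero =>
    have := sum_le_sum_of_subset_of_nonneg hS fun p _ _ => invw_nonneg p
    rw [pow_zero, div_one]; linarith
  | succ u =>
    have h1 := sum_prime_inv_ratio_le (x := winX u) (z := z) (by linarith [winX_big u]) S fun p hp => by
      obtain ⟨a, b, _⟩ := mem_winD_log.1 (hS hp)
      exact ⟨a, b, hz p hp⟩
    refine h1.trans ?_
    have e : (2 : ℝ) ^ (u + 1) = 2 * 2 ^ u := by ring
    have h2 := two_pow_le_winX u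
    have h3 : (0 : ℝ) < 2 ^ u := by positivity
    rw [e, div_le_div_iff₀ (by linarith) (by positivity)]
    nlinarith

theorem exists_smooth_mul_rough (p m : ℕ) (hm : m ≠ 0) : ∃ a b, m = a * b ∧
    (∀ q, q.Prime → q ∣ a → q < p) ∧ ∀ q, q.Prime → q ∣ b → p ≤ q := by
  induction m using induction_on_primes with
  | zero => exact absurd rfl hm
  | one =>
    exact ⟨1, 1, rfl, fun q hq h => absurd (Nat.dvd_one.1 h) hq.one_lt.ne',
      fun q hq h => absurd (Nat.dvd_one.1 h) hq.one_lt.ne'⟩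
  | prime_mul r m hr ih =>
    obtain ⟨a, b, rfl, ha, hb⟩ := ih (right_ne_zero_of_mul hm)
    rcases lt_or_ge r p with h | h
    · refine ⟨r * a, b, (mul_assoc _ _ _).symm, fun q hq hd => ?_, hb⟩
      rcases (hq.dvd_mul).1 hd with h1 | h1
      · rwa [(Nat.prime_dvd_prime_iff_eq hq hr).1 h1]
      · exact ha q hq h1
    · refine ⟨a, r * b, by ring, ha, fun q hq hd => ?_⟩
      rcases (hq.dvd_mul).1 hd with h1 | h1
      · rwa [(Nat.prime_dvd_prime_iff_eq hq hr).1 h1]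
      · exact hb q hq h1

/-- The integers up to `X` of the form `n * m` with `n ∈ (y / 2, y]` and the largest prime factor of
`n` at most that of `m`. -/
noncomputable def productClass (y : ℝ) (X : ℕ) : Finset ℕ :=
  (Icc 1 X).filter fun k => ∃ n m : ℕ, k = n * m ∧ y / 2 < n ∧ (n : ℝ) ≤ y ∧ 1 < n ∧
    ∀ q, q.Prime → q ∣ n → ∃ q', q'.Prime ∧ q ≤ q' ∧ q' ∣ m

theorem exists_factorization_of_mem_productClass {y : ℝ} {X v k : ℕ} (hy : log y ≤ winX v)
    (hk : k ∈ productClass y X) : ∃ u ≤ v, ∃ p ∈ cell u, ∃ a b : ℕ, k = a * p * b ∧ a ∈ Icc 1 X ∧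
      (∀ q, q.Prime → q ∣ a → log (q : ℝ) ≤ winX u) ∧ (∃ d ∈ a.divisors, y / 2 < p * d ∧ (p : ℝ) * d ≤ y) ∧
      b ∈ rough p (X / (a * p)) ∧ p ≤ X / (a * p) := by
  simp only [productClass, mem_filter, mem_Icc] at hk
  obtain ⟨⟨hk1, hkX⟩, n, m, hnm, hn1, hn2, hn3, hq⟩ := hk
  have hn0 : n ≠ 0 := by omega
  have hm0 : m ≠ 0 := by rintro rfl; simp at hnm; omega
  obtain ⟨p, hp, hmax⟩ := exists_max_image n.primeFactors id (Nat.nonempty_primeFactors.2 hn3)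
  rw [Nat.mem_primeFactors] at hp
  obtain ⟨hpp, ⟨d, rfl⟩, _⟩ := hp
  have hd0 : d ≠ 0 := right_ne_zero_of_mul hn0
  have hp0 : (0 : ℝ) < p := by exact_mod_cast hpp.pos
  have hpy : (p : ℝ) ≤ y := by
    refine le_trans ?_ hn2
    exact_mod_cast Nat.le_mul_of_pos_right p (Nat.pos_of_ne_zero hd0)
  obtain ⟨u, huv, hpu⟩ := exists_mem_cell (v := v) hpp ((log_le_log hp0 hpy).trans hy)
  obtain ⟨a', b, rfl, ha', hb⟩ := exists_smooth_mul_rough p m hm0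
  have ha0 : a' ≠ 0 := left_ne_zero_of_mul hm0
  have hb0 : b ≠ 0 := right_ne_zero_of_mul hm0
  have hpb : p ≤ b := by
    obtain ⟨q', hq', hpq, hdvd⟩ := hq p hpp (dvd_mul_right p d)
    rcases hq'.dvd_mul.1 hdvd with h | h
    · have := ha' q' hq' h; omega
    · exact hpq.trans (Nat.le_of_dvd (Nat.pos_of_ne_zero hb0) h)
  have hk' : k = d * a' * p * b := by rw [hnm]; ring
  have hap : 0 < d * a' * p := Nat.pos_of_ne_zero (mul_ne_zero (mul_ne_zero hd0 ha0) hpp.ne_zero)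
  have hbX : b ≤ X / (d * a' * p) := by
    rw [Nat.le_div_iff_mul_le hap, mul_comm, ← hk']; exact hkX
  refine ⟨u, huv, p, hpu, d * a', b, hk', ?_, ?_, ⟨d, ?_, ?_⟩, ?_, hpb.trans hbX⟩
  · rw [mem_Icc]
    refine ⟨Nat.pos_of_ne_zero (mul_ne_zero hd0 ha0), le_trans ?_ hkX⟩
    rw [hk', mul_assoc]
    exact Nat.le_mul_of_pos_right _ (Nat.pos_of_ne_zero (mul_ne_zero hpp.ne_zero hb0))
  · intro q hq1 hqa
    have hqp : q ≤ p := by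
      rcases hq1.dvd_mul.1 hqa with h | h
      · exact hmax q (Nat.mem_primeFactors.2 ⟨hq1, Dvd.dvd.mul_left h p, hn0⟩)
      · exact (ha' q hq1 h).le
    have hq0 : (0 : ℝ) < q := by exact_mod_cast hq1.pos
    exact (log_le_log hq0 (by exact_mod_cast hqp)).trans (mem_cell_bounds hpu).2.2
  · exact Nat.mem_divisors.2 ⟨dvd_mul_right d a', mul_ne_zero hd0 ha0⟩
  · push_cast at hn1 hn2; exact ⟨hn1, hn2⟩
  · rw [mem_rough]
    exact ⟨⟨Nat.pos_of_ne_zero hb0, hbX⟩, hb⟩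

theorem card_productClass_le_sum {y : ℝ} {X v : ℕ} (hy : log y ≤ winX v) :
    ((productClass y X).card : ℝ) ≤ ∑ u ∈ range (v + 1), ∑ p ∈ cell u, ∑ a ∈ Icc 1 X,
      if (∀ q, q.Prime → q ∣ a → log (q : ℝ) ≤ winX u) ∧ (∃ d ∈ a.divisors, y / 2 < p * d ∧ (p : ℝ) * d ≤ y) then
        32 * X / a * (invw p / log p) else 0 := by
  set G : ℕ → ℕ → ℕ → Finset ℕ := fun u p a =>
    if ((∀ q, q.Prime → q ∣ a → log (q : ℝ) ≤ winX u) ∧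
      (∃ d ∈ a.divisors, y / 2 < p * d ∧ (p : ℝ) * d ≤ y)) ∧ p ≤ X / (a * p) then
      (rough p (X / (a * p))).image fun b => a * p * b else ∅ with hG
  have hsub : productClass y X ⊆ (range (v + 1)).biUnion fun u => (cell u).biUnion fun p =>
      (Icc 1 X).biUnion fun a => G u p a := by
    intro k hk
    obtain ⟨u, hu, p, hp, a, b, hk1, ha, h1, h2, h3, h4⟩ := exists_factorization_of_mem_productClass hy hk
    simp only [mem_biUnion]
    refine ⟨u, mem_range.2 (Nat.lt_succ_of_le hu), p, hp, a, ha, ?_⟩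
    simp only [hG]
    rw [if_pos ⟨⟨h1, h2⟩, h4⟩, mem_image]
    exact ⟨b, h3, hk1.symm⟩
  have h1 : (productClass y X).card ≤ ∑ u ∈ range (v + 1), ∑ p ∈ cell u, ∑ a ∈ Icc 1 X, (G u p a).card := by
    refine (card_le_card hsub).trans (card_biUnion_le.trans (sum_le_sum fun u _ => ?_))
    exact card_biUnion_le.trans (sum_le_sum fun p _ => card_biUnion_le)
  refine (Nat.cast_le (α := ℝ).2 h1).trans ?_
  push_cast
  refine sum_le_sum fun u _ => sum_le_sum fun p hp => sum_le_sum fun a ha => ?_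
  have hpp := (mem_cell_bounds hp).1
  have hp2 : (2 : ℝ) ≤ p := by exact_mod_cast hpp.two_le
  have hlp : 0 < log (p : ℝ) := log_pos (by linarith)
  have ha0 : (0 : ℝ) < a := by exact_mod_cast (mem_Icc.1 ha).1
  simp only [hG]
  by_cases h2 : (∀ q, q.Prime → q ∣ a → log (q : ℝ) ≤ winX u) ∧ (∃ d ∈ a.divisors, y / 2 < p * d ∧ (p : ℝ) * d ≤ y)
  · rw [if_pos h2]
    by_cases h3 : p ≤ X / (a * p)
    · rw [if_pos ⟨h2, h3⟩]
      have h4 := card_rough_le p _ hpp.two_le h3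
      have h5 : ((X / (a * p) : ℕ) : ℝ) ≤ X / (a * p) := by
        have := Nat.cast_div_le (α := ℝ) (m := X) (n := a * p)
        push_cast at this; exact this
      calc _ ≤ ((rough p (X / (a * p))).card : ℝ) := by exact_mod_cast card_image_le
        _ ≤ 32 * ((X / (a * p) : ℕ) : ℝ) / log p := h4
        _ ≤ 32 * ((X : ℝ) / (a * p)) / log p :=
          div_le_div_of_nonneg_right (mul_le_mul_of_nonneg_left h5 (by norm_num)) hlp.le
        _ = _ := by rw [invw]; field_simp
    · rw [if_neg fun h => h3 h.2, card_empty, Nat.cast_zero]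
      have := invw_nonneg p
      positivity
  · rw [if_neg h2, if_neg fun h => h2 h.1, card_empty, Nat.cast_zero]

theorem sum_biUnion_le_of_nonneg {ι : Type*} (J : Finset ι) (S : ι → Finset ℕ) {f : ℕ → ℝ} (hf : ∀ p, 0 ≤ f p) :
    ∑ p ∈ J.biUnion S, f p ≤ ∑ j ∈ J, ∑ p ∈ S j, f p := by
  calc _ ≤ ∑ p ∈ J.biUnion S, ∑ j ∈ J, if p ∈ S j then f p else 0 := by
        refine sum_le_sum fun p hp => ?_
        obtain ⟨j, hj, hp⟩ := mem_biUnion.1 hp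
        calc f p = if p ∈ S j then f p else 0 := (if_pos hp).symm
          _ ≤ _ := single_le_sum (f := fun j => if p ∈ S j then f p else 0)
            (fun i _ => by split_ifs; exacts [hf p, le_rfl]) hj
    _ = ∑ j ∈ J, ∑ p ∈ J.biUnion S, if p ∈ S j then f p else 0 := sum_comm
    _ = _ := by
        refine sum_congr rfl fun j hj => ?_
        rw [← sum_filter]
        refine sum_congr ?_ fun _ _ => rfl
        ext p
        rw [mem_filter]
        exact ⟨fun h => h.2, fun h => ⟨mem_biUnion.2 ⟨j, hj, h⟩, h⟩⟩

theorem exists_sum_cell_divisor_le : ∃ K : ℝ, 0 < K ∧ ∀ (u a : ℕ) (y : ℝ), 0 < a →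
    ∑ p ∈ (cell u).filter (fun p : ℕ => ∃ d ∈ a.divisors, y / 2 < p * d ∧ (p : ℝ) * d ≤ y), invw p / log p ≤
      K * logCount a / 4 ^ u := by
  obtain ⟨K, hK, h⟩ := exists_sum_cell_ratio_le
  refine ⟨2 * K, by positivity, fun u a y ha => ?_⟩
  set J := a.divisors.image (Nat.log 4)
  set S : ℕ → Finset ℕ := fun j => (cell u).filter fun p : ℕ => y / 4 ^ j / 16 < p ∧ (p : ℝ) ≤ y / 4 ^ j with hS
  have hsub : (cell u).filter (fun p : ℕ => ∃ d ∈ a.divisors, y / 2 < p * d ∧ (p : ℝ) * d ≤ y) ⊆ J.biUnion S := by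
    intro p hp
    rw [mem_filter] at hp
    obtain ⟨hpu, d, hd, h1, h2⟩ := hp
    have hp0 : (0 : ℝ) < p := by exact_mod_cast (mem_cell_bounds hpu).1.pos
    rw [mem_biUnion]
    refine ⟨Nat.log 4 d, mem_image_of_mem _ hd, ?_⟩
    simp only [hS, mem_filter]
    have hd0 := (Nat.pos_of_mem_divisors hd).ne'
    have h3 : (4 : ℝ) ^ Nat.log 4 d ≤ d := by exact_mod_cast Nat.pow_log_le_self 4 hd0
    have h4 : (d : ℝ) < 4 ^ (Nat.log 4 d + 1) := by exact_mod_cast Nat.lt_pow_succ_log_self (by norm_num) d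
    have h5 : (0 : ℝ) < 4 ^ Nat.log 4 d := by positivity
    rw [pow_succ] at h4
    refine ⟨hpu, ?_, ?_⟩
    · rw [div_div, div_lt_iff₀ (by positivity)]
      have := mul_lt_mul_of_pos_left h4 hp0
      have h6 := mul_pos hp0 h5
      nlinarith
    · rw [le_div_iff₀ h5]
      exact (mul_le_mul_of_nonneg_left h3 hp0.le).trans h2
  have hlog : ∀ p ∈ cell u, invw p / log p ≤ 2 / 2 ^ u * invw p := by
    intro p hp
    obtain ⟨_, h1, _⟩ := mem_cell_bounds hp
    have h2 : (0 : ℝ) < 2 ^ u := by positivity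
    rw [div_le_iff₀ (by linarith)]
    have h3 := invw_nonneg p
    calc invw p = 2 / 2 ^ u * invw p * (2 ^ u / 2) := by field_simp
      _ ≤ _ := mul_le_mul_of_nonneg_left h1 (by positivity)
  have hpos : ∀ p, 0 ≤ invw p := invw_nonneg
  calc _ ≤ ∑ p ∈ (cell u).filter (fun p : ℕ => ∃ d ∈ a.divisors, y / 2 < p * d ∧ (p : ℝ) * d ≤ y),
        2 / 2 ^ u * invw p := sum_le_sum fun p hp => hlog p (mem_filter.1 hp).1
    _ ≤ ∑ p ∈ J.biUnion S, 2 / 2 ^ u * invw p :=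
        sum_le_sum_of_subset_of_nonneg hsub fun p _ _ => mul_nonneg (by positivity) (hpos p)
    _ ≤ ∑ j ∈ J, ∑ p ∈ S j, 2 / 2 ^ u * invw p :=
        sum_biUnion_le_of_nonneg J S fun p => mul_nonneg (by positivity) (hpos p)
    _ ≤ ∑ j ∈ J, 2 / 2 ^ u * (K / 2 ^ u) := by
        refine sum_le_sum fun j _ => ?_
        rw [← mul_sum]
        refine mul_le_mul_of_nonneg_left (h u (y / 4 ^ j) _ (filter_subset _ _) fun p hp => ?_) (by positivity)
        exact (mem_filter.1 hp).2
    _ = _ := by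
        rw [sum_const, nsmul_eq_mul]
        have : (4 : ℝ) ^ u = 2 ^ u * 2 ^ u := by rw [← mul_pow]; norm_num
        rw [this, show J.card = logCount a from rfl]
        field_simp

theorem exists_card_productClass_le : ∃ K : ℝ, 0 < K ∧ ∀ (v X : ℕ) (y : ℝ), 2 ^ v ≤ log y → log y ≤ winX v →
    ((productClass y X).card : ℝ) ≤ K * X * ((log 2 * exp 1 / 2) ^ v * decay v) := by
  obtain ⟨K₁, hK₁, hdiv⟩ := exists_sum_cell_divisor_le
  obtain ⟨K₂, hK₂, hsm⟩ := exists_sum_smooth_logCount_le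
  obtain ⟨K₃, hK₃, hgeo⟩ := exists_sum_pow_mul_decay_le
  refine ⟨32 * K₁ * 2 ^ 15 * K₂ * K₃, by positivity, fun v X y hy1 hy2 => ?_⟩
  have hl0 : 0 < log (2 : ℝ) := by linarith [log_two_gt]
  have h2v : (1 : ℝ) ≤ 2 ^ v := one_le_pow₀ (by norm_num)
  have hly : 0 < log y := by linarith
  have hy0 : y ≠ 0 := by rintro rfl; simp at hly
  refine (card_productClass_le_sum hy2).trans ?_
  have hu : ∀ u ∈ range (v + 1), (∑ p ∈ cell u, ∑ a ∈ Icc 1 X,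
      if (∀ q, q.Prime → q ∣ a → log (q : ℝ) ≤ winX u) ∧ (∃ d ∈ a.divisors, y / 2 < p * d ∧ (p : ℝ) * d ≤ y) then
        32 * X / a * (invw p / log p) else 0) ≤
      32 * X * K₁ * 2 ^ 15 * K₂ / log y * ((log 2 * exp 1) ^ u * decay u) := by
    intro u _
    set A : Finset ℕ := (Icc 1 X).filter fun a : ℕ => ∀ q : ℕ, q.Prime → q ∣ a → log (q : ℝ) ≤ winX u with hA
    have hA0 : ∀ a ∈ A, a ≠ 0 ∧ ∀ p : ℕ, p.Prime → p ∣ a → log p ≤ winX u := by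
      intro a ha
      rw [hA, mem_filter, mem_Icc] at ha
      exact ⟨by omega, ha.2⟩
    have hsa : ∀ a ∈ A, (∑ p ∈ cell u, if (∃ d ∈ a.divisors, y / 2 < p * d ∧ (p : ℝ) * d ≤ y) then
        32 * X / (a : ℝ) * (invw p / log p) else 0) ≤
        32 * X * K₁ * 2 ^ 15 / log y / 4 ^ u * (logCount a * (2 ^ u + log a) / (a : ℝ)) := by
      intro a ha
      have ha1 := Nat.pos_of_ne_zero (hA0 a ha).1
      have ha0 : (0 : ℝ) < a := by exact_mod_cast ha1
      have hla := log_natCast_nonneg a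
      rw [← sum_filter, ← mul_sum]
      rcases eq_empty_or_nonempty ((cell u).filter fun p : ℕ => ∃ d ∈ a.divisors, y / 2 < p * d ∧ (p : ℝ) * d ≤ y)
        with he | ⟨p, hp⟩
      · rw [he, sum_empty, mul_zero]; positivity
      have hlog : log y ≤ 2 ^ 15 * (2 ^ u + log a) := by
        rw [mem_filter] at hp
        obtain ⟨hpu, d, hd, h1, h2⟩ := hp
        obtain ⟨hpp, h3, h4⟩ := mem_cell_bounds hpu
        have hp0 : (0 : ℝ) < p := by exact_mod_cast hpp.pos
        have hd0 : (0 : ℝ) < d := by exact_mod_cast Nat.pos_of_mem_divisors hd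
        have hda : (d : ℝ) ≤ a := by exact_mod_cast Nat.divisor_le hd
        have hyp : 0 < y := lt_of_lt_of_le (mul_pos hp0 hd0) h2
        have h5 : y ≤ 2 * (p * a) := by
          have := mul_le_mul_of_nonneg_left hda hp0.le
          linarith
        have h6 := log_le_log hyp h5
        rw [log_mul (by norm_num) (by positivity), log_mul hp0.ne' ha0.ne'] at h6
        have h7 := winX_le u
        have h8 : (1 : ℝ) ≤ 2 ^ u := one_le_pow₀ (by norm_num)
        linarith [log_two_lt]
      have h9 : (1 : ℝ) ≤ 2 ^ 15 * (2 ^ u + log a) / log y := by rwa [one_le_div hly]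
      calc _ ≤ 32 * X / (a : ℝ) * (K₁ * logCount a / 4 ^ u) :=
            mul_le_mul_of_nonneg_left (hdiv u a y ha1) (by positivity)
        _ ≤ 32 * X / (a : ℝ) * (K₁ * logCount a / 4 ^ u) * (2 ^ 15 * (2 ^ u + log a) / log y) :=
            le_mul_of_one_le_right (by positivity) h9
        _ = _ := by ring
    have hd := decay_pos u
    calc _ = ∑ a ∈ A, ∑ p ∈ cell u, if (∃ d ∈ a.divisors, y / 2 < p * d ∧ (p : ℝ) * d ≤ y) then
          32 * X / (a : ℝ) * (invw p / log p) else 0 := by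
          rw [sum_comm, hA, sum_filter]
          refine sum_congr rfl fun a _ => ?_
          by_cases h : ∀ q, q.Prime → q ∣ a → log (q : ℝ) ≤ winX u
          · rw [if_pos h]
            refine sum_congr rfl fun p _ => ?_
            by_cases h2 : ∃ d ∈ a.divisors, y / 2 < p * d ∧ (p : ℝ) * d ≤ y
            · rw [if_pos ⟨h, h2⟩, if_pos h2]
            · rw [if_neg fun h' => h2 h'.2, if_neg h2]
          · rw [if_neg h]
            refine sum_eq_zero fun p _ => ?_
            rw [if_neg fun h' => h h'.1]
      _ ≤ ∑ a ∈ A, 32 * X * K₁ * 2 ^ 15 / log y / 4 ^ u * (logCount a * (2 ^ u + log a) / (a : ℝ)) :=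
          sum_le_sum hsa
      _ ≤ 32 * X * K₁ * 2 ^ 15 / log y / 4 ^ u * (K₂ * (2 ^ u * (2 * log 2 * exp 1) ^ u * decay u)) := by
          rw [← mul_sum]
          exact mul_le_mul_of_nonneg_left (hsm u A hA0) (by positivity)
      _ = _ := by
          have : (4 : ℝ) ^ u = 2 ^ u * 2 ^ u := by rw [← mul_pow]; norm_num
          rw [this, mul_assoc 2, mul_pow 2]
          field_simp
  refine (sum_le_sum hu).trans ?_
  rw [← mul_sum]
  have hd := decay_pos v
  calc _ ≤ 32 * X * K₁ * 2 ^ 15 * K₂ / log y * (K₃ * ((log 2 * exp 1) ^ v * decay v)) :=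
        mul_le_mul_of_nonneg_left (hgeo v) (by positivity)
    _ ≤ 32 * X * K₁ * 2 ^ 15 * K₂ / 2 ^ v * (K₃ * ((log 2 * exp 1) ^ v * decay v)) := by
        refine mul_le_mul_of_nonneg_right ?_ (by positivity)
        exact div_le_div_of_nonneg_left (by positivity) (by positivity) hy1
    _ = _ := by rw [div_pow]; ring

theorem mem_productClass_of_factors {N k n m : ℕ} {Q : ℝ} (hQ : 1 ≤ Q) (hk : k ∈ Icc 1 N) (hn : (n : ℝ) ≤ √N)
    (hm : (m : ℝ) ≤ √N) (hnm : k = n * m) (hnQ : Q < n)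
    (hq : ∀ q, q.Prime → q ∣ n → ∃ q', q'.Prime ∧ q ≤ q' ∧ q' ∣ m) :
    ∃ i ∈ (range (N + 1)).filter (fun i => Q < √N / 2 ^ i), k ∈ productClass (√N / 2 ^ i) (N / 2 ^ i) := by
  rw [mem_Icc] at hk
  have hn0 : (0 : ℝ) < n := by linarith
  obtain ⟨i, hi1, hi2⟩ := exists_nat_pow_near (x := √N / n) (y := 2) (by rwa [one_le_div hn0]) (by norm_num)
  rw [le_div_iff₀ hn0] at hi1
  rw [div_lt_iff₀ hn0] at hi2
  have h2i : (0 : ℝ) < 2 ^ i := by positivity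
  have hni : (n : ℝ) ≤ √N / 2 ^ i := by rw [le_div_iff₀ h2i]; linarith
  have hkN : k * 2 ^ i ≤ N := by
    have : (k : ℝ) * 2 ^ i ≤ N := by
      rw [hnm]; push_cast
      calc (n : ℝ) * m * 2 ^ i = (2 ^ i * n) * m := by ring
        _ ≤ √N * √N := mul_le_mul hi1 hm (Nat.cast_nonneg m) (sqrt_nonneg _)
        _ = N := mul_self_sqrt (Nat.cast_nonneg N)
    exact_mod_cast this
  refine ⟨i, ?_, ?_⟩
  · rw [mem_filter, mem_range]
    refine ⟨?_, lt_of_lt_of_le hnQ hni⟩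
    have h1 := Nat.lt_two_pow_self (n := i)
    have h2 : 2 ^ i ≤ k * 2 ^ i := Nat.le_mul_of_pos_left _ hk.1
    omega
  · rw [productClass, mem_filter, mem_Icc]
    refine ⟨⟨hk.1, ?_⟩, n, m, hnm, ?_, hni, ?_, hq⟩
    · rwa [Nat.le_div_iff_mul_le (by positivity)]
    · rw [div_div, div_lt_iff₀ (by positivity), ← pow_succ, mul_comm]; exact hi2
    · have : (1 : ℝ) < n := by linarith
      exact_mod_cast this

theorem one_div_pow_three_le (v : ℕ) : 1 / ((2 : ℝ) ^ v) ^ 3 ≤ (log 2 * exp 1 / 2) ^ v * decay v := by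
  have h1 := one_lt_log_two_mul_exp
  have h2 : (1 / 2 : ℝ) ^ v ≤ (log 2 * exp 1 / 2) ^ v := pow_le_pow_left₀ (by norm_num) (by linarith) v
  have h3 : (v : ℝ) + 1 ≤ 2 ^ v := by exact_mod_cast Nat.lt_two_pow_self (n := v)
  have h4 : 1 / ((2 : ℝ) ^ v) ^ 2 ≤ decay v := by
    unfold decay
    refine one_div_le_one_div_of_le (by positivity) ?_
    rw [sq]
    refine mul_le_mul h3 ?_ (sqrt_nonneg _) (by positivity)
    refine le_trans ?_ h3
    rw [sqrt_le_left (by positivity)]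
    have : (0 : ℝ) ≤ v := Nat.cast_nonneg v
    nlinarith
  have h5 := mul_le_mul h2 h4 (by positivity) (by positivity)
  refine le_trans (le_of_eq ?_) h5
  rw [div_pow, one_pow]
  field_simp

theorem exists_multTableCount_le : ∃ K : ℝ, 0 < K ∧ ∀ N v : ℕ, winX v < log N → log N ≤ winX (v + 1) →
    (multTableCount N : ℝ) ≤ K * N * ((log 2 * exp 1 / 2) ^ v * decay v) := by
  obtain ⟨K, hK, hcls⟩ := exists_card_productClass_le
  refine ⟨6 + 2 * K, by positivity, fun N v h1 h2 => ?_⟩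
  have hlN : 0 < log (N : ℝ) := by linarith [winX_big v]
  have hN0 : (0 : ℝ) < N := by
    rcases Nat.eq_zero_or_pos N with h | h
    · subst h; simp at hlN
    · exact_mod_cast h
  set Q := exp (log N / 4) with hQ
  have hQ1 : 1 ≤ Q := one_le_exp (by positivity)
  have hQ4 : Q ^ 4 = N := by
    rw [hQ, ← exp_nat_mul, show ((4 : ℕ) : ℝ) * (log N / 4) = log N by push_cast; ring, exp_log hN0]
  have hsq : √N = Q ^ 2 := by
    rw [← hQ4, show Q ^ 4 = (Q ^ 2) ^ 2 by ring, sqrt_sq (by positivity)]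
  set G := (log 2 * exp 1 / 2) ^ v * decay v with hG
  have h2v : (1 : ℝ) ≤ 2 ^ v := one_le_pow₀ (by norm_num)
  have hv12 := winX_ge v
  have hQG : 1 ≤ 6 * (Q * G) := by
    have h3 := pow_div_factorial_le_exp (log N / 4) (by positivity) 3
    have h4 : ((2 : ℝ) ^ v) ^ 3 ≤ (log N / 4) ^ 3 := pow_le_pow_left₀ (by positivity) (by linarith) 3
    have h5 := one_div_pow_three_le v
    rw [← hG] at h5
    have h6 : ((2 : ℝ) ^ v) ^ 3 / 6 ≤ Q := by
      refine le_trans ?_ h3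
      rw [show ((Nat.factorial 3 : ℕ) : ℝ) = 6 by norm_num [Nat.factorial]]
      linarith
    have h7 := mul_le_mul h6 h5 (by positivity) (by positivity)
    have e : ((2 : ℝ) ^ v) ^ 3 / 6 * (1 / ((2 : ℝ) ^ v) ^ 3) = 1 / 6 := by field_simp
    rw [e] at h7; linarith
  set I := (range (N + 1)).filter (fun i => Q < √N / 2 ^ i) with hI
  have hsub : (Icc 1 N).filter (fun k => ∃ n m : ℕ, (n : ℝ) ≤ √N ∧ (m : ℝ) ≤ √N ∧ k = n * m) ⊆
      Icc 1 ⌊Q ^ 3⌋₊ ∪ I.biUnion fun i => productClass (√N / 2 ^ i) (N / 2 ^ i) := by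
    intro k hk
    rw [mem_filter] at hk
    obtain ⟨hk, n, m, hn, hm, hnm⟩ := hk
    rw [mem_union]
    by_cases hnQ : (n : ℝ) ≤ Q
    · left
      rw [mem_Icc]
      refine ⟨(mem_Icc.1 hk).1, Nat.le_floor ?_⟩
      rw [hnm]; push_cast
      calc (n : ℝ) * m ≤ Q * Q ^ 2 := mul_le_mul hnQ (by rwa [← hsq]) (Nat.cast_nonneg m) (by positivity)
        _ = _ := by ring
    by_cases hmQ : (m : ℝ) ≤ Q
    · left
      rw [mem_Icc]
      refine ⟨(mem_Icc.1 hk).1, Nat.le_floor ?_⟩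
      rw [hnm]; push_cast
      calc (n : ℝ) * m ≤ Q ^ 2 * Q := mul_le_mul (by rwa [← hsq]) hmQ (Nat.cast_nonneg m) (by positivity)
        _ = _ := by ring
    right
    rw [mem_biUnion]
    by_cases hq : ∀ q, q.Prime → q ∣ n → ∃ q', q'.Prime ∧ q ≤ q' ∧ q' ∣ m
    · exact mem_productClass_of_factors hQ1 hk hn hm hnm (not_le.1 hnQ) hq
    · push Not at hq
      obtain ⟨q, hqp, hqn, hq⟩ := hq
      refine mem_productClass_of_factors hQ1 hk hm hn (by rw [hnm, mul_comm]) (not_le.1 hmQ) fun q' hq' hd => ?_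
      refine ⟨q, hqp, ?_, hqn⟩
      by_contra hlt
      exact hq q' hq' (not_le.1 hlt).le hd
  have hcard : multTableCount N ≤ ⌊Q ^ 3⌋₊ + ∑ i ∈ I, (productClass (√N / 2 ^ i) (N / 2 ^ i)).card := by
    refine (card_le_card hsub).trans ((card_union_le _ _).trans ?_)
    rw [Nat.card_Icc, Nat.add_sub_cancel]
    exact Nat.add_le_add_left card_biUnion_le _
  have hG0 : 0 < G := by have := decay_pos v; positivity
  have hi : ∀ i ∈ I, ((productClass (√N / 2 ^ i) (N / 2 ^ i)).card : ℝ) ≤ K * N * G * (1 / 2) ^ i := by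
    intro i hi
    rw [hI, mem_filter] at hi
    have h2i : (1 : ℝ) ≤ 2 ^ i := one_le_pow₀ (by norm_num)
    have hlow : log N / 4 ≤ log (√N / 2 ^ i) := by
      have := log_le_log (exp_pos _) hi.2.le
      rwa [log_exp] at this
    have hup : log (√N / 2 ^ i) ≤ log N := by
      refine log_le_log (by linarith [hi.2]) ?_
      refine (div_le_self (sqrt_nonneg _) h2i).trans ?_
      rw [hsq, ← hQ4]; exact pow_le_pow_right₀ hQ1 (by norm_num)
    have e2 : (2 : ℝ) ^ (v + 1) = 2 * 2 ^ v := by ring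
    have h3 := hcls (v + 1) (N / 2 ^ i) (√N / 2 ^ i) (by rw [e2]; linarith) (hup.trans h2)
    have h4 : ((N / 2 ^ i : ℕ) : ℝ) ≤ N * (1 / 2) ^ i := by
      have := Nat.cast_div_le (α := ℝ) (m := N) (n := 2 ^ i)
      push_cast at this
      rw [div_pow, one_pow, mul_one_div]; exact this
    have h5 : (log 2 * exp 1 / 2) ^ (v + 1) * decay (v + 1) ≤ G := by
      have hl := log_two_gt
      have hl2 := log_two_lt
      have he := exp_one_lt_d9
      have he0 := exp_pos 1
      rw [hG]
      refine mul_le_mul ?_ (decay_anti (Nat.le_succ v)) (decay_pos _).le (by positivity)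
      exact pow_le_pow_of_le_one (by positivity) (by nlinarith) (Nat.le_succ v)
    calc _ ≤ _ := h3
      _ ≤ K * (N * (1 / 2) ^ i) * G := by
        refine mul_le_mul (mul_le_mul_of_nonneg_left h4 hK.le) h5 ?_ (by positivity)
        have := decay_pos (v + 1)
        positivity
      _ = _ := by ring
  have hgeo : ∑ i ∈ I, (1 / 2 : ℝ) ^ i ≤ 2 :=
    (sum_le_sum_of_subset_of_nonneg (filter_subset _ _) fun _ _ _ => by positivity).trans (sum_geometric_two_le _)
  calc (multTableCount N : ℝ) ≤ (⌊Q ^ 3⌋₊ : ℝ) + ∑ i ∈ I, ((productClass (√N / 2 ^ i) (N / 2 ^ i)).card : ℝ) := by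
        exact_mod_cast hcard
    _ ≤ Q ^ 3 + ∑ i ∈ I, K * N * G * (1 / 2) ^ i := add_le_add (Nat.floor_le (by positivity)) (sum_le_sum hi)
    _ ≤ Q ^ 3 * (6 * (Q * G)) + K * N * G * 2 := by
        rw [← mul_sum]
        exact add_le_add (le_mul_of_one_le_right (by positivity) hQG) (mul_le_mul_of_nonneg_left hgeo (by positivity))
    _ = 6 * Q ^ 4 * G + K * N * G * 2 := by ring
    _ = _ := by rw [hQ4]; ring

/-- Pairs of subsets of `A` whose products lie in the same dyadic interval to base four. -/
noncomputable def logPairs (A : Finset ℕ) : Finset (Finset ℕ × Finset ℕ) :=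
  (A.powerset ×ˢ A.powerset).filter fun x => Nat.log 4 (∏ q ∈ x.1, q) = Nat.log 4 (∏ q ∈ x.2, q)

/-- Pairs of subsets of `B` which agree on the windows `s + 1, …, v - 1` and whose products become
comparable after multiplying the first one by `p`. -/
noncomputable def splitPairs (v s p : ℕ) (B : Finset ℕ) : Finset (Finset ℕ × Finset ℕ) :=
  (B.powerset ×ˢ B.powerset).filter fun x =>
    x.1 ∩ winUnion winD (s + 1) v = x.2 ∩ winUnion winD (s + 1) v ∧
      Nat.log 4 (p * ∏ q ∈ x.1, q) = Nat.log 4 (∏ q ∈ x.2, q)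

theorem four_pow_card_le {A : Finset ℕ} (h0 : ∀ p ∈ A, p ≠ 0) :
    4 ^ A.card ≤ logCount (∏ p ∈ A, p) * (logPairs A).card := by
  set I := A.powerset.image fun Y => Nat.log 4 (∏ q ∈ Y, q) with hI
  have h1 : ∑ j ∈ I, (A.powerset.filter fun Y => Nat.log 4 (∏ q ∈ Y, q) = j).card = 2 ^ A.card := by
    rw [← card_powerset]
    exact (card_eq_sum_card_image _ _).symm
  have h2 : ∑ j ∈ I, (A.powerset.filter fun Y => Nat.log 4 (∏ q ∈ Y, q) = j).card ^ 2 = (logPairs A).card := by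
    rw [card_eq_sum_card_fiberwise (f := fun x : Finset ℕ × Finset ℕ => Nat.log 4 (∏ q ∈ x.1, q)) (t := I)]
    · refine sum_congr rfl fun j _ => ?_
      rw [sq, ← card_product]
      congr 1
      ext ⟨Y, Z⟩
      simp only [logPairs, mem_product, mem_filter]
      constructor
      · rintro ⟨⟨a, b⟩, c, d⟩; exact ⟨⟨⟨a, c⟩, b.trans d.symm⟩, b⟩
      · rintro ⟨⟨⟨a, c⟩, b⟩, d⟩; exact ⟨⟨a, d⟩, c, b.symm.trans d⟩
    · intro x hx
      simp only [logPairs, coe_filter, mem_product, Set.mem_ofPred_eq] at hx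
      exact mem_coe.2 (mem_image_of_mem _ hx.1.1)
  have h3 : I.card ≤ logCount (∏ p ∈ A, p) := by
    refine card_le_card fun j hj => ?_
    rw [hI, mem_image] at hj
    obtain ⟨Y, hY, rfl⟩ := hj
    refine mem_image_of_mem _ (Nat.mem_divisors.2 ⟨prod_dvd_prod_of_subset _ _ _ (mem_powerset.1 hY), ?_⟩)
    exact prod_ne_zero_iff.2 h0
  have h4 := sq_sum_le_card_mul_sum_sq (s := I)
    (f := fun j => (A.powerset.filter fun Y => Nat.log 4 (∏ q ∈ Y, q) = j).card)
  rw [h1, h2, ← pow_mul, mul_comm A.card 2, pow_mul] at h4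
  exact h4.trans (Nat.mul_le_mul_right _ h3)

theorem card_logPairs_le {v : ℕ} {A : Finset ℕ} (hA : A ⊆ winUnion winD 0 v) :
    (logPairs A).card ≤ 2 ^ A.card +
      ∑ s ∈ range v, ∑ p ∈ A, if p ∈ winD s then 2 * (splitPairs v s p (A.erase p)).card else 0 := by
  set F : Finset (Finset ℕ × Finset ℕ) := (range v).biUnion fun s => (A.filter fun p : ℕ => p ∈ winD s).biUnion fun p =>
    ((splitPairs v s p (A.erase p)).image fun x => (insert p x.1, x.2)) ∪
      ((splitPairs v s p (A.erase p)).image fun x => (x.2, insert p x.1)) with hF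
  have hsub : logPairs A ⊆ (A.powerset.image fun Y => (Y, Y)) ∪ F := by
    rintro ⟨Y, Z⟩ hx
    simp only [logPairs, mem_filter, mem_product, mem_powerset] at hx
    obtain ⟨⟨hY, hZ⟩, hlog⟩ := hx
    rw [mem_union]
    by_cases hYZ : Y = Z
    · left
      subst hYZ
      exact mem_image_of_mem _ (mem_powerset.2 hY)
    · right
      have hne : (symmDiff Y Z).Nonempty := by
        rw [nonempty_iff_ne_empty]
        intro h
        exact hYZ (symmDiff_eq_bot.1 h)
      obtain ⟨p, hp, hmax⟩ := exists_max_image (symmDiff Y Z) id hne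
      have hpA : p ∈ A := by
        rw [mem_symmDiff] at hp
        rcases hp with h | h
        exacts [hY h.1, hZ h.1]
      have hpU := hA hpA
      rw [winUnion, mem_biUnion] at hpU
      obtain ⟨s, hs, hps⟩ := hpU
      have hagree : Y ∩ winUnion winD (s + 1) v = Z ∩ winUnion winD (s + 1) v := by
        ext q
        simp only [mem_inter]
        refine and_congr_left fun hq => ?_
        by_contra hcon
        have hq2 : q ∈ symmDiff Y Z := by
          rw [mem_symmDiff]; tauto
        have hle : q ≤ p := hmax q hq2
        have h1 := (mem_winUnion_winD (by rw [mem_Ico] at hs; omega)).1 hq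
        have h2 := (mem_winD_log.1 hps)
        have h3 : log (q : ℝ) ≤ log p := log_le_log (by exact_mod_cast h1.1.pos) (by exact_mod_cast hle)
        linarith [h1.2.1, h2.2.2]
      have hpn : p ∉ winUnion winD (s + 1) v := fun hq => by
        have h1 := (mem_winUnion_winD (by rw [mem_Ico] at hs; omega)).1 hq
        linarith [(mem_winD_log.1 hps).2.2, h1.2.1]
      rw [hF]
      refine mem_biUnion.2 ⟨s, mem_range.2 (mem_Ico.1 hs).2, mem_biUnion.2 ⟨p, mem_filter.2 ⟨hpA, hps⟩, ?_⟩⟩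
      rw [mem_union, mem_image, mem_image]
      have key : ∀ Y Z : Finset ℕ, Y ⊆ A → Z ⊆ A → Nat.log 4 (∏ q ∈ Y, q) = Nat.log 4 (∏ q ∈ Z, q) →
          Y ∩ winUnion winD (s + 1) v = Z ∩ winUnion winD (s + 1) v → p ∈ Y → p ∉ Z →
          (Y.erase p, Z) ∈ splitPairs v s p (A.erase p) := by
        intro Y Z hY hZ hlog hag hpY hpZ
        simp only [splitPairs, mem_filter, mem_product, mem_powerset]
        refine ⟨⟨erase_subset_erase p hY, fun q hq => mem_erase.2 ⟨fun h => hpZ (h ▸ hq), hZ hq⟩⟩, ?_, ?_⟩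
        · rw [← hag, erase_inter, erase_eq_of_notMem fun h => hpn (mem_inter.1 h).2]
        · rw [mul_prod_erase Y (fun q => q) hpY]; exact hlog
      rw [mem_symmDiff] at hp
      rcases hp with h | h
      · left
        exact ⟨_, key Y Z hY hZ hlog hagree h.1 h.2, by rw [insert_erase h.1]⟩
      · right
        exact ⟨_, key Z Y hZ hY hlog.symm hagree.symm h.1 h.2, by rw [insert_erase h.1]⟩
  refine (card_le_card hsub).trans ((card_union_le _ _).trans (Nat.add_le_add ?_ ?_))
  · exact card_image_le.trans (card_powerset A).le
  · refine card_biUnion_le.trans (sum_le_sum fun s _ => ?_)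
    rw [← sum_filter]
    refine card_biUnion_le.trans (sum_le_sum fun p _ => ?_)
    refine (card_union_le _ _).trans ?_
    rw [two_mul]
    exact Nat.add_le_add card_image_le card_image_le

theorem sum_invw_card_splitPairs_le (v s : ℕ) {B : Finset ℕ} (hB : B ⊆ winUnion winD 0 v) :
    ∑ p ∈ winD s, invw p * (splitPairs v s p B).card ≤
      100 / winX s * (2 ^ B.card * 2 ^ (B ∩ winUnion winD 0 (s + 1)).card) := by
  have hX := winX_big s
  have hprime : ∀ p ∈ B, p.Prime := fun p hp => prime_of_mem_winUnion (hB hp)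
  set Q := (B.powerset ×ˢ B.powerset).filter fun x =>
    x.1 ∩ winUnion winD (s + 1) v = x.2 ∩ winUnion winD (s + 1) v with hQ
  have h1 : ∀ p, splitPairs v s p B = Q.filter fun x => Nat.log 4 (p * ∏ q ∈ x.1, q) = Nat.log 4 (∏ q ∈ x.2, q) := by
    intro p
    rw [splitPairs, hQ, filter_filter]
  have h2 : ∑ p ∈ winD s, invw p * (splitPairs v s p B).card =
      ∑ x ∈ Q, ∑ p ∈ (winD s).filter (fun p : ℕ => Nat.log 4 (p * ∏ q ∈ x.1, q) = Nat.log 4 (∏ q ∈ x.2, q)), invw p := by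
    simp_rw [h1, card_filter, sum_filter]
    rw [sum_comm]
    refine sum_congr rfl fun p _ => ?_
    push_cast
    rw [mul_sum]
    refine sum_congr rfl fun x _ => ?_
    split_ifs <;> simp
  have h3 : ∀ x ∈ Q, ∑ p ∈ (winD s).filter (fun p : ℕ => Nat.log 4 (p * ∏ q ∈ x.1, q) = Nat.log 4 (∏ q ∈ x.2, q)), invw p ≤
      100 / winX s := by
    intro x hx
    simp only [hQ, mem_filter, mem_product, mem_powerset] at hx
    have hm : ∏ q ∈ x.1, q ≠ 0 := prod_primes_ne_zero fun p hp => hprime p (hx.1.1 hp)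
    set m := ∏ q ∈ x.1, q with hmdef
    set j := Nat.log 4 (∏ q ∈ x.2, q) with hj
    have hm0 : (0 : ℝ) < m := by exact_mod_cast Nat.pos_of_ne_zero hm
    refine sum_prime_inv_ratio_le (z := 4 ^ (j + 1) / m) (by linarith) _ fun p hp => ?_
    rw [mem_filter, mem_winD_log] at hp
    refine ⟨hp.1.1, hp.1.2.1, ?_, ?_⟩
    · have h4 := Nat.pow_log_le_self 4 (mul_ne_zero hp.1.1.ne_zero hm)
      rw [hp.2] at h4
      have h5 : (4 : ℝ) ^ j ≤ p * m := by exact_mod_cast h4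
      rw [div_div, div_lt_iff₀ (by positivity)]
      have : (0 : ℝ) < 4 ^ j := by positivity
      rw [pow_succ]
      nlinarith
    · have h4 := Nat.lt_pow_succ_log_self (b := 4) (by norm_num) (p * m)
      rw [hp.2] at h4
      have h5 : (p : ℝ) * m < 4 ^ (j + 1) := by exact_mod_cast h4
      rw [le_div_iff₀ hm0]
      exact h5.le
  have h4 : Q.card ≤ 2 ^ B.card * 2 ^ (B ∩ winUnion winD 0 (s + 1)).card := by
    rw [← card_powerset, ← card_powerset, ← card_product]
    refine card_le_card_of_injOn (fun x => (x.1, x.2 ∩ winUnion winD 0 (s + 1))) ?_ ?_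
    · intro x hx
      simp only [hQ, coe_filter, mem_product, mem_powerset, Set.mem_ofPred_eq] at hx
      simp only [coe_product, Set.mem_prod, mem_coe, mem_powerset]
      exact ⟨hx.1.1, inter_subset_inter_right hx.1.2⟩
    · rintro ⟨Y, Z⟩ hx ⟨Y', Z'⟩ hx' h
      simp only [hQ, coe_filter, mem_product, mem_powerset, Set.mem_ofPred_eq] at hx hx'
      simp only [Prod.mk.injEq] at h ⊢
      obtain ⟨rfl, h⟩ := h
      refine ⟨rfl, ?_⟩
      have h5 : Z ∩ winUnion winD (s + 1) v = Z' ∩ winUnion winD (s + 1) v := hx.2.symm.trans hx'.2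
      have hcov : winUnion winD 0 v ⊆ winUnion winD 0 (s + 1) ∪ winUnion winD (s + 1) v := by
        rcases le_total (s + 1) v with hsv | hsv
        · rw [← winUnion_union winD (Nat.zero_le _) hsv]
        · exact (winUnion_mono winD le_rfl hsv).trans subset_union_left
      rw [← inter_eq_left.2 (hx.1.2.trans (hB.trans hcov)), ← inter_eq_left.2 (hx'.1.2.trans (hB.trans hcov)),
        inter_union_distrib_left, inter_union_distrib_left, h, h5]
  rw [h2]
  refine (sum_le_sum h3).trans ?_
  rw [sum_const, nsmul_eq_mul, mul_comm]
  refine mul_le_mul_of_nonneg_left ?_ (div_nonneg (by norm_num) (by linarith))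
  exact_mod_cast h4

theorem prod_invw_nonneg (A : Finset ℕ) : 0 ≤ ∏ p ∈ A, invw p := prod_nonneg fun p _ => invw_nonneg p

theorem subSum_mul_superSum_le (u v m : ℕ) (huv : u ≤ v) (hm : m < u) :
    subSum winD invw 0 u (u - (m + 1)) * 2 ^ (u - (m + 1)) * superSum winD invw 0 u v (v - u + m) ≤
      144 / log 2 * (2 ^ u * ((log 2 * exp 1) ^ v * (decay u * decay (v - u)))) *
        (((m : ℝ) + 1) ^ 5 * (1 / 2) ^ m) := by
  have hl0 : 0 < log (2 : ℝ) := by linarith [log_two_gt]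
  have h1 := subSum_le disjoint_winD invw_nonneg sum_winD_le 0 u (u - (m + 1))
  rw [zero_add] at h1
  have h2 := superSum_le disjoint_winD invw_nonneg sum_winD_le 0 u (v - u) (v - u + m)
  rw [Nat.add_sub_cancel' huv] at h2
  have h3 := ballotLE_le u (m + 1) hm
  have h4 := ballotGE_le (v - u) m
  obtain ⟨k, rfl⟩ := Nat.exists_eq_add_of_le (show m + 1 ≤ u from hm)
  obtain ⟨T, rfl⟩ := Nat.exists_eq_add_of_le huv
  rw [Nat.add_sub_cancel_left] at h1 h2 h3 h4
  rw [Nat.add_sub_cancel_left, Nat.add_sub_cancel_left]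
  have hd1 := decay_pos (m + 1 + k)
  have hd2 := decay_pos T
  have h5 := h1.trans (mul_le_mul_of_nonneg_left h3 (by positivity))
  have h6 := h2.trans (mul_le_mul_of_nonneg_left h4 (by positivity))
  have h7 : 0 ≤ superSum winD invw 0 (m + 1 + k) (m + 1 + k + T) (T + m) :=
    sum_nonneg fun A _ => by split_ifs; exacts [prod_invw_nonneg A, le_rfl]
  have e1 : exp ((m + 1 + k : ℕ) : ℝ) = exp 1 ^ (m + 1 + k) := by rw [← exp_nat_mul, mul_one]
  have e2 : exp ((T : ℕ) : ℝ) = exp 1 ^ T := by rw [← exp_nat_mul, mul_one]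
  rw [e1] at h5
  rw [e2] at h6
  refine (mul_le_mul (mul_le_mul_of_nonneg_right h5 (by positivity)) h6 h7 (by positivity)).trans ?_
  have e3 : log 2 ^ k * log 2 ^ (T + m) = 1 / log 2 * log 2 ^ (m + 1 + k + T) := by
    rw [show m + 1 + k + T = k + (T + m) + 1 by ring, pow_succ, ← pow_add]
    field_simp
  have e4 : (2 : ℝ) ^ k = 1 / 2 * 2 ^ (m + 1 + k) * (1 / 2) ^ m := by
    rw [show m + 1 + k = k + m + 1 by ring, pow_succ, pow_add, div_pow, one_pow]
    field_simp
  have e5 : exp 1 ^ (m + 1 + k) * exp 1 ^ T = exp 1 ^ (m + 1 + k + T) := by rw [← pow_add]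
  have e6 : log 2 ^ k * (3 * (((m + 1 : ℕ) : ℝ) + 1) * exp 1 ^ (m + 1 + k) * decay (m + 1 + k)) * 2 ^ k *
      (log 2 ^ (T + m) * (24 * ((m : ℝ) + 1) ^ 4 * exp 1 ^ T * decay T)) =
      72 * (log 2 ^ k * log 2 ^ (T + m)) * (exp 1 ^ (m + 1 + k) * exp 1 ^ T) * 2 ^ k *
        (decay (m + 1 + k) * decay T) * ((((m + 1 : ℕ) : ℝ) + 1) * ((m : ℝ) + 1) ^ 4) := by ring
  rw [e6, e3, e4, e5]
  have e7 : 144 / log 2 * (2 ^ (m + 1 + k) * ((log 2 * exp 1) ^ (m + 1 + k + T) * (decay (m + 1 + k) * decay T))) *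
        (((m : ℝ) + 1) ^ 5 * (1 / 2) ^ m) =
      72 * (1 / log 2 * log 2 ^ (m + 1 + k + T)) * exp 1 ^ (m + 1 + k + T) *
      (1 / 2 * 2 ^ (m + 1 + k) * (1 / 2) ^ m) * (decay (m + 1 + k) * decay T) * (4 * ((m : ℝ) + 1) * ((m : ℝ) + 1) ^ 4) := by
    rw [mul_pow]; ring
  rw [e7]
  refine mul_le_mul_of_nonneg_left (mul_le_mul_of_nonneg_right ?_ (by positivity)) (by positivity)
  push_cast
  have : (0 : ℝ) ≤ m := Nat.cast_nonneg m
  linarith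

theorem exists_sum_subBallot_superBallot_le : ∃ K : ℝ, 0 < K ∧ ∀ u v : ℕ, u ≤ v →
    ∑ A ∈ (winUnion winD 0 v).powerset, (if A.card + 1 = v ∧ SubBallot winD 0 u (A ∩ winUnion winD 0 u) ∧
        SuperBallot winD 0 u v (A ∩ winUnion winD u v) then
          (∏ p ∈ A, invw p) * 2 ^ (A ∩ winUnion winD 0 u).card else 0) ≤
      K * (2 ^ u * ((log 2 * exp 1) ^ v * (decay u * decay (v - u)))) := by
  have hl0 : 0 < log (2 : ℝ) := by linarith [log_two_gt]
  obtain ⟨K, hK, hsum⟩ := exists_sum_pow_mul_geometric_le (r := 1 / 2) (by norm_num) (by norm_num) 5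
  refine ⟨144 / log 2 * K, by positivity, fun u v huv => ?_⟩
  have hdis : Disjoint (winUnion winD 0 u) (winUnion winD u v) := disjoint_winUnion disjoint_winD le_rfl
  rw [winUnion_union winD (Nat.zero_le u) huv, sum_powerset_union hdis]
  have h1 : ∀ B ∈ (winUnion winD 0 u).powerset, ∀ C ∈ (winUnion winD u v).powerset,
      (if (B ∪ C).card + 1 = v ∧ SubBallot winD 0 u ((B ∪ C) ∩ winUnion winD 0 u) ∧
        SuperBallot winD 0 u v ((B ∪ C) ∩ winUnion winD u v) then
          (∏ p ∈ B ∪ C, invw p) * 2 ^ ((B ∪ C) ∩ winUnion winD 0 u).card else 0) ≤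
      ∑ m ∈ range u, (if B.card = u - (m + 1) ∧ SubBallot winD 0 u B then ∏ p ∈ B, invw p else 0) *
        2 ^ (u - (m + 1)) *
        (if C.card = v - u + m ∧ SuperBallot winD 0 u v C then ∏ p ∈ C, invw p else 0) := by
    intro B hB C hC
    rw [mem_powerset] at hB hC
    have e1 : (B ∪ C) ∩ winUnion winD 0 u = B := by
      rw [union_inter_distrib_right, inter_eq_left.2 hB,
        disjoint_iff_inter_eq_empty.1 (hdis.symm.mono_left hC), union_empty]
    have e2 : (B ∪ C) ∩ winUnion winD u v = C := by
      rw [union_inter_distrib_right, inter_eq_left.2 hC,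
        disjoint_iff_inter_eq_empty.1 (hdis.mono_left hB), empty_union]
    have hBC := hdis.mono hB hC
    have hnn : ∀ m, 0 ≤ (if B.card = u - (m + 1) ∧ SubBallot winD 0 u B then ∏ p ∈ B, invw p else 0) *
        2 ^ (u - (m + 1)) *
        (if C.card = v - u + m ∧ SuperBallot winD 0 u v C then ∏ p ∈ C, invw p else 0) := by
      intro m
      refine mul_nonneg (mul_nonneg ?_ (by positivity)) ?_
      · split_ifs; exacts [prod_invw_nonneg B, le_rfl]
      · split_ifs; exacts [prod_invw_nonneg C, le_rfl]
    rw [e1, e2, card_union_of_disjoint hBC, prod_union hBC]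
    split_ifs with h
    · obtain ⟨hc, hs, hS⟩ := h
      have h2 := hS u le_rfl huv
      rw [inter_eq_left.2 hC] at h2
      have h3 := hs u (Nat.zero_le _) le_rfl
      rw [inter_eq_left.2 hB] at h3
      have hlt : B.card < u := by omega
      refine le_trans (le_of_eq ?_) (single_le_sum (fun m _ => hnn m) (mem_range.2 (show u - B.card - 1 < u by omega)))
      rw [if_pos ⟨by omega, hs⟩, if_pos ⟨by omega, hS⟩, show u - (u - B.card - 1 + 1) = B.card by omega]
      ring
    · exact sum_nonneg fun m _ => hnn m
  refine (sum_le_sum fun B hB => sum_le_sum fun C hC => h1 B hB C hC).trans ?_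
  have h2 : ∑ B ∈ (winUnion winD 0 u).powerset, ∑ C ∈ (winUnion winD u v).powerset,
      ∑ m ∈ range u, (if B.card = u - (m + 1) ∧ SubBallot winD 0 u B then ∏ p ∈ B, invw p else 0) *
        2 ^ (u - (m + 1)) *
        (if C.card = v - u + m ∧ SuperBallot winD 0 u v C then ∏ p ∈ C, invw p else 0) =
      ∑ m ∈ range u, subSum winD invw 0 u (u - (m + 1)) * 2 ^ (u - (m + 1)) * superSum winD invw 0 u v (v - u + m) := by
    symm
    rw [sum_congr rfl fun m _ => show _ = _ by rw [subSum, superSum, sum_mul, sum_mul_sum], sum_comm]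
    exact sum_congr rfl fun B _ => sum_comm
  rw [h2]
  refine (sum_le_sum fun m hm => subSum_mul_superSum_le u v m huv (mem_range.1 hm)).trans ?_
  rw [← mul_sum]
  have hd1 := decay_pos u
  have hd2 := decay_pos (v - u)
  refine (mul_le_mul_of_nonneg_left (hsum (range u)) (by positivity)).trans (le_of_eq ?_)
  ring

theorem subBallot_mono {D : ℕ → Finset ℕ} {a b : ℕ} {A B : Finset ℕ} (h : SubBallot D a b B) (hAB : A ⊆ B) :
    SubBallot D a b A := fun t h1 h2 =>
  (Nat.add_le_add_left (card_le_card (inter_subset_inter_right hAB)) a).trans (h t h1 h2)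

theorem superBallot_of_subBallot {D : ℕ → Finset ℕ} (hD : ∀ i j, i ≠ j → Disjoint (D i) (D j)) {u v : ℕ}
    {A : Finset ℕ} (hA : A ⊆ winUnion D 0 v) (hcard : A.card = v) (h : SubBallot D 0 v A) :
    SuperBallot D 0 u v A := by
  intro t _ ht
  have h1 := h t (Nat.zero_le t) ht
  have h2 : A.card = (A ∩ winUnion D 0 t).card + (A ∩ winUnion D t v).card := by
    rw [← card_union_of_disjoint ((disjoint_winUnion hD le_rfl).mono inter_subset_right inter_subset_right),
      ← inter_union_distrib_left, ← winUnion_union D (Nat.zero_le t) ht, inter_eq_left.2 hA]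
  omega

theorem ballots_of_insert {s v p : ℕ} (hs : s < v) {A : Finset ℕ} (hA : A ⊆ winUnion winD 0 v) (hp : p ∈ winD s)
    (hpA : p ∉ A) (hcard : (insert p A).card = v) (h : SubBallot winD 0 v (insert p A)) :
    A.card + 1 = v ∧ SubBallot winD 0 (s + 1) (A ∩ winUnion winD 0 (s + 1)) ∧
      SuperBallot winD 0 (s + 1) v (A ∩ winUnion winD (s + 1) v) := by
  rw [card_insert_of_notMem hpA] at hcard
  refine ⟨hcard, fun t h1 h2 => ?_, fun t h1 h2 => ?_⟩
  · refine (subBallot_mono (subBallot_mono h (subset_insert p A)) inter_subset_left) t h1 (by omega)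
  · have hpU : p ∈ winUnion winD 0 v := mem_biUnion.2 ⟨s, mem_Ico.2 ⟨Nat.zero_le s, hs⟩, hp⟩
    have h3 := superBallot_of_subBallot disjoint_winD (u := s + 1) (insert_subset hpU hA)
      (by rw [card_insert_of_notMem hpA]; exact hcard) h t h1 h2
    have hpn : p ∉ winUnion winD t v := fun hq => by
      have h4 := (mem_winUnion_winD h2).1 hq
      linarith [(mem_winD_log.1 hp).2.2, winX_mono h1, h4.2.1]
    have e : insert p A ∩ winUnion winD t v = A ∩ winUnion winD (s + 1) v ∩ winUnion winD t v := by
      rw [insert_inter_of_notMem hpn, inter_assoc, inter_eq_right.2 (winUnion_mono winD h1 le_rfl)]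
    rwa [e] at h3

theorem exists_sum_splitPairs_le : ∃ K : ℝ, 0 < K ∧ ∀ s v : ℕ, s < v →
    ∑ A ∈ (winUnion winD 0 v).powerset, ∑ p ∈ A, (if A.card = v ∧ SubBallot winD 0 v A then
        (∏ p ∈ A, invw p) * (if p ∈ winD s then 2 * ((splitPairs v s p (A.erase p)).card : ℝ) else 0) else 0) ≤
      K * (2 ^ v * ((log 2 * exp 1) ^ v * (decay (s + 1) * decay (v - (s + 1))))) := by
  obtain ⟨K, hK, hmain⟩ := exists_sum_subBallot_superBallot_le
  refine ⟨K, hK, fun s v hs => ?_⟩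
  have hl0 : 0 < log (2 : ℝ) := by linarith [log_two_gt]
  rw [sum_powerset_sum_mem (winUnion winD 0 v) (fun A p => if A.card = v ∧ SubBallot winD 0 v A then
        (∏ p ∈ A, invw p) * (if p ∈ winD s then 2 * ((splitPairs v s p (A.erase p)).card : ℝ) else 0) else 0)]
  have hX := winX_ge s
  have h2s : (0 : ℝ) < 2 ^ s := by positivity
  have hX0 : 0 < winX s := by linarith
  have h1 : ∀ A ∈ (winUnion winD 0 v).powerset,
      ∑ p ∈ winUnion winD 0 v \ A, (if (insert p A).card = v ∧ SubBallot winD 0 v (insert p A) then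
        (∏ p ∈ insert p A, invw p) *
          (if p ∈ winD s then 2 * ((splitPairs v s p ((insert p A).erase p)).card : ℝ) else 0) else 0) ≤
      100 / winX s * 2 ^ v * (if A.card + 1 = v ∧ SubBallot winD 0 (s + 1) (A ∩ winUnion winD 0 (s + 1)) ∧
        SuperBallot winD 0 (s + 1) v (A ∩ winUnion winD (s + 1) v) then
          (∏ p ∈ A, invw p) * 2 ^ (A ∩ winUnion winD 0 (s + 1)).card else 0) := by
    intro A hA
    rw [mem_powerset] at hA
    by_cases hc : A.card + 1 = v ∧ SubBallot winD 0 (s + 1) (A ∩ winUnion winD 0 (s + 1)) ∧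
        SuperBallot winD 0 (s + 1) v (A ∩ winUnion winD (s + 1) v)
    · rw [if_pos hc]
      calc _ ≤ ∑ p ∈ winUnion winD 0 v \ A, if p ∈ winD s then
            2 * (∏ q ∈ A, invw q) * (invw p * (splitPairs v s p A).card) else 0 := by
            refine sum_le_sum fun p hp => ?_
            rw [mem_sdiff] at hp
            have h3 := prod_invw_nonneg A
            have h4 := invw_nonneg p
            rw [erase_insert hp.2, prod_insert hp.2]
            by_cases hps : p ∈ winD s
            · rw [if_pos hps, if_pos hps]
              split_ifs
              · apply le_of_eq; ring
              · positivity
            · rw [if_neg hps, if_neg hps]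
              split_ifs <;> simp
        _ ≤ ∑ p ∈ winD s, 2 * (∏ q ∈ A, invw q) * (invw p * (splitPairs v s p A).card) := by
            rw [← sum_filter]
            refine sum_le_sum_of_subset_of_nonneg (fun p hp => (mem_filter.1 hp).2) fun p _ _ => ?_
            have h3 := prod_invw_nonneg A
            have h4 := invw_nonneg p
            positivity
        _ = 2 * (∏ q ∈ A, invw q) * ∑ p ∈ winD s, invw p * (splitPairs v s p A).card := by rw [mul_sum]
        _ ≤ 2 * (∏ q ∈ A, invw q) * (100 / winX s * (2 ^ A.card * 2 ^ (A ∩ winUnion winD 0 (s + 1)).card)) :=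
            mul_le_mul_of_nonneg_left (sum_invw_card_splitPairs_le v s hA)
              (mul_nonneg (by norm_num) (prod_invw_nonneg A))
        _ = _ := by
            have e : (2 : ℝ) ^ v = 2 ^ A.card * 2 := by rw [← pow_succ, hc.1]
            rw [e]; ring
    · rw [if_neg hc, mul_zero]
      refine sum_nonpos fun p hp => ?_
      rw [mem_sdiff] at hp
      split_ifs with h3 h4
      · exact absurd (ballots_of_insert hs hA h4 hp.2 h3.1 h3.2) hc
      · rw [mul_zero]
      · exact le_rfl
  refine (sum_le_sum h1).trans ?_
  rw [← mul_sum]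
  have h5 := hmain (s + 1) v hs
  refine (mul_le_mul_of_nonneg_left h5 (by positivity)).trans ?_
  have h6 : 100 / winX s * 2 ^ (s + 1) ≤ 1 := by
    rw [div_mul_eq_mul_div, div_le_one hX0, pow_succ]
    linarith
  have hd1 := decay_pos (s + 1)
  have hd2 := decay_pos (v - (s + 1))
  calc _ = 100 / winX s * 2 ^ (s + 1) * (K * (2 ^ v * ((log 2 * exp 1) ^ v * (decay (s + 1) * decay (v - (s + 1)))))) := by ring
    _ ≤ 1 * (K * (2 ^ v * ((log 2 * exp 1) ^ v * (decay (s + 1) * decay (v - (s + 1)))))) :=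
        mul_le_mul_of_nonneg_right h6 (by positivity)
    _ = _ := one_mul _

theorem exists_sum_logPairs_le : ∃ K : ℝ, 0 < K ∧ ∀ v : ℕ,
    ∑ A ∈ (winUnion winD 0 v).powerset, (if A.card = v ∧ SubBallot winD 0 v A then
        (∏ p ∈ A, invw p) * ((logPairs A).card : ℝ) else 0) ≤
      K * (2 ^ v * ((log 2 * exp 1) ^ v * decay v)) := by
  obtain ⟨K, hK, hmain⟩ := exists_sum_splitPairs_le
  refine ⟨3 + K * 18, by positivity, fun v => ?_⟩
  have hl0 : 0 < log (2 : ℝ) := by linarith [log_two_gt]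
  have h1 : ∀ A ∈ (winUnion winD 0 v).powerset, (if A.card = v ∧ SubBallot winD 0 v A then
        (∏ p ∈ A, invw p) * ((logPairs A).card : ℝ) else 0) ≤
      2 ^ v * (if A.card = v ∧ SubBallot winD 0 v A then ∏ p ∈ A, invw p else 0) +
      ∑ s ∈ range v, ∑ p ∈ A, (if A.card = v ∧ SubBallot winD 0 v A then
        (∏ p ∈ A, invw p) * (if p ∈ winD s then 2 * ((splitPairs v s p (A.erase p)).card : ℝ) else 0) else 0) := by
    intro A hA
    have h2 := card_logPairs_le (mem_powerset.1 hA)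
    have h3 : ((logPairs A).card : ℝ) ≤ 2 ^ A.card +
        ∑ s ∈ range v, ∑ p ∈ A, if p ∈ winD s then 2 * ((splitPairs v s p (A.erase p)).card : ℝ) else 0 := by
      exact_mod_cast h2
    by_cases hc : A.card = v ∧ SubBallot winD 0 v A
    · simp only [if_pos hc]
      refine (mul_le_mul_of_nonneg_left h3 (prod_invw_nonneg A)).trans (le_of_eq ?_)
      rw [mul_add, mul_sum, hc.1]
      congr 1
      · ring
      · exact sum_congr rfl fun s _ => by rw [mul_sum]
    · simp only [if_neg hc]
      simp
  refine (sum_le_sum h1).trans ?_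
  rw [sum_add_distrib, ← mul_sum, sum_comm]
  have h4 : ∑ A ∈ (winUnion winD 0 v).powerset, (if A.card = v ∧ SubBallot winD 0 v A then ∏ p ∈ A, invw p else 0) ≤
      3 * ((log 2 * exp 1) ^ v * decay v) := by
    have h5 := subSum_le disjoint_winD invw_nonneg sum_winD_le 0 v v
    rw [zero_add] at h5
    refine (show _ ≤ _ from h5).trans ?_
    have h6 := ballotLE_le v 0 (Nat.zero_le v)
    rw [Nat.sub_zero] at h6
    refine (mul_le_mul_of_nonneg_left h6 (by positivity)).trans (le_of_eq ?_)
    have e : exp (v : ℝ) = exp 1 ^ v := by rw [← exp_nat_mul, mul_one]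
    rw [e, mul_pow]; push_cast; ring
  have h7 : ∑ s ∈ range v, decay (s + 1) * decay (v - (s + 1)) ≤ 18 * decay v := by
    refine le_trans ?_ (sum_decay_mul_decay_le v)
    rw [sum_range_succ' (fun T => decay T * decay (v - T))]
    have := mul_pos (decay_pos 0) (decay_pos (v - 0))
    linarith
  calc _ ≤ 2 ^ v * (3 * ((log 2 * exp 1) ^ v * decay v)) +
        ∑ s ∈ range v, K * 2 ^ v * (log 2 * exp 1) ^ v * (decay (s + 1) * decay (v - (s + 1))) := by
        refine add_le_add (mul_le_mul_of_nonneg_left h4 (by positivity)) (sum_le_sum fun s hs => ?_)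
        refine (hmain s v (mem_range.1 hs)).trans (le_of_eq ?_)
        ring
    _ ≤ 2 ^ v * (3 * ((log 2 * exp 1) ^ v * decay v)) + K * 2 ^ v * (log 2 * exp 1) ^ v * (18 * decay v) := by
        rw [← mul_sum]
        exact add_le_add_right (mul_le_mul_of_nonneg_left h7 (by positivity)) _
    _ = _ := by ring

theorem sum_subBallot_log_le (v : ℕ) :
    ∑ A ∈ (winUnion winD 0 (v + 1)).powerset, (if A.card = v + 1 ∧ SubBallot winD 0 (v + 1) A then
        (∏ p ∈ A, invw p) * log ((∏ p ∈ A, p : ℕ) : ℝ) else 0) ≤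
      2 ^ 19 * 2 ^ (v + 1) * ((log 2 * exp 1) ^ (v + 1) * decay (v + 1)) := by
  have hl := log_two_gt
  have h1 : ∀ A ∈ (winUnion winD 0 (v + 1)).powerset, (if A.card = v + 1 ∧ SubBallot winD 0 (v + 1) A then
        (∏ p ∈ A, invw p) * log ((∏ p ∈ A, p : ℕ) : ℝ) else 0) =
      ∑ p ∈ A, (if A.card = v + 1 ∧ SubBallot winD 0 (v + 1) A then (∏ p ∈ A, invw p) * log (p : ℝ) else 0) := by
    intro A hA
    split_ifs
    · rw [log_prod_eq fun p hp => prime_of_mem_winUnion (mem_powerset.1 hA hp), mul_sum]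
    · simp
  rw [sum_congr rfl h1, sum_powerset_sum_mem (winUnion winD 0 (v + 1)) fun A p =>
    if A.card = v + 1 ∧ SubBallot winD 0 (v + 1) A then (∏ p ∈ A, invw p) * log (p : ℝ) else 0]
  have h2 : ∀ A ∈ (winUnion winD 0 (v + 1)).powerset, ∑ p ∈ winUnion winD 0 (v + 1) \ A,
      (if (insert p A).card = v + 1 ∧ SubBallot winD 0 (v + 1) (insert p A) then
        (∏ p ∈ insert p A, invw p) * log (p : ℝ) else 0) ≤
      2 ^ 15 * 2 ^ (v + 1) * (if A.card = v ∧ SubBallot winD 0 (v + 1) A then ∏ p ∈ A, invw p else 0) := by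
    intro A _
    by_cases hc : A.card = v ∧ SubBallot winD 0 (v + 1) A
    · rw [if_pos hc]
      calc _ ≤ ∑ p ∈ winUnion winD 0 (v + 1) \ A, (∏ q ∈ A, invw q) * (log p * invw p) := by
            refine sum_le_sum fun p hp => ?_
            rw [mem_sdiff] at hp
            have hlog : 0 ≤ log (p : ℝ) := log_natCast_nonneg p
            split_ifs
            · rw [prod_insert hp.2]; apply le_of_eq; ring
            · exact mul_nonneg (prod_invw_nonneg A) (mul_nonneg hlog (invw_nonneg p))
        _ = (∏ q ∈ A, invw q) * ∑ p ∈ winUnion winD 0 (v + 1) \ A, (log p * invw p) := by rw [mul_sum]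
        _ ≤ (∏ q ∈ A, invw q) * (2 ^ 15 * 2 ^ (v + 1)) := by
            refine mul_le_mul_of_nonneg_left ?_ (prod_invw_nonneg A)
            refine le_trans ?_ (sum_log_mul_invw_winUnion_le (v + 1))
            exact sum_le_sum_of_subset_of_nonneg sdiff_subset fun p _ _ =>
              mul_nonneg (log_natCast_nonneg p) (invw_nonneg p)
        _ = _ := by ring
    · rw [if_neg hc, mul_zero]
      refine sum_nonpos fun p hp => ?_
      rw [mem_sdiff] at hp
      rw [if_neg]
      rintro ⟨h3, h4⟩
      rw [card_insert_of_notMem hp.2] at h3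
      exact hc ⟨by omega, subBallot_mono h4 (subset_insert p A)⟩
  refine (sum_le_sum h2).trans ?_
  rw [← mul_sum]
  have h5 := subSum_le disjoint_winD invw_nonneg sum_winD_le 0 (v + 1) v
  have h6 := ballotLE_le (v + 1) 1 (by omega)
  rw [zero_add] at h5
  rw [Nat.add_sub_cancel] at h6
  have hd := decay_pos (v + 1)
  have h7 : ∑ A ∈ (winUnion winD 0 (v + 1)).powerset,
      (if A.card = v ∧ SubBallot winD 0 (v + 1) A then ∏ p ∈ A, invw p else 0) ≤
      16 * ((log 2 * exp 1) ^ (v + 1) * decay (v + 1)) := by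
    refine (show _ ≤ _ from h5).trans ((mul_le_mul_of_nonneg_left h6 (by positivity)).trans ?_)
    have e : exp ((v + 1 : ℕ) : ℝ) = exp 1 ^ (v + 1) := by rw [← exp_nat_mul, mul_one]
    rw [e, mul_pow, pow_succ (log 2)]
    have h8 : 0 ≤ log 2 ^ v * exp 1 ^ (v + 1) * decay (v + 1) := by positivity
    push_cast
    nlinarith
  calc _ ≤ 2 ^ 15 * 2 ^ (v + 1) * (16 * ((log 2 * exp 1) ^ (v + 1) * decay (v + 1))) :=
        mul_le_mul_of_nonneg_left h7 (by positivity)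
    _ = _ := by ring

/-- The sets `A` of exactly `v` primes from the first `v` windows, distributed according to `SubBallot`,
with `log (∏ A) ≤ 2 ^ 22 * 2 ^ v`. -/
noncomputable def coreSets (v : ℕ) : Finset (Finset ℕ) :=
  (winUnion winD 0 v).powerset.filter fun A =>
    (A.card = v ∧ SubBallot winD 0 v A) ∧ log ((∏ p ∈ A, p : ℕ) : ℝ) ≤ 2 ^ 22 * 2 ^ v

theorem le_sum_coreSets (v : ℕ) :
    1 / 4 * ((log 2 * exp 1) ^ (v + 1) * decay (v + 1)) ≤ ∑ A ∈ coreSets (v + 1), ∏ p ∈ A, invw p := by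
  have hl := log_two_gt
  have h1 := le_subSum_winD (v + 1) (v + 1)
  have h2 := le_ballotLE_self (v + 1)
  have h3 := sum_subBallot_log_le v
  have e : exp ((v + 1 : ℕ) : ℝ) = exp 1 ^ (v + 1) := by rw [← exp_nat_mul, mul_one]
  rw [e] at h2
  have h4 : 1 / 2 * ((log 2 * exp 1) ^ (v + 1) * decay (v + 1)) ≤ subSum winD invw 0 (v + 1) (v + 1) := by
    refine le_trans ?_ h1
    rw [mul_pow, mul_assoc (log 2 ^ (v + 1))]
    exact mul_le_mul_of_nonneg_left (mul_le_mul_of_nonneg_left h2 (by positivity)) (by norm_num)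
  set E := (log 2 * exp 1) ^ (v + 1) * decay (v + 1)
  have h2v : (0 : ℝ) < 2 ^ (v + 1) := by positivity
  have h5 : subSum winD invw 0 (v + 1) (v + 1) ≤ ∑ A ∈ coreSets (v + 1), ∏ p ∈ A, invw p +
      1 / (2 ^ 22 * 2 ^ (v + 1)) * ∑ A ∈ (winUnion winD 0 (v + 1)).powerset,
        (if A.card = v + 1 ∧ SubBallot winD 0 (v + 1) A then
        (∏ p ∈ A, invw p) * log ((∏ p ∈ A, p : ℕ) : ℝ) else 0) := by
    rw [subSum, coreSets, sum_filter, mul_sum, ← sum_add_distrib]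
    refine sum_le_sum fun A _ => ?_
    have h0 := prod_invw_nonneg A
    have hlog : 0 ≤ log ((∏ p ∈ A, p : ℕ) : ℝ) := log_natCast_nonneg _
    by_cases hc : A.card = v + 1 ∧ SubBallot winD 0 (v + 1) A
    · rw [if_pos hc, if_pos hc]
      by_cases hL : log ((∏ p ∈ A, p : ℕ) : ℝ) ≤ 2 ^ 22 * 2 ^ (v + 1)
      · rw [if_pos ⟨hc, hL⟩]
        have : 0 ≤ 1 / (2 ^ 22 * 2 ^ (v + 1)) * ((∏ p ∈ A, invw p) * log ((∏ p ∈ A, p : ℕ) : ℝ)) :=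
          mul_nonneg (by positivity) (mul_nonneg h0 hlog)
        linarith
      · rw [if_neg fun h => hL h.2, zero_add, one_div_mul_eq_div, le_div_iff₀ (by positivity)]
        exact mul_le_mul_of_nonneg_left (not_le.1 hL).le h0
    · rw [if_neg hc, if_neg hc, if_neg fun h => hc h.1]
      simp
  have h6 : 1 / (2 ^ 22 * 2 ^ (v + 1)) * ∑ A ∈ (winUnion winD 0 (v + 1)).powerset,
        (if A.card = v + 1 ∧ SubBallot winD 0 (v + 1) A then
        (∏ p ∈ A, invw p) * log ((∏ p ∈ A, p : ℕ) : ℝ) else 0) ≤ 1 / 8 * E := by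
    refine (mul_le_mul_of_nonneg_left h3 (by positivity)).trans (le_of_eq ?_)
    field_simp
    ring
  have hE : 0 < E := mul_pos (by positivity) (decay_pos _)
  linarith

theorem exists_le_sum_coreSets_logCount : ∃ c : ℝ, 0 < c ∧ ∀ v : ℕ,
    c * ((2 * log 2 * exp 1) ^ (v + 1) * decay (v + 1)) ≤
      ∑ A ∈ coreSets (v + 1), (∏ p ∈ A, invw p) * logCount (∏ p ∈ A, p) := by
  obtain ⟨K, hK, hpairs⟩ := exists_sum_logPairs_le
  have hl := log_two_gt
  refine ⟨1 / (16 * K), by positivity, fun v => ?_⟩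
  have h1 := le_sum_coreSets v
  have h2 := hpairs (v + 1)
  have e : (2 * log 2 * exp 1) ^ (v + 1) = 2 ^ (v + 1) * (log 2 * exp 1) ^ (v + 1) := by rw [mul_assoc, mul_pow]
  rw [e, mul_assoc]
  set E := (log 2 * exp 1) ^ (v + 1) * decay (v + 1)
  have hE : 0 < E := mul_pos (by positivity) (decay_pos _)
  set t : ℝ := 1 / (4 * K * 2 ^ (v + 1)) with ht
  have h2v : (0 : ℝ) < 2 ^ (v + 1) := by positivity
  have h3 : ∀ A ∈ coreSets (v + 1), (∏ p ∈ A, invw p) * (4 ^ (v + 1) * (2 * t - t ^ 2 * (logPairs A).card)) ≤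
      (∏ p ∈ A, invw p) * logCount (∏ p ∈ A, p) := by
    intro A hA
    rw [coreSets, mem_filter, mem_powerset] at hA
    refine mul_le_mul_of_nonneg_left ?_ (prod_invw_nonneg A)
    have h4 := four_pow_card_le fun p hp => (prime_of_mem_winUnion (hA.1 hp)).ne_zero
    rw [hA.2.1.1] at h4
    have h5 : (4 : ℝ) ^ (v + 1) ≤ logCount (∏ p ∈ A, p) * (logPairs A).card := by exact_mod_cast h4
    have h6 : (0 : ℝ) ≤ logCount (∏ p ∈ A, p) := Nat.cast_nonneg _
    rcases le_total (2 * t - t ^ 2 * (logPairs A).card) 0 with h7 | h7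
    · exact (mul_nonpos_of_nonneg_of_nonpos (by positivity) h7).trans h6
    · refine (mul_le_mul_of_nonneg_right h5 h7).trans ?_
      nlinarith [mul_nonneg h6 (sq_nonneg (t * (logPairs A).card - 1))]
  have h8 : ∑ A ∈ coreSets (v + 1), (∏ p ∈ A, invw p) * ((logPairs A).card : ℝ) ≤ K * (2 ^ (v + 1) * E) := by
    refine le_trans ?_ h2
    rw [coreSets, sum_filter]
    refine sum_le_sum fun A _ => ?_
    have h9 : 0 ≤ (∏ p ∈ A, invw p) * ((logPairs A).card : ℝ) := mul_nonneg (prod_invw_nonneg A) (Nat.cast_nonneg _)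
    by_cases hc : A.card = v + 1 ∧ SubBallot winD 0 (v + 1) A
    · rw [if_pos hc]
      split_ifs
      exacts [le_rfl, h9]
    · rw [if_neg hc, if_neg fun h => hc h.1]
  refine le_trans ?_ (sum_le_sum h3)
  have h10 : ∑ A ∈ coreSets (v + 1), (∏ p ∈ A, invw p) * (4 ^ (v + 1) * (2 * t - t ^ 2 * (logPairs A).card)) =
      4 ^ (v + 1) * (2 * t * ∑ A ∈ coreSets (v + 1), ∏ p ∈ A, invw p -
        t ^ 2 * ∑ A ∈ coreSets (v + 1), (∏ p ∈ A, invw p) * ((logPairs A).card : ℝ)) := by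
    rw [mul_sum, mul_sum, ← sum_sub_distrib, mul_sum]
    exact sum_congr rfl fun A _ => by ring
  rw [h10]
  have ht0 : 0 < t := by positivity
  have e4 : (4 : ℝ) ^ (v + 1) = 2 ^ (v + 1) * 2 ^ (v + 1) := by rw [← mul_pow]; norm_num
  calc 1 / (16 * K) * (2 ^ (v + 1) * E) = 4 ^ (v + 1) * (2 * t * (1 / 4 * E) - t ^ 2 * (K * (2 ^ (v + 1) * E))) := by
        rw [e4, ht]; field_simp; norm_num
    _ ≤ _ := by
        refine mul_le_mul_of_nonneg_left (sub_le_sub ?_ ?_) (by positivity)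
        · exact mul_le_mul_of_nonneg_left h1 (by positivity)
        · exact mul_le_mul_of_nonneg_left h8 (by positivity)

/-- Primes `p` such that `d * p` is slightly below `y` for some divisor `d` of `a`. -/
noncomputable def outerPrimes (y : ℝ) (a : ℕ) : Finset ℕ :=
  (a.divisors.image (Nat.log 4)).biUnion fun j => primesIoc (y / 4 ^ (j + 1) / 4) (y / 4 ^ (j + 1))

/-- Primes `q` such that `a * p * q` is slightly below `y ^ 2`. -/
noncomputable def innerPrimes (y : ℝ) (a p : ℕ) : Finset ℕ :=
  primesIoc (y * y / (16 * a * p) / 4) (y * y / (16 * a * p))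

theorem mem_outerPrimes {y : ℝ} (hy : 0 < y) {a p M : ℕ} (ha : 16 * ((a : ℝ) * M) ≤ y)
    (hp : p ∈ outerPrimes y a) :
    p.Prime ∧ M < p ∧ (p : ℝ) ≤ y / 4 ∧ ∃ d, d ∣ a ∧ (d : ℝ) * p ≤ y ∧ y ≤ 16 * (d * p) := by
  rw [outerPrimes, mem_biUnion] at hp
  obtain ⟨j, hj, hp⟩ := hp
  rw [mem_primesIoc (by positivity) (by positivity)] at hp
  rw [mem_image] at hj
  obtain ⟨d, hd, rfl⟩ := hj
  rw [Nat.mem_divisors] at hd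
  have hd0 : d ≠ 0 := fun h => hd.2 (by rw [h] at hd; exact Nat.eq_zero_of_zero_dvd hd.1)
  have h1 : (4 : ℝ) ^ Nat.log 4 d ≤ d := by exact_mod_cast Nat.pow_log_le_self 4 hd0
  have h2 : (d : ℝ) < 4 ^ (Nat.log 4 d + 1) := by exact_mod_cast Nat.lt_pow_succ_log_self (b := 4) (by norm_num) d
  have h3 : (d : ℝ) ≤ a := by exact_mod_cast Nat.le_of_dvd (Nat.pos_of_ne_zero hd.2) hd.1
  obtain ⟨hpp, hp1, hp2⟩ := hp
  have hpos : (0 : ℝ) < 4 ^ Nat.log 4 d := by positivity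
  have h1' : (1 : ℝ) ≤ 4 ^ Nat.log 4 d := one_le_pow₀ (by norm_num)
  have hp0 : (0 : ℝ) < p := by exact_mod_cast hpp.pos
  have ha0 : (0 : ℝ) < a := by exact_mod_cast Nat.pos_of_ne_zero hd.2
  rw [pow_succ] at h2 hp1 hp2
  set F : ℝ := 4 ^ Nat.log 4 d
  rw [div_div, div_lt_iff₀ (by positivity)] at hp1
  rw [le_div_iff₀ (by positivity)] at hp2
  refine ⟨hpp, ?_, ?_, d, hd.1, ?_, ?_⟩
  · have h4 : F * 4 * 4 ≤ 16 * a := by linarith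
    have h5 := mul_le_mul_of_nonneg_left h4 hp0.le
    have h6 : (a : ℝ) * M < a * p := by linarith
    exact_mod_cast lt_of_mul_lt_mul_left h6 ha0.le
  · nlinarith
  · nlinarith
  · nlinarith

theorem mem_innerPrimes {y : ℝ} (hy : 0 < y) {a p q M : ℕ} (ha0 : 0 < a) (ha : 16 * ((a : ℝ) * M) ≤ y)
    (hp0 : 0 < p) (hp : (p : ℝ) ≤ y / 4) (hq : q ∈ innerPrimes y a p) :
    q.Prime ∧ M < q ∧ 16 * ((a : ℝ) * p * q) ≤ y * y := by
  have hp' : (0 : ℝ) < p := by exact_mod_cast hp0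
  have ha' : (0 : ℝ) < a := by exact_mod_cast ha0
  rw [innerPrimes, mem_primesIoc (by positivity) (by positivity)] at hq
  obtain ⟨hqp, h1, h2⟩ := hq
  have hq' : (0 : ℝ) < q := by exact_mod_cast hqp.pos
  rw [div_div, div_lt_iff₀ (by positivity)] at h1
  rw [le_div_iff₀ (by positivity)] at h2
  refine ⟨hqp, ?_, by linarith⟩
  have h3 : (q : ℝ) * (16 * a * p * 4) ≤ q * (16 * a * (y / 4) * 4) := by
    refine mul_le_mul_of_nonneg_left ?_ hq'.le
    have := mul_le_mul_of_nonneg_left hp (show 0 ≤ 16 * (a : ℝ) * 4 by positivity)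
    linarith
  have h4 : y * y < y * (16 * a * q) := by linarith
  have h5 : y < 16 * a * q := lt_of_mul_lt_mul_left h4 hy.le
  have h6 : (a : ℝ) * M < a * q := by linarith
  have h7 : (M : ℝ) < q := lt_of_mul_lt_mul_left h6 ha'.le
  exact_mod_cast h7

theorem le_sum_card_innerPrimes {W : ℝ} (hW4 : 4 ≤ W)
    (hW : ∀ w : ℝ, W ≤ w → 1 / 10 * w / log w ≤ (primesIoc (w / 4) w).card)
    {y : ℝ} {a : ℕ} (ha0 : 0 < a) (ha : 4 * W * a ≤ y) :
    y * y / (1600 * log (y * y) ^ 2) * (logCount a / a) ≤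
      ∑ p ∈ outerPrimes y a, ((innerPrimes y a p).card : ℝ) := by
  have ha' : (1 : ℝ) ≤ a := by exact_mod_cast ha0
  have hy16 : 16 ≤ y := by nlinarith
  have hyy : y ≤ y * y := by nlinarith
  set L := log (y * y) with hL
  have hL0 : 0 < L := log_pos (by linarith)
  have hcard : ∀ w : ℝ, W ≤ w → w ≤ y * y → w / (10 * L) ≤ (primesIoc (w / 4) w).card := by
    intro w h1 h2
    refine le_trans ?_ (hW w h1)
    have h3 : log w ≤ L := log_le_log (by linarith) h2
    have h4 : 0 < log w := log_pos (by linarith)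
    rw [one_div_mul_eq_div, div_div]
    exact div_le_div_of_nonneg_left (by linarith) (by positivity) (by linarith)
  have hj : ∀ j ∈ a.divisors.image (Nat.log 4), (4 : ℝ) ^ j ≤ a := by
    intro j hj
    rw [mem_image] at hj
    obtain ⟨d, hd, rfl⟩ := hj
    rw [Nat.mem_divisors] at hd
    have hd0 : d ≠ 0 := fun h => hd.2 (by rw [h] at hd; exact Nat.eq_zero_of_zero_dvd hd.1)
    exact_mod_cast (Nat.pow_log_le_self 4 hd0).trans (Nat.le_of_dvd ha0 hd.1)
  rw [outerPrimes, sum_biUnion]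
  · have h1 : ∀ j ∈ a.divisors.image (Nat.log 4), y * y / (1600 * L ^ 2) * (1 / a) ≤
        ∑ p ∈ primesIoc (y / 4 ^ (j + 1) / 4) (y / 4 ^ (j + 1)), ((innerPrimes y a p).card : ℝ) := by
      intro j hjm
      have h4j := hj j hjm
      have h4j1 : (1 : ℝ) ≤ 4 ^ j := one_le_pow₀ (by norm_num)
      set z := y / 4 ^ (j + 1) with hz
      have hz0 : 0 < z := by positivity
      have hzW : W ≤ z := by
        rw [hz, le_div_iff₀ (by positivity), pow_succ]
        nlinarith
      have hzy : z ≤ y / 4 := by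
        rw [hz, pow_succ]
        exact div_le_div_of_nonneg_left (by linarith) (by norm_num) (by linarith)
      have h2 : ∀ p ∈ primesIoc (z / 4) z, y * y / (16 * a * z) / (10 * L) ≤ ((innerPrimes y a p).card : ℝ) := by
        intro p hp
        rw [mem_primesIoc (by positivity) (by positivity)] at hp
        have hp0 : (0 : ℝ) < p := by exact_mod_cast hp.1.pos
        have hp1 : (1 : ℝ) ≤ p := by exact_mod_cast hp.1.one_le
        refine le_trans (div_le_div_of_nonneg_right ?_ (by positivity)) (hcard (y * y / (16 * a * p)) ?_ ?_)
        · refine div_le_div_of_nonneg_left (by positivity) (by positivity) ?_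
          exact mul_le_mul_of_nonneg_left hp.2.2 (by positivity)
        · rw [le_div_iff₀ (by positivity)]
          have h3 : (p : ℝ) ≤ y / 4 := hp.2.2.trans hzy
          calc W * (16 * a * p) ≤ W * (16 * a * (y / 4)) := by
                refine mul_le_mul_of_nonneg_left (mul_le_mul_of_nonneg_left h3 (by positivity)) (by linarith)
            _ = 4 * W * a * y := by ring
            _ ≤ y * y := mul_le_mul_of_nonneg_right ha (by linarith)
        · refine div_le_self (by positivity) ?_
          nlinarith [mul_le_mul ha' hp1 zero_le_one (by linarith)]
      refine le_trans ?_ (card_nsmul_le_sum _ _ _ h2)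
      rw [nsmul_eq_mul]
      refine le_trans (le_of_eq ?_) (mul_le_mul_of_nonneg_right (hcard z hzW (by linarith)) (by positivity))
      field_simp
      norm_num
    refine le_trans (le_of_eq ?_) (card_nsmul_le_sum _ _ _ h1)
    rw [nsmul_eq_mul, logCount]
    ring
  · intro i _ j _ hij
    rw [Function.onFun, disjoint_left]
    intro p hpi hpj
    have hlt : ∀ i j : ℕ, i < j → p ∈ primesIoc (y / 4 ^ (i + 1) / 4) (y / 4 ^ (i + 1)) →
        p ∈ primesIoc (y / 4 ^ (j + 1) / 4) (y / 4 ^ (j + 1)) → False := by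
      intro i j hij h1 h2
      rw [mem_primesIoc (by positivity) (by positivity)] at h1 h2
      have h3 : (4 : ℝ) ^ (i + 1) * 4 ≤ 4 ^ (j + 1) := by
        rw [← pow_succ]
        exact pow_le_pow_right₀ (by norm_num) (by omega)
      have h4 : y / 4 ^ (j + 1) ≤ y / 4 ^ (i + 1) / 4 := by
        rw [div_div]
        exact div_le_div_of_nonneg_left (by linarith) (by positivity) h3
      linarith [h1.2.1, h2.2.2]
    rcases lt_or_gt_of_ne hij with h | h
    · exact hlt i j h hpi hpj
    · exact hlt j i h hpj hpi

theorem prime_dvd_smooth_mul {a p q r M : ℕ} (ha0 : 0 < a) (ha : a ≤ M) (hp : p.Prime) (hq : q.Prime)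
    (hr : r.Prime) (hrM : M < r) (h : r ∣ a * p * q) : r = p ∨ r = q := by
  rcases hr.dvd_mul.1 h with h | h
  · rcases hr.dvd_mul.1 h with h | h
    · exact absurd (Nat.le_of_dvd ha0 h) (by omega)
    · exact Or.inl ((Nat.prime_dvd_prime_iff_eq hr hp).1 h)
  · exact Or.inr ((Nat.prime_dvd_prime_iff_eq hr hq).1 h)

theorem eq_of_smooth_mul_prime_eq {a b q r M : ℕ} (ha0 : 0 < a) (ha : a ≤ M)
    (hq : q.Prime) (hr : r.Prime) (hrM : M < r) (h : a * q = b * r) : a = b ∧ q = r := by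
  have h1 : r ∣ a * q := h ▸ Dvd.intro_left b rfl
  have h2 : r = q := by
    rcases hr.dvd_mul.1 h1 with h | h
    · exact absurd (Nat.le_of_dvd ha0 h) (by omega)
    · exact (Nat.prime_dvd_prime_iff_eq hr hq).1 h
  subst h2
  exact ⟨Nat.eq_of_mul_eq_mul_right hr.pos h, rfl⟩

theorem prod_primes_injective {A B : Finset ℕ} (hA : ∀ p ∈ A, p.Prime) (hB : ∀ p ∈ B, p.Prime)
    (h : ∏ p ∈ A, p = ∏ p ∈ B, p) : A = B := by
  rw [← Nat.primeFactors_prod hA, ← Nat.primeFactors_prod hB, h]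

theorem sum_card_innerPrimes_le {N M : ℕ} (hN : 0 < N) {y : ℝ} (hy : y = √N) (S : Finset (Finset ℕ))
    (hS : ∀ A ∈ S, (∀ p ∈ A, p.Prime) ∧ ∏ p ∈ A, p ≤ M) (hM : 16 * ((M : ℝ) * M) ≤ y) :
    ∑ A ∈ S, ∑ p ∈ outerPrimes y (∏ p ∈ A, p), (innerPrimes y (∏ p ∈ A, p) p).card ≤ 2 * multTableCount N := by
  have hy0 : 0 < y := by rw [hy]; exact sqrt_pos.2 (by exact_mod_cast hN)
  have hyy : y * y = N := by rw [hy]; exact mul_self_sqrt (Nat.cast_nonneg N)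
  set T := S.sigma fun A => (outerPrimes y (∏ p ∈ A, p)).sigma fun p => innerPrimes y (∏ p ∈ A, p) p with hT
  have hcard : ∑ A ∈ S, ∑ p ∈ outerPrimes y (∏ p ∈ A, p), (innerPrimes y (∏ p ∈ A, p) p).card = T.card := by
    rw [hT, card_sigma]
    exact sum_congr rfl fun A _ => (card_sigma _ _).symm
  set f : ((_ : Finset ℕ) × (_ : ℕ) × ℕ) → ℕ := fun x => (∏ p ∈ x.1, p) * x.2.1 * x.2.2 with hf
  have hmem : ∀ x ∈ T, (∀ p ∈ x.1, p.Prime) ∧ 0 < ∏ p ∈ x.1, p ∧ ∏ p ∈ x.1, p ≤ M ∧ x.2.1.Prime ∧ M < x.2.1 ∧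
      x.2.2.Prime ∧ M < x.2.2 ∧ 16 * (f x : ℝ) ≤ N ∧
      ∃ d, d ∣ ∏ p ∈ x.1, p ∧ (d : ℝ) * x.2.1 ≤ y ∧ y ≤ 16 * (d * x.2.1) := by
    rintro ⟨A, p, q⟩ hx
    rw [hT, mem_sigma, mem_sigma] at hx
    obtain ⟨hA, hp, hq⟩ := hx
    dsimp only at hA hp hq ⊢
    obtain ⟨hAp, hAM⟩ := hS A hA
    have ha0 := Nat.pos_of_ne_zero (prod_primes_ne_zero hAp)
    simp only [hf]
    set a := ∏ p ∈ A, p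
    have haM : 16 * ((a : ℝ) * M) ≤ y := by
      refine le_trans ?_ hM
      have : (a : ℝ) ≤ M := by exact_mod_cast hAM
      exact mul_le_mul_of_nonneg_left (mul_le_mul_of_nonneg_right this (Nat.cast_nonneg M)) (by norm_num)
    obtain ⟨hpp, hpM, hpy, hd⟩ := mem_outerPrimes hy0 haM hp
    obtain ⟨hqp, hqM, hqy⟩ := mem_innerPrimes hy0 ha0 haM hpp.pos hpy hq
    refine ⟨hAp, ha0, hAM, hpp, hpM, hqp, hqM, ?_, hd⟩
    rw [← hyy]
    push_cast
    exact hqy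
  rw [hcard]
  have himage : T.image f ⊆ (Icc 1 N).filter
      (fun k => ∃ n m : ℕ, (n : ℝ) ≤ √N ∧ (m : ℝ) ≤ √N ∧ k = n * m) := by
    intro k hk
    rw [mem_image] at hk
    obtain ⟨x, hx, rfl⟩ := hk
    obtain ⟨_, ha0, _, hp, _, hq, _, hfx, d, ⟨e, hde⟩, hd1, hd2⟩ := hmem x hx
    have hfx1 : f x = d * x.2.1 * (e * x.2.2) := by
      simp only [hf]; rw [hde]; ring
    have hp0 : (0 : ℝ) < x.2.1 := by exact_mod_cast hp.pos
    have hf0 : 0 < f x := Nat.mul_pos (Nat.mul_pos ha0 hp.pos) hq.pos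
    have hd0 : 0 < d := Nat.pos_of_ne_zero fun h => by rw [h, Nat.zero_mul] at hde; omega
    have hd0' : (0 : ℝ) < d := by exact_mod_cast hd0
    rw [mem_filter, mem_Icc]
    refine ⟨⟨hf0, ?_⟩, d * x.2.1, e * x.2.2, ?_, ?_, hfx1⟩
    · have : (f x : ℝ) ≤ N := by
        have : (0 : ℝ) ≤ f x := Nat.cast_nonneg _
        linarith
      exact_mod_cast this
    · rw [← hy]; exact_mod_cast hd1
    · rw [← hy]
      rw [hfx1, ← hyy] at hfx
      push_cast at hfx ⊢
      set E : ℝ := (e : ℝ) * x.2.2 with hE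
      have hE0 : 0 ≤ E := by positivity
      have h1 : y * E ≤ 16 * (d * x.2.1) * E := mul_le_mul_of_nonneg_right hd2 hE0
      exact le_of_mul_le_mul_left (by linarith) hy0
  have hfib : ∀ k ∈ T.image f, (T.filter fun x => f x = k).card ≤ 2 := by
    intro k hk
    rw [mem_image] at hk
    obtain ⟨x, hx, rfl⟩ := hk
    obtain ⟨_, ha0, haM, hp, hpM, hq, hqM, _, _⟩ := hmem x hx
    refine le_trans (card_le_card_of_injOn (t := {x.2.1, x.2.2}) (fun z => z.2.1) ?_ ?_) (card_le_two)
    · intro z hz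
      rw [mem_coe, mem_filter] at hz
      obtain ⟨_, hz0, hzM, hzp, hzpM, hzq, hzqM, _, _⟩ := hmem z hz.1
      rw [mem_coe, mem_insert, mem_singleton]
      refine prime_dvd_smooth_mul ha0 haM hp hq hzp hzpM ?_
      change z.2.1 ∣ f x
      rw [← hz.2]
      exact Dvd.dvd.mul_right (Dvd.intro_left _ rfl) _
    · intro z hz w hw hzw
      rw [mem_coe, mem_filter] at hz hw
      obtain ⟨hzA, hz0, hzM, hzp, hzpM, hzq, hzqM, _, _⟩ := hmem z hz.1
      obtain ⟨hwA, hw0, hwM, hwp, hwpM, hwq, hwqM, _, _⟩ := hmem w hw.1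
      have h1 : f z = f w := hz.2.trans hw.2.symm
      obtain ⟨A, p, q⟩ := z
      obtain ⟨B, p', q'⟩ := w
      dsimp only at *
      subst hzw
      have h2 : (∏ p ∈ A, p) * q = (∏ p ∈ B, p) * q' := by
        refine Nat.eq_of_mul_eq_mul_right hzp.pos ?_
        calc _ = (∏ p ∈ A, p) * p * q := by ring
          _ = (∏ p ∈ B, p) * p * q' := h1
          _ = _ := by ring
      obtain ⟨h3, rfl⟩ := eq_of_smooth_mul_prime_eq hz0 hzM hzq hwq hwqM h2
      rw [prod_primes_injective hzA hwA h3]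
  refine (card_le_mul_card_image T 2 hfib).trans (Nat.mul_le_mul_left 2 ?_)
  exact card_le_card himage

theorem exists_le_multTableCount : ∃ c : ℝ, 0 < c ∧ ∃ v₀ : ℕ, ∀ N v : ℕ, v₀ ≤ v →
    winX v < log N → log N ≤ winX (v + 1) →
    c * N * ((log 2 * exp 1 / 2) ^ v * decay v) ≤ multTableCount N := by
  obtain ⟨c, hc, hcore⟩ := exists_le_sum_coreSets_logCount
  obtain ⟨W, hW4, hW⟩ := exists_le_card_primesIoc
  have hl := log_two_gt
  refine ⟨c / (3200 * 2 ^ 30 * (2 * log 2 * exp 1) ^ 13), by positivity, ⌈log (4 * W)⌉₊ + 14, fun N v hv h1 h2 => ?_⟩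
  have h2v : (1 : ℝ) ≤ 2 ^ v := one_le_pow₀ (by norm_num)
  have hX := winX_ge v
  have hN : 0 < N := Nat.pos_of_ne_zero fun h => by
    rw [h, Nat.cast_zero, log_zero] at h1
    linarith
  have hN' : (0 : ℝ) < N := by exact_mod_cast hN
  obtain ⟨u, rfl⟩ : ∃ u, v = u + 1 + 13 := ⟨v - 14, by omega⟩
  set v := u + 1 + 13 with hvdef
  have h4W : 4 * W ≤ exp (2 ^ v) := by
    rw [← log_le_iff_le_exp (by linarith)]
    have h3 : (⌈log (4 * W)⌉₊ : ℝ) ≤ v := by exact_mod_cast (by omega : ⌈log (4 * W)⌉₊ ≤ v)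
    have h4 : (v : ℝ) ≤ 2 ^ v := by exact_mod_cast Nat.lt_two_pow_self.le
    linarith [Nat.le_ceil (log (4 * W))]
  obtain ⟨y, hy⟩ : ∃ y, y = √(N : ℝ) := ⟨_, rfl⟩
  have hyy : y * y = N := by rw [hy]; exact mul_self_sqrt (Nat.cast_nonneg N)
  have hyexp : exp (6072 * 2 ^ v) ≤ y := by
    rw [hy]
    refine le_sqrt_of_sq_le ?_
    rw [← exp_nat_mul, ← exp_log hN']
    refine exp_le_exp.2 ?_
    push_cast
    linarith
  set M : ℕ := ⌊exp (2 ^ 9 * 2 ^ v)⌋₊ with hM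
  have hMexp : (M : ℝ) ≤ exp (2 ^ 9 * 2 ^ v) := Nat.floor_le (exp_pos _).le
  have hMM : 16 * ((M : ℝ) * M) ≤ y := by
    refine le_trans ?_ hyexp
    calc 16 * ((M : ℝ) * M) ≤ exp (2 ^ v) * (exp (2 ^ 9 * 2 ^ v) * exp (2 ^ 9 * 2 ^ v)) := by
          refine mul_le_mul (by linarith) (mul_le_mul hMexp hMexp (Nat.cast_nonneg _) (exp_pos _).le)
            (by positivity) (exp_pos _).le
      _ = exp (2 ^ v + (2 ^ 9 * 2 ^ v + 2 ^ 9 * 2 ^ v)) := by rw [exp_add, exp_add]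
      _ ≤ _ := exp_le_exp.2 (by linarith)
  have hS : ∀ A ∈ coreSets (u + 1), (∀ p ∈ A, p.Prime) ∧ ∏ p ∈ A, p ≤ M := by
    intro A hA
    rw [coreSets, mem_filter, mem_powerset] at hA
    have hp : ∀ p ∈ A, p.Prime := fun p hp => prime_of_mem_winUnion (hA.1 hp)
    refine ⟨hp, Nat.le_floor ?_⟩
    have h0 : (0 : ℝ) < (∏ p ∈ A, p : ℕ) := by exact_mod_cast Nat.pos_of_ne_zero (prod_primes_ne_zero hp)
    rw [← log_le_iff_le_exp h0]
    refine hA.2.2.trans (le_of_eq ?_)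
    rw [hvdef, pow_add 2 (u + 1) 13]
    ring
  have hcount := sum_card_innerPrimes_le hN hy (coreSets (u + 1)) hS hMM
  have hcount' : ∑ A ∈ coreSets (u + 1), ∑ p ∈ outerPrimes y (∏ p ∈ A, p), ((innerPrimes y (∏ p ∈ A, p) p).card : ℝ) ≤
      2 * multTableCount N := by exact_mod_cast hcount
  have hlow : ∀ A ∈ coreSets (u + 1), (N : ℝ) / (1600 * log N ^ 2) * ((∏ p ∈ A, invw p) * logCount (∏ p ∈ A, p)) ≤
      ∑ p ∈ outerPrimes y (∏ p ∈ A, p), ((innerPrimes y (∏ p ∈ A, p) p).card : ℝ) := by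
    intro A hA
    obtain ⟨hp, haM⟩ := hS A hA
    have ha0 := Nat.pos_of_ne_zero (prod_primes_ne_zero hp)
    have haM' : ((∏ p ∈ A, p : ℕ) : ℝ) ≤ M := by exact_mod_cast haM
    have h3 : 4 * W * ((∏ p ∈ A, p : ℕ) : ℝ) ≤ y := by
      refine le_trans ?_ hyexp
      calc 4 * W * ((∏ p ∈ A, p : ℕ) : ℝ) ≤ exp (2 ^ v) * exp (2 ^ 9 * 2 ^ v) :=
            mul_le_mul h4W (haM'.trans hMexp) (Nat.cast_nonneg _) (exp_pos _).le
        _ = exp (2 ^ v + 2 ^ 9 * 2 ^ v) := by rw [exp_add]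
        _ ≤ _ := exp_le_exp.2 (by linarith)
    have h4 := le_sum_card_innerPrimes hW4 hW ha0 h3
    rw [hyy] at h4
    refine le_trans (le_of_eq ?_) h4
    have e : ∏ p ∈ A, invw p = 1 / ((∏ p ∈ A, p : ℕ) : ℝ) := by
      push_cast
      simp only [invw, one_div, prod_inv_distrib]
    rw [e]; ring
  have hsum := (sum_le_sum hlow).trans hcount'
  rw [← mul_sum] at hsum
  have hlogN : 0 < log (N : ℝ) := by linarith
  have h3 := (mul_le_mul_of_nonneg_left (hcore u)
    (show 0 ≤ (N : ℝ) / (1600 * log N ^ 2) by positivity)).trans hsum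
  have hlogN2 : log (N : ℝ) ^ 2 ≤ 2 ^ 30 * (2 ^ v * 2 ^ v) := by
    have h4 : log (N : ℝ) ≤ 2 ^ 15 * 2 ^ v := by
      refine (h2.trans (winX_le (v + 1))).trans (le_of_eq ?_)
      ring
    calc log (N : ℝ) ^ 2 ≤ (2 ^ 15 * 2 ^ v) ^ 2 := pow_le_pow_left₀ hlogN.le h4 2
      _ = _ := by ring
  have hdec : decay v ≤ decay (u + 1) := decay_anti (by omega)
  have hd0 := decay_pos v
  have hd1 := decay_pos (u + 1)
  have e1 : (2 * log 2 * exp 1) ^ v = (2 * log 2 * exp 1) ^ (u + 1) * (2 * log 2 * exp 1) ^ 13 := by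
    rw [hvdef, pow_add]
  have e2 : (log 2 * exp 1 / 2) ^ v = (2 * log 2 * exp 1) ^ v / (2 ^ v * 2 ^ v) := by
    rw [← mul_pow, ← div_pow]
    congr 1; ring
  have h5 : c * N * ((2 * log 2 * exp 1) ^ (u + 1) * decay v) / (1600 * (2 ^ 30 * (2 ^ v * 2 ^ v))) ≤
      2 * multTableCount N := by
    refine le_trans ?_ h3
    rw [div_mul_eq_mul_div]
    refine div_le_div₀ (by positivity) ?_ (by positivity) ?_
    · have := mul_le_mul_of_nonneg_left hdec (show 0 ≤ c * N * (2 * log 2 * exp 1) ^ (u + 1) by positivity)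
      linarith
    · exact mul_le_mul_of_nonneg_left hlogN2 (by norm_num)
  have e3 : c / (3200 * 2 ^ 30 * (2 * log 2 * exp 1) ^ 13) * N * ((log 2 * exp 1 / 2) ^ v * decay v) =
      1 / 2 * (c * N * ((2 * log 2 * exp 1) ^ (u + 1) * decay v) / (1600 * (2 ^ 30 * (2 ^ v * 2 ^ v)))) := by
    rw [e2, e1]
    have h6 : (2 * log 2 * exp 1) ^ 13 ≠ 0 := by positivity
    generalize (2 * log 2 * exp 1) ^ 13 = z at h6
    field_simp
    norm_num
  rw [e3]
  linarith

theorem exists_window {L : ℝ} {v₀ : ℕ} (hL : winX v₀ < L) : ∃ v, v₀ ≤ v ∧ winX v < L ∧ L ≤ winX (v + 1) := by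
  have hex : ∃ n, L ≤ winX n := by
    obtain ⟨n, hn⟩ := pow_unbounded_of_one_lt L (one_lt_two)
    exact ⟨n, by linarith [two_pow_le_winX n]⟩
  have h1 := Nat.find_spec hex
  have h2 : v₀ < Nat.find hex := by
    by_contra h
    exact absurd (h1.trans (winX_mono (not_lt.1 h))) (not_le.2 hL)
  obtain ⟨v, hv⟩ : ∃ v, Nat.find hex = v + 1 := ⟨Nat.find hex - 1, by omega⟩
  refine ⟨v, by omega, ?_, hv ▸ h1⟩
  exact not_le.1 (Nat.find_min hex (by omega))

theorem decay_eq_rpow (v : ℕ) : decay v = 1 / ((v : ℝ) + 1) ^ ((3 : ℝ) / 2) := by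
  have h : (0 : ℝ) < (v : ℝ) + 1 := by positivity
  rw [decay, sqrt_eq_rpow, show (3 : ℝ) / 2 = 1 + 1 / 2 by norm_num, rpow_add h, rpow_one]

/-- The size of `multTableCount N / N` in terms of `log N` and of the window containing `log N`. -/
theorem exists_decay_mul_log_bounds : ∃ k K : ℝ, 0 < k ∧ 0 < K ∧ ∀ (L : ℝ) (v : ℕ), winX v < L → L ≤ winX (v + 1) →
    k ≤ (log 2 * exp 1 / 2) ^ v * decay v *
      (L ^ (1 - (1 + log (log 2)) / log 2) * log L ^ ((3 : ℝ) / 2)) ∧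
    (log 2 * exp 1 / 2) ^ v * decay v *
      (L ^ (1 - (1 + log (log 2)) / log 2) * log L ^ ((3 : ℝ) / 2)) ≤ K := by
  have hl := log_two_gt
  have hl2 := log_two_lt
  have hl0 : 0 < log (2 : ℝ) := by linarith
  set δ := 1 - (1 + log (log 2)) / log 2 with hδ
  refine ⟨exp (-(15 * |δ|)) * (1 / 2 : ℝ) ^ ((3 : ℝ) / 2), exp (15 * |δ|) * (15 : ℝ) ^ ((3 : ℝ) / 2),
    by positivity, by positivity, fun L v h1 h2 => ?_⟩
  have h2v : (1 : ℝ) ≤ 2 ^ v := one_le_pow₀ (by norm_num)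
  have hX := winX_ge v
  have hL0 : 0 < L := by linarith
  have hlog1 : log L ≤ 15 * log 2 + v * log 2 := by
    have h3 : L ≤ 2 ^ (15 + v) := by
      refine (h2.trans (winX_le (v + 1))).trans (le_of_eq ?_)
      ring
    have h4 := log_le_log hL0 h3
    rw [log_pow] at h4
    push_cast at h4
    linarith
  have hlog2 : 10 * log 2 + v * log 2 ≤ log L := by
    have h3 : (2 : ℝ) ^ (10 + v) ≤ L := by
      rw [pow_add]
      linarith
    have h4 := log_le_log (by positivity) h3
    rw [log_pow] at h4
    push_cast at h4
    linarith
  have hpow : (log 2 * exp 1 / 2) ^ v = exp (-(δ * (v * log 2))) := by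
    have h3 : log (log 2 * exp 1 / 2) = -(δ * log 2) := by
      rw [log_div (by positivity) (by norm_num), log_mul (by positivity) (by positivity), log_exp, hδ]
      field_simp
      ring
    rw [← exp_log (show 0 < log 2 * exp 1 / 2 by positivity), h3, ← exp_nat_mul]
    congr 1; ring
  have hmain : (log 2 * exp 1 / 2) ^ v * decay v * (L ^ δ * log L ^ ((3 : ℝ) / 2)) =
      exp (δ * (log L - v * log 2)) * (log L / ((v : ℝ) + 1)) ^ ((3 : ℝ) / 2) := by
    have hv0 : (0 : ℝ) ≤ v := Nat.cast_nonneg v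
    rw [div_rpow (by nlinarith) (by positivity), decay_eq_rpow, hpow, rpow_def_of_pos hL0 δ,
      show δ * (log L - v * log 2) = -(δ * (v * log 2)) + log L * δ by ring, exp_add]
    ring
  rw [hmain]
  have hv0 : (0 : ℝ) ≤ v := Nat.cast_nonneg v
  have hx0 : 0 ≤ log L - v * log 2 := by linarith
  have hx1 : log L - v * log 2 ≤ 15 := by linarith
  have habs : |δ * (log L - v * log 2)| ≤ 15 * |δ| := by
    rw [abs_mul, abs_of_nonneg hx0, mul_comm]
    exact mul_le_mul_of_nonneg_right hx1 (abs_nonneg δ)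
  have hr1 : 1 / 2 ≤ log L / ((v : ℝ) + 1) := by
    rw [le_div_iff₀ (by positivity)]
    nlinarith
  have hr2 : log L / ((v : ℝ) + 1) ≤ 15 := by
    rw [div_le_iff₀ (by positivity)]
    nlinarith
  rw [abs_le] at habs
  constructor
  · exact mul_le_mul (exp_le_exp.2 habs.1) (rpow_le_rpow (by norm_num) hr1 (by norm_num)) (by positivity) (exp_pos _).le
  · exact mul_le_mul (exp_le_exp.2 habs.2) (rpow_le_rpow (by linarith) hr2 (by norm_num))
      (rpow_nonneg (by linarith) _) (exp_pos _).le

end FordMult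

/-- Ford's multiplication table theorem:
`M(N) ≍ N / ((log N)^δ (log log N)^{3/2})` with `δ = 1 − (1 + log log 2)/log 2`. -/
theorem ford_multiplication_table :
    ∃ c₁ c₂ : ℝ, 0 < c₁ ∧ 0 < c₂ ∧ ∃ N₀ : ℕ, ∀ N : ℕ, N₀ ≤ N →
      c₁ * N / ((Real.log N) ^ (1 - (1 + Real.log (Real.log 2)) / Real.log 2) *
          (Real.log (Real.log N)) ^ ((3 : ℝ) / 2)) ≤ (multTableCount N : ℝ) ∧
      (multTableCount N : ℝ) ≤
        c₂ * N / ((Real.log N) ^ (1 - (1 + Real.log (Real.log 2)) / Real.log 2) *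
          (Real.log (Real.log N)) ^ ((3 : ℝ) / 2)) := by
  obtain ⟨K, hK, hupper⟩ := FordMult.exists_multTableCount_le
  obtain ⟨c, hc, v₀, hlower⟩ := FordMult.exists_le_multTableCount
  obtain ⟨k, k', hk, hk', hbounds⟩ := FordMult.exists_decay_mul_log_bounds
  refine ⟨c * k, K * k', by positivity, by positivity, ⌈Real.exp (FordMult.winX v₀ + 1)⌉₊, fun N hN => ?_⟩
  have hN1 : Real.exp (FordMult.winX v₀ + 1) ≤ N := (Nat.le_ceil _).trans (by exact_mod_cast hN)
  have hN0 : (0 : ℝ) < N := (Real.exp_pos _).trans_le hN1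
  have hlog : FordMult.winX v₀ < Real.log N := by
    rw [← Real.le_log_iff_exp_le hN0] at hN1
    linarith
  obtain ⟨v, hv, h1, h2⟩ := FordMult.exists_window hlog
  obtain ⟨hb1, hb2⟩ := hbounds _ v h1 h2
  have hlogpos : 1 < Real.log N := by linarith [FordMult.winX_big v]
  have hloglog := Real.log_pos hlogpos
  set D := Real.log N ^ (1 - (1 + Real.log (Real.log 2)) / Real.log 2) * Real.log (Real.log N) ^ ((3 : ℝ) / 2) with hD
  have hD0 : 0 < D := mul_pos (Real.rpow_pos_of_pos (by linarith) _) (Real.rpow_pos_of_pos hloglog _)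
  set E := (Real.log 2 * Real.exp 1 / 2) ^ v * FordMult.decay v
  constructor
  · refine le_trans ?_ (hlower N v hv h1 h2)
    rw [div_le_iff₀ hD0]
    calc c * k * N = c * N * k := by ring
      _ ≤ c * N * (E * D) := mul_le_mul_of_nonneg_left hb1 (by positivity)
      _ = c * N * E * D := by ring
  · refine (hupper N v h1 h2).trans ?_
    rw [le_div_iff₀ hD0]
    calc K * N * E * D = K * N * (E * D) := by ring
      _ ≤ K * N * k' := mul_le_mul_of_nonneg_left hb2 (by positivity)
      _ = K * k' * N := by ring
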